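/- Let D be the time-dependent operator Dξ = ∂_sξ + J₀∂_tξ + S(s,t)ξ on the half strip I = ℝ^±, and assume hypothesis (H1). Then there exist a constant c > 0 and a compact operator K : H²_{bc}(ℝ^±×[0,1]) → H¹_{bc}(ℝ^±×[0,1]) such that for all ξ ∈ H²_{bc}(ℝ^±×[0,1]): ‖ξ‖_{W^{2,2}} ≤ c·( ‖Dξ‖_{W^{1,2}} + ‖Kξ‖_{W^{1,2}} + ‖π^±_A(ξ(0,·))‖_{3/2} ). -/

import Mathlib

open scoped RealInnerProductSpace Classical
open MeasureTheory Set

noncomputable section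

variable {E : Type*} [NormedAddCommGroup E] [InnerProductSpace ℝ E]

/-- The strip `I × [0,1] ⊆ ℝ²`. -/
def Strip (I : Set ℝ) : Set (ℝ × ℝ) := I ×ˢ Icc (0:ℝ) 1

/-- Strong representative of a `W^{1,2}` function on the strip over `I`,
with total derivative `Du`. -/
def W12On (I : Set ℝ) (u : ℝ × ℝ → E) (Du : ℝ × ℝ → ℝ × ℝ →L[ℝ] E) : Prop :=
  (∀ p ∈ Strip I, HasFDerivWithinAt u (Du p) (Strip I) p) ∧
  IntegrableOn (fun p => ‖u p‖ ^ 2) (Strip I) volume ∧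
  IntegrableOn (fun p => ‖Du p (1, 0)‖ ^ 2) (Strip I) volume ∧
  IntegrableOn (fun p => ‖Du p (0, 1)‖ ^ 2) (Strip I) volume

/-- Strong representative of a `W^{2,2}` function on the strip over `I`. -/
def W22On (I : Set ℝ) (u : ℝ × ℝ → E) (Du : ℝ × ℝ → ℝ × ℝ →L[ℝ] E)
    (D2u : ℝ × ℝ → ℝ × ℝ →L[ℝ] ℝ × ℝ →L[ℝ] E) : Prop :=
  W12On I u Du ∧
  (∀ p ∈ Strip I, HasFDerivWithinAt Du (D2u p) (Strip I) p) ∧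
  IntegrableOn (fun p => ‖D2u p (1, 0) (1, 0)‖ ^ 2) (Strip I) volume ∧
  IntegrableOn (fun p => ‖D2u p (1, 0) (0, 1)‖ ^ 2) (Strip I) volume ∧
  IntegrableOn (fun p => ‖D2u p (0, 1) (0, 1)‖ ^ 2) (Strip I) volume

/-- The Lagrangian boundary condition `u(s,0), u(s,1) ∈ Λ`. -/
def LagBC (Λ : Submodule ℝ E) (I : Set ℝ) (u : ℝ × ℝ → E) : Prop :=
  ∀ s ∈ I, u (s, 0) ∈ Λ ∧ u (s, 1) ∈ Λ

/-- The second boundary condition `Aξ(s,0), Aξ(s,1) ∈ Λ` for `A = J∂_t + S₁(t)`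
(part of membership in `H²_bc`). -/
def LagBC2 (Λ : Submodule ℝ E) (J : E →L[ℝ] E) (S1 : ℝ → E →L[ℝ] E)
    (I : Set ℝ) (u : ℝ × ℝ → E) (Du : ℝ × ℝ → ℝ × ℝ →L[ℝ] E) : Prop :=
  ∀ s ∈ I, J (Du (s, 0) (0, 1)) + S1 0 (u (s, 0)) ∈ Λ ∧
           J (Du (s, 1) (0, 1)) + S1 1 (u (s, 1)) ∈ Λ

/-- Hypothesis (HA) for `A = J∂_t + S₁(t)` on paths with boundary conditions in `Λ`,
encoded through a complete orthonormal family `(x i)` of eigenfunctions with nonzero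
eigenvalues `μ i`. -/
def EigenData (J : E →L[ℝ] E) (Λ : Submodule ℝ E) (S1 : ℝ → E →L[ℝ] E)
    {ι : Type*} (x : ι → ℝ → E) (μ : ι → ℝ) : Prop :=
  (∀ i, ContDiff ℝ (⊤ : ℕ∞) (x i)) ∧
  (∀ i, μ i ≠ 0) ∧
  (∀ i, x i 0 ∈ Λ ∧ x i 1 ∈ Λ) ∧
  (∀ i t, J (deriv (x i) t) + S1 t (x i t) = μ i • x i t) ∧
  (∀ i j, (∫ t in (0:ℝ)..1, ⟪x i t, x j t⟫) = if i = j then 1 else 0) ∧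
  (∀ y : ℝ → E, ContinuousOn y (Icc 0 1) →
    (∀ i, (∫ t in (0:ℝ)..1, ⟪y t, x i t⟫) = 0) → ∀ t ∈ Icc 0 1, y t = 0)

/-- The coefficient of a path `γ : [0,1] → E` on the eigenfunction `x i`. -/
def coeff {ι : Type*} (x : ι → ℝ → E) (γ : ℝ → E) (i : ι) : ℝ :=
  ∫ t in (0:ℝ)..1, ⟪γ t, x i t⟫

/-- Membership in the negative spectral subspace `E⁻`. -/
def InEneg {ι : Type*} (x : ι → ℝ → E) (μ : ι → ℝ) (γ : ℝ → E) : Prop :=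
  ∀ i, 0 < μ i → coeff x γ i = 0

/-- Membership in the positive spectral subspace `E⁺`. -/
def InEpos {ι : Type*} (x : ι → ℝ → E) (μ : ι → ℝ) (γ : ℝ → E) : Prop :=
  ∀ i, μ i < 0 → coeff x γ i = 0

/-- The operator `D u = ∂_s u + J ∂_t u + S(s,t) u` (evaluated pointwise using the
derivative data `Du`). -/
def Dop (J : E →L[ℝ] E) (S : ℝ → ℝ → E →L[ℝ] E) (u : ℝ × ℝ → E)
    (Du : ℝ × ℝ → ℝ × ℝ →L[ℝ] E) (p : ℝ × ℝ) : E :=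
  Du p (1, 0) + J (Du p (0, 1)) + S p.1 p.2 (u p)

/-- The `E^{3/2}`-norm `‖γ‖_{3/2}` of a path, via the eigenvector expansion. -/
def norm32 {ι : Type*} (x : ι → ℝ → E) (μ : ι → ℝ) (γ : ℝ → E) : ℝ :=
  Real.sqrt (∑' i, |μ i| ^ 3 * coeff x γ i ^ 2)

/-- `‖π_P γ‖_{3/2}`, where `π_P` is the spectral projection keeping the eigenmodes
with `P (μ i)`. -/
def norm32P {ι : Type*} (x : ι → ℝ → E) (μ : ι → ℝ) (P : ℝ → Prop) (γ : ℝ → E) : ℝ :=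
  Real.sqrt (∑' i, if P (μ i) then |μ i| ^ 3 * coeff x γ i ^ 2 else 0)

/-- The `L²`-norm over the strip. -/
def normL2 (I : Set ℝ) (v : ℝ × ℝ → E) : ℝ :=
  Real.sqrt (∫ p in Strip I, ‖v p‖ ^ 2)

/-- The `W^{1,2}`-norm over the strip. -/
def normW12 (I : Set ℝ) (v : ℝ × ℝ → E) (Dv : ℝ × ℝ → ℝ × ℝ →L[ℝ] E) : ℝ :=
  Real.sqrt (∫ p in Strip I,
    (‖v p‖ ^ 2 + ‖Dv p (1, 0)‖ ^ 2 + ‖Dv p (0, 1)‖ ^ 2))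

/-- The `W^{2,2}`-norm over the strip. -/
def normW22 (I : Set ℝ) (v : ℝ × ℝ → E) (Dv : ℝ × ℝ → ℝ × ℝ →L[ℝ] E)
    (D2v : ℝ × ℝ → ℝ × ℝ →L[ℝ] ℝ × ℝ →L[ℝ] E) : ℝ :=
  Real.sqrt (∫ p in Strip I,
    (‖v p‖ ^ 2 + ‖Dv p (1, 0)‖ ^ 2 + ‖Dv p (0, 1)‖ ^ 2
      + ‖D2v p (1, 0) (1, 0)‖ ^ 2 + ‖D2v p (1, 0) (0, 1)‖ ^ 2
      + ‖D2v p (0, 1) (0, 1)‖ ^ 2))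

/-- The derivative of `Dop J (S₁ + R) u` in the direction `w`, computed by the chain and
Leibniz rules from the data `(u, Du, D2u)` and `(R, DR)`. -/
def DDop (J : E →L[ℝ] E) (S1 : ℝ → E →L[ℝ] E) (R : ℝ × ℝ → E →L[ℝ] E)
    (DR : ℝ × ℝ → ℝ × ℝ →L[ℝ] E →L[ℝ] E) (u : ℝ × ℝ → E)
    (Du : ℝ × ℝ → ℝ × ℝ →L[ℝ] E) (D2u : ℝ × ℝ → ℝ × ℝ →L[ℝ] ℝ × ℝ →L[ℝ] E)
    (q : ℝ × ℝ) (w : ℝ × ℝ) : E :=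
  D2u q w (1, 0) + J (D2u q w (0, 1))
    + (w.2 • deriv S1 q.2 + DR q w) (u q)
    + (S1 q.2 + R q) (Du q w)

/-! ### Square-integrable functions -/

lemma norm_add_sq_le_two (v w : E) : ‖v + w‖ ^ 2 ≤ 2 * ‖v‖ ^ 2 + 2 * ‖w‖ ^ 2 := by
  have h := parallelogram_law_with_norm ℝ v w
  nlinarith [mul_self_nonneg ‖v - w‖]

lemma norm_sub_sq_le_two (v w : E) : ‖v - w‖ ^ 2 ≤ 2 * ‖v‖ ^ 2 + 2 * ‖w‖ ^ 2 := by
  simpa [sub_eq_add_neg] using norm_add_sq_le_two v (-w)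

lemma MeasureTheory.MemLp.integrable_norm_sq {α F : Type*} [MeasurableSpace α]
    [NormedAddCommGroup F] {m : Measure α} {f : α → F} (hf : MemLp f 2 m) :
    Integrable (fun a => ‖f a‖ ^ 2) m :=
  (memLp_two_iff_integrable_sq_norm hf.1).1 hf

/-- If `‖f‖² ≤ a‖g‖² + b‖h‖²` pointwise almost everywhere, then the integrals satisfy the same
inequality. -/
lemma integral_norm_sq_le_of_le {α : Type*} [MeasurableSpace α] {m : Measure α}
    {F G H : Type*} [NormedAddCommGroup F] [InnerProductSpace ℝ F]
    [NormedAddCommGroup G] [InnerProductSpace ℝ G] [NormedAddCommGroup H] [InnerProductSpace ℝ H]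
    {f : α → F} {g : α → G} {h : α → H} {a b : ℝ} (hg : MemLp g 2 m) (hh : MemLp h 2 m)
    (hle : ∀ᵐ x ∂m, ‖f x‖ ^ 2 ≤ a * ‖g x‖ ^ 2 + b * ‖h x‖ ^ 2) :
    ∫ x, ‖f x‖ ^ 2 ∂m ≤ a * ∫ x, ‖g x‖ ^ 2 ∂m + b * ∫ x, ‖h x‖ ^ 2 ∂m := by
  rw [← integral_const_mul, ← integral_const_mul,
    ← integral_add (hg.integrable_norm_sq.const_mul a) (hh.integrable_norm_sq.const_mul b)]
  exact integral_mono_of_nonneg (Filter.Eventually.of_forall fun x => by positivity)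
    ((hg.integrable_norm_sq.const_mul a).add (hh.integrable_norm_sq.const_mul b)) hle

lemma sq_setIntegral_le {g : ℝ → ℝ} {x y : ℝ} (hxy : x ≤ y)
    (hg : MemLp g 2 (volume.restrict (Ioc x y))) :
    (∫ t in Ioc x y, g t) ^ 2 ≤ (y - x) * ∫ t in Ioc x y, g t ^ 2 := by
  rcases hxy.eq_or_lt with rfl | hlt
  · simp
  set A := ∫ t in Ioc x y, g t with hA
  set c := A / (y - x) with hc
  have hpos : 0 < y - x := sub_pos.2 hlt
  have hi : Integrable g (volume.restrict (Ioc x y)) := hg.integrable (by norm_num)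
  have hi2 : Integrable (fun t => g t ^ 2) (volume.restrict (Ioc x y)) := by
    simpa using hg.integrable_norm_sq
  have h0 : 0 ≤ ∫ t in Ioc x y, (g t - c) ^ 2 := integral_nonneg fun t => sq_nonneg _
  have he : ∫ t in Ioc x y, (g t - c) ^ 2 =
      (∫ t in Ioc x y, g t ^ 2) - 2 * c * A + c ^ 2 * (y - x) := by
    have h1 : (fun t => (g t - c) ^ 2) = fun t => (g t ^ 2 - 2 * c * g t) + c ^ 2 := by
      ext t; ring
    have h2 : Integrable (fun t => g t ^ 2 - 2 * c * g t) (volume.restrict (Ioc x y)) :=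
      hi2.sub (hi.const_mul _)
    rw [h1, integral_add h2 (integrable_const _), integral_sub hi2 (hi.const_mul _),
      integral_const_mul]
    simp [hxy, Measure.real, mul_comm, ← hA]
  rw [he] at h0
  have hcA : c * (y - x) = A := by rw [hc]; field_simp
  nlinarith

/-! ### One-dimensional calculus -/

lemma aestronglyMeasurable_of_hasDerivWithinAt [FiniteDimensional ℝ E] {f f' : ℝ → E} {a b : ℝ}
    (hf : ∀ t ∈ Icc a b, HasDerivWithinAt f (f' t) (Icc a b) t) :
    AEStronglyMeasurable f' (volume.restrict (Icc a b)) := by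
  borelize E
  refine (measurable_deriv f).stronglyMeasurable.aestronglyMeasurable.congr ?_
  rw [← restrict_Ioo_eq_restrict_Icc]
  refine (ae_restrict_iff' measurableSet_Ioo).2 (Filter.Eventually.of_forall fun t ht => ?_)
  exact ((hf t (Ioo_subset_Icc_self ht)).hasDerivAt (Icc_mem_nhds ht.1 ht.2)).deriv

lemma memLp_of_hasDerivWithinAt [FiniteDimensional ℝ E] {f f' : ℝ → E} {a b : ℝ}
    (hf : ∀ t ∈ Icc a b, HasDerivWithinAt f (f' t) (Icc a b) t)
    (hi : IntegrableOn (fun t => ‖f' t‖ ^ 2) (Icc a b)) :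
    MemLp f' 2 (volume.restrict (Icc a b)) :=
  (memLp_two_iff_integrable_sq_norm (aestronglyMeasurable_of_hasDerivWithinAt hf)).2 hi

lemma integral_eq_sub_of_hasDerivWithinAt [FiniteDimensional ℝ E] {f f' : ℝ → E} {a b x y : ℝ}
    (hf : ∀ t ∈ Icc a b, HasDerivWithinAt f (f' t) (Icc a b) t)
    (hi : IntegrableOn f' (Icc a b)) (hx : x ∈ Icc a b) (hy : y ∈ Icc a b) (hxy : x ≤ y) :
    ∫ t in x..y, f' t = f y - f x := by
  have hsub : Icc x y ⊆ Icc a b := Icc_subset_Icc hx.1 hy.2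
  refine intervalIntegral.integral_eq_sub_of_hasDerivAt_of_le hxy
    (fun t ht => ((hf t (hsub ht)).continuousWithinAt).mono hsub) (fun t ht => ?_) ?_
  · exact (hf t (hsub (Ioo_subset_Icc_self ht))).hasDerivAt
      (Icc_mem_nhds (hx.1.trans_lt ht.1) (ht.2.trans_le hy.2))
  · rw [intervalIntegrable_iff_integrableOn_Icc_of_le hxy]
    exact hi.mono_set hsub

/-- Functions with square-integrable derivative are Hölder continuous of exponent `1/2`. -/
lemma norm_sub_sq_le_of_hasDerivWithinAt [FiniteDimensional ℝ E] {f f' : ℝ → E} {a b x y : ℝ}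
    (hf : ∀ t ∈ Icc a b, HasDerivWithinAt f (f' t) (Icc a b) t)
    (hi : IntegrableOn (fun t => ‖f' t‖ ^ 2) (Icc a b)) (hx : x ∈ Icc a b) (hy : y ∈ Icc a b) :
    ‖f y - f x‖ ^ 2 ≤ |y - x| * ∫ t in Icc a b, ‖f' t‖ ^ 2 := by
  wlog hxy : x ≤ y generalizing x y
  · have := this hy hx (le_of_not_ge hxy)
    rwa [norm_sub_rev, abs_sub_comm] at this
  have hL := memLp_of_hasDerivWithinAt hf hi
  have hsub : Ioc x y ⊆ Icc a b := Ioc_subset_Icc_self.trans (Icc_subset_Icc hx.1 hy.2)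
  have hL' : MemLp (fun t => ‖f' t‖) 2 (volume.restrict (Ioc x y)) :=
    (hL.mono_measure (Measure.restrict_mono hsub le_rfl)).norm
  rw [← integral_eq_sub_of_hasDerivWithinAt hf (hL.integrable (by norm_num)) hx hy hxy,
    abs_of_nonneg (sub_nonneg.2 hxy), intervalIntegral.integral_of_le hxy]
  calc ‖∫ t in Ioc x y, f' t‖ ^ 2 ≤ (∫ t in Ioc x y, ‖f' t‖) ^ 2 := by
        gcongr; exact norm_integral_le_integral_norm _
    _ ≤ (y - x) * ∫ t in Ioc x y, ‖f' t‖ ^ 2 := sq_setIntegral_le hxy hL'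
    _ ≤ _ := by
        gcongr
        exact Filter.Eventually.of_forall fun t => by positivity

lemma integrableOn_norm_sq_of_hasDerivWithinAt {f f' : ℝ → E} {a b : ℝ}
    (hf : ∀ t ∈ Icc a b, HasDerivWithinAt f (f' t) (Icc a b) t) :
    IntegrableOn (fun t => ‖f t‖ ^ 2) (Icc a b) :=
  ContinuousOn.integrableOn_Icc
    (ContinuousOn.pow (ContinuousOn.norm fun t ht => (hf t ht).continuousWithinAt) 2)

/-- One-dimensional Sobolev inequality on an interval of length at least one. -/
lemma norm_sq_le_of_hasDerivWithinAt [FiniteDimensional ℝ E] {f f' : ℝ → E} {a b y : ℝ}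
    (hab : 1 ≤ b - a)
    (hf : ∀ t ∈ Icc a b, HasDerivWithinAt f (f' t) (Icc a b) t)
    (hi : IntegrableOn (fun t => ‖f' t‖ ^ 2) (Icc a b)) (hy : y ∈ Icc a b) :
    ‖f y‖ ^ 2 ≤ 2 * (b - a) * ∫ t in Icc a b, (‖f t‖ ^ 2 + ‖f' t‖ ^ 2) := by
  have hfi := integrableOn_norm_sq_of_hasDerivWithinAt hf
  set D := ∫ t in Icc a b, ‖f' t‖ ^ 2 with hD
  have hD0 : 0 ≤ D := integral_nonneg fun t => by positivity
  have hF0 : 0 ≤ ∫ t in Icc a b, ‖f t‖ ^ 2 := integral_nonneg fun t => by positivity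
  have hpt : ∀ t ∈ Icc a b, ‖f y‖ ^ 2 ≤ 2 * ‖f t‖ ^ 2 + 2 * (b - a) * D := by
    intro t ht
    have h1 := norm_sub_sq_le_of_hasDerivWithinAt hf hi ht hy
    have h2 := norm_add_sq_le_two (f t) (f y - f t)
    have h3 : |y - t| ≤ b - a := by
      rw [abs_le]; constructor <;> linarith [ht.1, ht.2, hy.1, hy.2]
    have h4 : |y - t| * D ≤ (b - a) * D := by gcongr
    rw [add_sub_cancel] at h2
    linarith
  have hle : ∫ _ in Icc a b, ‖f y‖ ^ 2 ≤ ∫ t in Icc a b, (2 * ‖f t‖ ^ 2 + 2 * (b - a) * D) := by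
    refine setIntegral_mono_on ?_ ?_ measurableSet_Icc hpt
    · exact integrable_const _
    · exact (hfi.const_mul 2).add (integrable_const _)
  rw [integral_add (hfi.const_mul 2) (integrable_const _), integral_const_mul] at hle
  have hab' : a ≤ b := by linarith
  simp only [integral_const, Measure.real, MeasurableSet.univ, Measure.restrict_apply, univ_inter,
    Real.volume_Icc, smul_eq_mul, ENNReal.toReal_ofReal (sub_nonneg.2 hab')] at hle
  rw [integral_add hfi hi]
  have h5 : ‖f y‖ ^ 2 ≤ (b - a) * ‖f y‖ ^ 2 := by nlinarith [sq_nonneg ‖f y‖]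
  have h6 : 0 ≤ b - a := by linarith
  have key : (b - a) * ‖f y‖ ^ 2 ≤
      (b - a) * (2 * ∫ t in Icc a b, ‖f t‖ ^ 2) + (b - a) * (2 * (b-a) * D) := by
    nlinarith
  have := le_of_mul_le_mul_left (by
    linarith [key, mul_add (b-a) (2 * ∫ t in Icc a b, ‖f t‖ ^ 2) (2 * (b-a) * D)] :
    (b - a) * ‖f y‖ ^ 2 ≤ (b - a) * (2 * (∫ t in Icc a b, ‖f t‖ ^ 2) + 2 * (b-a) * D)) (by linarith)
  nlinarith

/-- Interpolation: the derivative is controlled by the function and a small multiple of the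
second derivative. -/
lemma norm_deriv_sq_le_of_hasDerivWithinAt [FiniteDimensional ℝ E] {f f' f'' : ℝ → E}
    {a b h C y : ℝ} (hh : 0 < h) (hab : 2 * h ≤ b - a)
    (hf : ∀ t ∈ Icc a b, HasDerivWithinAt f (f' t) (Icc a b) t)
    (hf' : ∀ t ∈ Icc a b, HasDerivWithinAt f' (f'' t) (Icc a b) t)
    (hi : IntegrableOn (fun t => ‖f'' t‖ ^ 2) (Icc a b)) (hC : ∀ t ∈ Icc a b, ‖f t‖ ≤ C)
    (hy : y ∈ Icc a b) :
    ‖f' y‖ ^ 2 ≤ 8 * C ^ 2 / h ^ 2 + 2 * h * ∫ t in Icc a b, ‖f'' t‖ ^ 2 := by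
  set D := ∫ t in Icc a b, ‖f'' t‖ ^ 2 with hD
  have hD0 : 0 ≤ D := integral_nonneg fun t => by positivity
  obtain ⟨z, hz, hzy⟩ : ∃ z ∈ Icc a b, |z - y| = h := by
    rcases le_total (y + h) b with h1 | h1
    · exact ⟨y + h, ⟨by linarith [hy.1], h1⟩, by simp [abs_of_pos hh]⟩
    · exact ⟨y - h, ⟨by linarith, by linarith [hy.2]⟩, by simp [abs_of_pos hh]⟩
  have hsub : uIcc y z ⊆ Icc a b := by
    rw [← uIcc_of_le (by linarith : a ≤ b)]
    rw [← uIcc_of_le (by linarith : a ≤ b)] at hy hz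
    exact uIcc_subset_uIcc hy hz
  have hmv := Convex.norm_image_sub_le_of_norm_hasDerivWithin_le (C := Real.sqrt (h * D))
    (f := fun t => f t - t • f' y) (f' := fun t => f' t - f' y) (s := uIcc y z) (x := y) (y := z)
    (fun t ht => by
      have h1 := (hf t (hsub ht)).mono hsub
      have h2 := ((hasDerivAt_id t).smul_const (f' y)).hasDerivWithinAt (s := uIcc y z)
      simpa [Pi.sub_def] using h1.sub h2)
    (fun t ht => by
      refine Real.le_sqrt_of_sq_le
        ((norm_sub_sq_le_of_hasDerivWithinAt hf' hi hy (hsub ht)).trans ?_)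
      gcongr
      rw [← hzy]
      exact abs_sub_left_of_mem_uIcc ht)
    (convex_uIcc y z) left_mem_uIcc right_mem_uIcc
  rw [Real.norm_eq_abs, hzy] at hmv
  have e : (z - y) • f' y = (f z - f y) - ((f z - z • f' y) - (f y - y • f' y)) := by
    rw [sub_smul]; abel
  have h1 : h * ‖f' y‖ ≤ 2 * C + Real.sqrt (h * D) * h := by
    rw [← hzy, ← Real.norm_eq_abs, ← norm_smul, e, Real.norm_eq_abs, hzy]
    refine (norm_sub_le _ _).trans (add_le_add ?_ hmv)
    linarith [norm_sub_le (f z) (f y), hC z hz, hC y hy]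
  have h2 : ‖f' y‖ ≤ 2 * C / h + Real.sqrt (h * D) := by
    rw [← sub_le_iff_le_add, le_div_iff₀ hh]; linarith
  have h3 : Real.sqrt (h * D) ^ 2 = h * D := Real.sq_sqrt (by positivity)
  calc ‖f' y‖ ^ 2 ≤ (2 * C / h + Real.sqrt (h * D)) ^ 2 := by gcongr
    _ ≤ 2 * (2 * C / h) ^ 2 + 2 * Real.sqrt (h * D) ^ 2 := by
        nlinarith [sq_nonneg (2 * C / h - Real.sqrt (h * D))]
    _ = _ := by rw [h3]; ring

/-! ### The spectral decomposition on the unit interval -/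

/-- An operator `A = J∂_t + S₁(t)` with an orthogonal complex structure `J`, Lagrangian boundary
conditions `Λ`, smooth symmetric `S₁` and spectral data `x`, `μ`. -/
structure IsSpectralOperator (J : E →L[ℝ] E) (Λ : Submodule ℝ E) (S1 : ℝ → E →L[ℝ] E)
    {ι : Type*} (x : ι → ℝ → E) (μ : ι → ℝ) : Prop where
  norm_J : ∀ v, ‖J v‖ = ‖v‖
  J_J : ∀ v, J (J v) = -v
  mem_iff : ∀ v, v ∈ Λ ↔ J v ∈ Λᗮ
  smooth : ContDiff ℝ (⊤ : ℕ∞) S1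
  symm : ∀ (t : ℝ) (v w : E), ⟪S1 t v, w⟫ = ⟪v, S1 t w⟫
  eigen : EigenData J Λ S1 x μ

/-- Lebesgue measure on the unit interval. -/
abbrev unitMeasure : Measure ℝ := volume.restrict (Icc (0:ℝ) 1)

lemma intervalIntegral_eq_unitMeasure {F : Type*} [NormedAddCommGroup F] [NormedSpace ℝ F]
    (f : ℝ → F) : ∫ t in (0:ℝ)..1, f t = ∫ t, f t ∂unitMeasure := by
  rw [intervalIntegral.integral_of_le zero_le_one, integral_Icc_eq_integral_Ioc]

lemma inner_toLp_toLp {α : Type*} [MeasurableSpace α] {m : Measure α} {f g : α → E}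
    (hf : MemLp f 2 m) (hg : MemLp g 2 m) :
    ⟪hf.toLp f, hg.toLp g⟫ = ∫ a, ⟪f a, g a⟫ ∂m := by
  rw [L2.inner_def]
  refine integral_congr_ae ?_
  filter_upwards [hf.coeFn_toLp, hg.coeFn_toLp] with a h1 h2
  rw [h1, h2]

lemma norm_toLp_sq {α : Type*} [MeasurableSpace α] {m : Measure α} {f : α → E}
    (hf : MemLp f 2 m) : ‖hf.toLp f‖ ^ 2 = ∫ a, ‖f a‖ ^ 2 ∂m := by
  rw [← real_inner_self_eq_norm_sq, inner_toLp_toLp hf hf]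
  simp_rw [real_inner_self_eq_norm_sq]

lemma integrable_inner_of_memLp {α : Type*} [MeasurableSpace α] {m : Measure α} {f g : α → E}
    (hf : MemLp f 2 m) (hg : MemLp g 2 m) : Integrable (fun a => ⟪f a, g a⟫) m := by
  refine (L2.integrable_inner (𝕜 := ℝ) (hf.toLp f) (hg.toLp g)).congr ?_
  filter_upwards [hf.coeFn_toLp, hg.coeFn_toLp] with a h1 h2
  rw [h1, h2]

lemma memLp_unitMeasure_of_continuousOn {F : Type*} [NormedAddCommGroup F] {f : ℝ → F}
    (hf : ContinuousOn f (Icc 0 1)) :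
    MemLp f 2 unitMeasure := by
  refine (memLp_two_iff_integrable_sq_norm
    (hf.aestronglyMeasurable_of_isCompact isCompact_Icc measurableSet_Icc)).2 ?_
  exact (hf.norm.pow 2).integrableOn_Icc

lemma exists_norm_le_of_continuous {F : Type*} [NormedAddCommGroup F] {f : ℝ → F}
    (hf : Continuous f) : ∃ B, 0 ≤ B ∧ ∀ t ∈ Icc (0:ℝ) 1, ‖f t‖ ≤ B := by
  obtain ⟨B, hB⟩ := isCompact_Icc.exists_bound_of_continuousOn (hf.continuousOn (s := Icc (0:ℝ) 1))
  exact ⟨B, (norm_nonneg _).trans (hB 0 (by simp)), hB⟩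

namespace IsSpectralOperator

variable {J : E →L[ℝ] E} {Λ : Submodule ℝ E} {S1 : ℝ → E →L[ℝ] E} {ι : Type*} {x : ι → ℝ → E}
  {μ : ι → ℝ}

lemma inner_J_left (h : IsSpectralOperator J Λ S1 x μ) (v w : E) : ⟪J v, w⟫ = -⟪v, J w⟫ := by
  let L : E →ₗᵢ[ℝ] E := ⟨J.toLinearMap, h.norm_J⟩
  have h1 : ⟪J v, J (J w)⟫ = ⟪v, J w⟫ := L.inner_map_map v (J w)
  rw [h.J_J, inner_neg_right] at h1
  linarith

lemma inner_J_of_mem (h : IsSpectralOperator J Λ S1 x μ) {v w : E} (hv : v ∈ Λ) (hw : w ∈ Λ) :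
    ⟪J v, w⟫ = 0 := by
  rw [real_inner_comm]
  exact (Submodule.mem_orthogonal _ _).1 ((h.mem_iff v).1 hv) w hw

lemma hasDerivAt_x (h : IsSpectralOperator J Λ S1 x μ) (i : ι) (t : ℝ) :
    HasDerivAt (x i) (deriv (x i) t) t :=
  ((h.eigen.1 i).differentiable (by simp)).differentiableAt.hasDerivAt

lemma continuous_x (h : IsSpectralOperator J Λ S1 x μ) (i : ι) : Continuous (x i) :=
  (h.eigen.1 i).continuous

lemma continuous_S1 (h : IsSpectralOperator J Λ S1 x μ) : Continuous S1 := h.smooth.continuous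

lemma exists_bound (h : IsSpectralOperator J Λ S1 x μ) :
    ∃ B, 0 ≤ B ∧ ∀ t ∈ Icc (0:ℝ) 1, ‖S1 t‖ ≤ B :=
  exists_norm_le_of_continuous h.continuous_S1

lemma memLp_x (h : IsSpectralOperator J Λ S1 x μ) (i : ι) : MemLp (x i) 2 unitMeasure :=
  memLp_unitMeasure_of_continuousOn (h.continuous_x i).continuousOn

/-- The eigenfunctions as elements of `L²`. -/
def vec (h : IsSpectralOperator J Λ S1 x μ) (i : ι) : Lp E 2 unitMeasure := (h.memLp_x i).toLp (x i)

lemma orthonormal_vec (h : IsSpectralOperator J Λ S1 x μ) : Orthonormal ℝ h.vec := by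
  rw [orthonormal_iff_ite]
  intro i j
  rw [vec, vec, inner_toLp_toLp, ← intervalIntegral_eq_unitMeasure]
  exact h.eigen.2.2.2.2.1 i j

lemma inner_toLp_vec (h : IsSpectralOperator J Λ S1 x μ) {f : ℝ → E} (hf : MemLp f 2 unitMeasure)
    (i : ι) : ⟪h.vec i, hf.toLp f⟫ = coeff x f i := by
  rw [real_inner_comm, vec, inner_toLp_toLp, ← intervalIntegral_eq_unitMeasure, coeff]

lemma continuous_sum (h : IsSpectralOperator J Λ S1 x μ) (F : Finset ι) (a : ι → ℝ) :
    Continuous fun t => ∑ i ∈ F, a i • x i t :=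
  continuous_finsetSum _ fun i _ => (h.continuous_x i).const_smul _

lemma toLp_sum (h : IsSpectralOperator J Λ S1 x μ) (F : Finset ι) (a : ι → ℝ)
    (hf : MemLp (fun t => ∑ i ∈ F, a i • x i t) 2 unitMeasure) :
    hf.toLp _ = ∑ i ∈ F, a i • h.vec i := by
  refine Lp.ext (hf.coeFn_toLp.trans ?_)
  have h1 : ∀ᵐ t ∂unitMeasure, ∀ i ∈ F, (a i • h.vec i : Lp E 2 unitMeasure) t = a i • x i t := by
    rw [Filter.eventually_all_finset]
    intro i _
    filter_upwards [Lp.coeFn_smul (a i) (h.vec i), (h.memLp_x i).coeFn_toLp] with t h1 h2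
    rw [h1, Pi.smul_apply, vec, h2]
  filter_upwards [Lp.coeFn_finsetSum F (fun i => a i • h.vec i), h1] with t h2 h3
  rw [h2]
  simp only [Finset.sum_apply]
  exact (Finset.sum_congr rfl h3).symm

lemma integral_norm_sq_sum (h : IsSpectralOperator J Λ S1 x μ) (F : Finset ι) (a : ι → ℝ) :
    ∫ t, ‖∑ i ∈ F, a i • x i t‖ ^ 2 ∂unitMeasure = ∑ i ∈ F, a i ^ 2 := by
  rw [← norm_toLp_sq (memLp_unitMeasure_of_continuousOn (h.continuous_sum F a).continuousOn),
    h.toLp_sum, ← real_inner_self_eq_norm_sq, h.orthonormal_vec.inner_sum]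
  simp [sq]

/-- The spectral operator acts diagonally on finite sums of eigenfunctions. -/
lemma hasDerivAt_sum (h : IsSpectralOperator J Λ S1 x μ) (F : Finset ι) (a : ι → ℝ) (t : ℝ) :
    HasDerivAt (fun t => ∑ i ∈ F, a i • x i t)
      (J (S1 t (∑ i ∈ F, a i • x i t) - ∑ i ∈ F, (a i * μ i) • x i t)) t := by
  have h1 : HasDerivAt (fun t => ∑ i ∈ F, a i • x i t) (∑ i ∈ F, a i • deriv (x i) t) t :=
    HasDerivAt.fun_sum fun i _ => (h.hasDerivAt_x i t).const_smul _
  convert h1 using 1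
  have h2 : ∀ i, deriv (x i) t = J (S1 t (x i t) - μ i • x i t) := by
    intro i
    have h3 := h.eigen.2.2.2.1 i t
    rw [← h3, sub_add_cancel_right, map_neg, h.J_J, neg_neg]
  simp only [map_sum, ← Finset.sum_sub_distrib, map_smul, h2, map_sub, smul_sub, mul_smul]

lemma exists_norm_sum_sq_le [FiniteDimensional ℝ E] (h : IsSpectralOperator J Λ S1 x μ) :
    ∃ C, 0 ≤ C ∧ ∀ (F : Finset ι) (a : ι → ℝ), ∀ t ∈ Icc (0:ℝ) 1,
      ‖∑ i ∈ F, a i • x i t‖ ^ 2 ≤ C * ∑ i ∈ F, (1 + μ i ^ 2) * a i ^ 2 := by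
  obtain ⟨B, hB0, hB⟩ := h.exists_bound
  refine ⟨2 * (1 + (2 * B ^ 2 + 2)), by positivity, fun F a t ht => ?_⟩
  set f : ℝ → E := fun t => ∑ i ∈ F, a i • x i t with hf
  set g : ℝ → E := fun t => ∑ i ∈ F, (a i * μ i) • x i t with hg
  set f' : ℝ → E := fun t => J (S1 t (f t) - g t) with hf'
  have hfc : Continuous f := h.continuous_sum F a
  have hgc : Continuous g := h.continuous_sum F _
  have hfc' : Continuous f' := J.continuous.comp ((h.continuous_S1.clm_apply hfc).sub hgc)
  have hd : ∀ t ∈ Icc (0:ℝ) 1, HasDerivWithinAt f (f' t) (Icc 0 1) t :=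
    fun t _ => (h.hasDerivAt_sum F a t).hasDerivWithinAt
  have h1 := norm_sq_le_of_hasDerivWithinAt (by norm_num : (1:ℝ) ≤ 1 - 0) hd
    (hfc'.norm.pow 2).continuousOn.integrableOn_Icc ht
  have i1 : IntegrableOn (fun t => ‖f t‖ ^ 2) (Icc 0 1) :=
    (hfc.norm.pow 2).continuousOn.integrableOn_Icc
  have i2 : IntegrableOn (fun t => ‖f' t‖ ^ 2) (Icc 0 1) :=
    (hfc'.norm.pow 2).continuousOn.integrableOn_Icc
  rw [integral_add i1 i2] at h1
  have h2 : ∫ t in Icc (0:ℝ) 1, ‖f' t‖ ^ 2 ≤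
      2 * B ^ 2 * ∫ t, ‖f t‖ ^ 2 ∂unitMeasure + 2 * ∫ t, ‖g t‖ ^ 2 ∂unitMeasure := by
    refine integral_norm_sq_le_of_le (memLp_unitMeasure_of_continuousOn hfc.continuousOn)
      (memLp_unitMeasure_of_continuousOn hgc.continuousOn) ?_
    refine (ae_restrict_iff' measurableSet_Icc).2 (Filter.Eventually.of_forall fun t ht => ?_)
    rw [hf', h.norm_J]
    refine (norm_sub_sq_le_two _ _).trans ?_
    have : ‖S1 t (f t)‖ ^ 2 ≤ (B * ‖f t‖) ^ 2 := by
      gcongr; exact (S1 t).le_of_opNorm_le (hB t ht) _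
    rw [mul_pow] at this
    linarith
  rw [h.integral_norm_sq_sum] at h1 h2
  rw [h.integral_norm_sq_sum] at h2
  have h3 : ∑ i ∈ F, (1 + μ i ^ 2) * a i ^ 2 = ∑ i ∈ F, a i ^ 2 + ∑ i ∈ F, (a i * μ i) ^ 2 := by
    rw [← Finset.sum_add_distrib]
    exact Finset.sum_congr rfl fun i _ => by ring
  have h4 : 0 ≤ ∑ i ∈ F, a i ^ 2 := Finset.sum_nonneg fun i _ => sq_nonneg _
  have h5 : 0 ≤ ∑ i ∈ F, (a i * μ i) ^ 2 := Finset.sum_nonneg fun i _ => sq_nonneg _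
  rw [h3]
  refine h1.trans ?_
  nlinarith [mul_nonneg (sq_nonneg B) h5]

lemma finite_setOf_abs_le [FiniteDimensional ℝ E] (h : IsSpectralOperator J Λ S1 x μ) (r : ℝ) :
    {i | |μ i| ≤ r}.Finite := by
  obtain ⟨C, hC0, hC⟩ := h.exists_norm_sum_sq_le
  set K := C * (1 + r ^ 2) with hK
  have hK0 : 0 ≤ K := by positivity
  set d := Module.finrank ℝ E
  have hcard : ∀ F : Finset ι, (∀ i ∈ F, |μ i| ≤ r) → (F.card : ℝ) ≤ K * d := by
    intro F hF
    let e := stdOrthonormalBasis ℝ E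
    have h1 : ∀ t ∈ Icc (0:ℝ) 1, ∀ k, ∑ i ∈ F, ⟪x i t, e k⟫ ^ 2 ≤ K := by
      intro t ht k
      set T := ∑ i ∈ F, ⟪x i t, e k⟫ ^ 2 with hT
      have hT0 : 0 ≤ T := Finset.sum_nonneg fun i _ => sq_nonneg _
      have h2 := hC F (fun i => ⟪x i t, e k⟫) t ht
      have h3 : ∑ i ∈ F, (1 + μ i ^ 2) * ⟪x i t, e k⟫ ^ 2 ≤ (1 + r ^ 2) * T := by
        rw [hT, Finset.mul_sum]
        refine Finset.sum_le_sum fun i hi => ?_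
        have := hF i hi
        gcongr 2
        rw [← sq_abs]
        gcongr
      have h4 : T ≤ ‖∑ i ∈ F, ⟪x i t, e k⟫ • x i t‖ := by
        have : T = ⟪∑ i ∈ F, ⟪x i t, e k⟫ • x i t, e k⟫ := by
          rw [sum_inner]
          exact Finset.sum_congr rfl fun i _ => by rw [real_inner_smul_left, sq]
        rw [this]
        simpa using real_inner_le_norm (∑ i ∈ F, ⟪x i t, e k⟫ • x i t) (e k)
      have h5 : T ^ 2 ≤ K * T := by
        calc T ^ 2 ≤ ‖∑ i ∈ F, ⟪x i t, e k⟫ • x i t‖ ^ 2 := by gcongr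
          _ ≤ C * ((1 + r ^ 2) * T) := h2.trans (by gcongr)
          _ = K * T := by rw [hK]; ring
      by_contra! hlt
      nlinarith
    have h2 : ∀ t ∈ Icc (0:ℝ) 1, ∑ i ∈ F, ‖x i t‖ ^ 2 ≤ K * d := by
      intro t ht
      have h3 : ∀ i, ‖x i t‖ ^ 2 = ∑ k, ⟪x i t, e k⟫ ^ 2 := fun i => by
        rw [← e.sum_sq_norm_inner_left]; simp
      simp_rw [h3]
      rw [Finset.sum_comm]
      refine (Finset.sum_le_sum fun k _ => h1 t ht k).trans ?_
      simp [d, mul_comm]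
    have h3 : ∀ i, ∫ t, ‖x i t‖ ^ 2 ∂unitMeasure = 1 := fun i => by
      rw [← norm_toLp_sq (h.memLp_x i)]
      have := h.orthonormal_vec.1 i
      rw [vec] at this
      rw [this, one_pow]
    have h4 : (F.card : ℝ) = ∫ t, ∑ i ∈ F, ‖x i t‖ ^ 2 ∂unitMeasure := by
      rw [integral_finsetSum _ fun i _ => (h.memLp_x i).integrable_norm_sq]
      simp [h3]
    rw [h4]
    refine (setIntegral_mono_on (integrable_finsetSum _ fun i _ => (h.memLp_x i).integrable_norm_sq)
      (integrable_const (K * d)) measurableSet_Icc h2).trans ?_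
    simp [Measure.real]
  by_contra hinf
  obtain ⟨n, hn⟩ := exists_nat_gt (K * d)
  obtain ⟨F, hF, hFn⟩ := Set.Infinite.exists_subset_card_eq hinf n
  have := hcard F fun i hi => hF hi
  rw [hFn] at this
  linarith

lemma countable_index [FiniteDimensional ℝ E] (h : IsSpectralOperator J Λ S1 x μ) :
    Countable ι := by
  rw [← Set.countable_univ_iff]
  have : (univ : Set ι) = ⋃ n : ℕ, {i | |μ i| ≤ n} := by
    ext i
    simpa using exists_nat_ge |μ i|
  rw [this]
  exact countable_iUnion fun n => (h.finite_setOf_abs_le n).countable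

lemma exists_gap [FiniteDimensional ℝ E] (h : IsSpectralOperator J Λ S1 x μ) :
    ∃ m, 0 < m ∧ ∀ i, m ≤ |μ i| := by
  have hfin := h.finite_setOf_abs_le 1
  rcases hfin.toFinset.eq_empty_or_nonempty with he | hne
  · refine ⟨1, one_pos, fun i => ?_⟩
    by_contra! hlt
    have : i ∈ hfin.toFinset := by simpa using hlt.le
    simp [he] at this
  · obtain ⟨j, -, hj⟩ := Finset.exists_min_image _ (fun i => |μ i|) hne
    refine ⟨min 1 |μ j|, lt_min one_pos (abs_pos.2 (h.eigen.2.1 j)), fun i => ?_⟩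
    rcases le_total |μ i| 1 with h1 | h1
    · exact (min_le_right _ _).trans (hj i (by simpa using h1))
    · exact (min_le_left _ _).trans h1

/-- Eigencoefficients of `Au`. -/
lemma coeff_apply [FiniteDimensional ℝ E] (h : IsSpectralOperator J Λ S1 x μ) {u u' : ℝ → E}
    (hu : ∀ t ∈ Icc (0:ℝ) 1, HasDerivWithinAt u (u' t) (Icc 0 1) t)
    (hi : MemLp u' 2 unitMeasure) (h0 : u 0 ∈ Λ) (h1 : u 1 ∈ Λ) (i : ι) :
    coeff x (fun t => J (u' t) + S1 t (u t)) i = μ i * coeff x u i := by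
  have huc : ContinuousOn u (Icc 0 1) := fun t ht => (hu t ht).continuousWithinAt
  have hd : ∀ t ∈ Icc (0:ℝ) 1, HasDerivWithinAt (fun t => ⟪J (u t), x i t⟫)
      (⟪J (u' t) + S1 t (u t), x i t⟫ - μ i * ⟪u t, x i t⟫) (Icc 0 1) t := by
    intro t ht
    have h2 := (J.hasFDerivAt.comp_hasDerivWithinAt t (hu t ht)).inner ℝ
      (h.hasDerivAt_x i t).hasDerivWithinAt
    have h3 := h.eigen.2.2.2.1 i t
    have h4 : J (deriv (x i) t) = μ i • x i t - S1 t (x i t) := by rw [← h3]; abel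
    have h5 : ⟪J (u' t) + S1 t (u t), x i t⟫ - μ i * ⟪u t, x i t⟫ =
        ⟪J (u t), deriv (x i) t⟫ + ⟪J (u' t), x i t⟫ := by
      rw [h.inner_J_left (u t), h4, inner_sub_right, inner_add_left, h.symm, real_inner_smul_right]
      ring
    rw [h5]
    exact h2
  have hv : MemLp (fun t => J (u' t) + S1 t (u t)) 2 unitMeasure :=
    (J.comp_memLp' hi).add (memLp_unitMeasure_of_continuousOn
      (h.continuous_S1.continuousOn.clm_apply huc))
  have i1 : Integrable (fun t => ⟪J (u' t) + S1 t (u t), x i t⟫) unitMeasure :=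
    integrable_inner_of_memLp hv (h.memLp_x i)
  have i2 : Integrable (fun t => ⟪u t, x i t⟫) unitMeasure :=
    integrable_inner_of_memLp (memLp_unitMeasure_of_continuousOn huc) (h.memLp_x i)
  have h2 := integral_eq_sub_of_hasDerivWithinAt hd (i1.sub (i2.const_mul _))
    (by simp : (0:ℝ) ∈ Icc (0:ℝ) 1) (by simp : (1:ℝ) ∈ Icc (0:ℝ) 1) zero_le_one
  rw [h.inner_J_of_mem h0 (h.eigen.2.2.1 i).1, h.inner_J_of_mem h1 (h.eigen.2.2.1 i).2,
    intervalIntegral_eq_unitMeasure, integral_sub i1 (i2.const_mul _), integral_const_mul] at h2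
  rw [coeff, coeff, intervalIntegral_eq_unitMeasure, intervalIntegral_eq_unitMeasure]
  linarith

end IsSpectralOperator

lemma memLp_indicator_of_continuous {F : Type*} [NormedAddCommGroup F] {f : ℝ → F}
    (hf : Continuous f) (s : ℝ) :
    MemLp ((Icc 0 s).indicator f) 2 unitMeasure :=
  (memLp_unitMeasure_of_continuousOn hf.continuousOn).indicator measurableSet_Icc

/-- An `L²` function on the unit interval all of whose integrals over `[0, s]` vanish is zero. -/
lemma Lp_eq_zero_of_inner_indicator [FiniteDimensional ℝ E] (y : Lp E 2 unitMeasure)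
    (hy : ∀ s ∈ Icc (0:ℝ) 1, ∀ e : E,
      ⟪(memLp_indicator_of_continuous (continuous_const (y := e)) s).toLp _, y⟫ = 0) : y = 0 := by
  have hyi : Integrable y unitMeasure := (Lp.memLp y).integrable (by norm_num)
  have hyI : IntervalIntegrable y volume 0 1 := by
    rw [intervalIntegrable_iff_integrableOn_Icc_of_le zero_le_one]; exact hyi
  have hz : ∀ s ∈ Icc (0:ℝ) 1, ∫ t in (0:ℝ)..s, y t = 0 := by
    intro s hs
    refine ext_inner_left ℝ fun e => ?_
    have h0 := hy s hs e
    rw [L2.inner_def] at h0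
    have h1 : ∫ t, ⟪((memLp_indicator_of_continuous (continuous_const (y := e)) s).toLp _ :
        Lp E 2 unitMeasure) t, y t⟫ ∂unitMeasure =
        ∫ t, (Icc 0 s).indicator (fun t => ⟪e, y t⟫) t ∂unitMeasure := by
      refine integral_congr_ae ?_
      filter_upwards [(memLp_indicator_of_continuous (continuous_const (y := e)) s).coeFn_toLp]
        with t ht
      rw [ht]
      by_cases h2 : t ∈ Icc 0 s <;> simp [h2]
    rw [h1, integral_indicator measurableSet_Icc, Measure.restrict_restrict measurableSet_Icc,
      inter_eq_self_of_subset_left (Icc_subset_Icc_right hs.2), integral_inner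
      (hyi.mono_measure (Measure.restrict_mono (Icc_subset_Icc_right hs.2) le_rfl))] at h0
    rw [inner_zero_right, intervalIntegral.integral_of_le hs.1, ← integral_Icc_eq_integral_Ioc]
    exact h0
  rw [Lp.eq_zero_iff_ae_eq_zero]
  have hd := hyI.ae_hasDerivAt_integral
  rw [uIcc_of_le zero_le_one] at hd
  change _ =ᵐ[volume.restrict (Icc (0:ℝ) 1)] _
  rw [← restrict_Ioo_eq_restrict_Icc]
  refine (ae_restrict_iff' measurableSet_Ioo).2 ?_
  filter_upwards [hd] with s hs hsI
  have h1 := hs (Ioo_subset_Icc_self hsI) 0 (by simp)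
  have h2 : (fun s => ∫ t in (0:ℝ)..s, y t) =ᶠ[nhds s] fun _ => 0 := by
    filter_upwards [Icc_mem_nhds hsI.1 hsI.2] with r hr using hz r hr
  exact (h2.hasDerivAt_iff.1 h1).unique (hasDerivAt_const s (0:E))

lemma Orthonormal.hasSum_sq_of_hasSum {H ι : Type*} [NormedAddCommGroup H] [InnerProductSpace ℝ H]
    {b : ι → H} (hb : Orthonormal ℝ b) {a : ι → ℝ} {z : H} (hz : HasSum (fun i => a i • b i) z) :
    HasSum (fun i => a i ^ 2) (‖z‖ ^ 2) := by
  have h1 : Filter.Tendsto (fun F : Finset ι => ‖∑ i ∈ F, a i • b i‖ ^ 2) Filter.atTop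
      (nhds (‖z‖ ^ 2)) := (Filter.Tendsto.norm hz).pow 2
  refine h1.congr fun F => ?_
  rw [← real_inner_self_eq_norm_sq, hb.inner_sum]
  simp [sq]

lemma Orthonormal.inner_eq_of_hasSum {H ι : Type*} [NormedAddCommGroup H] [InnerProductSpace ℝ H]
    {b : ι → H} (hb : Orthonormal ℝ b) {a : ι → ℝ} {z : H} (hz : HasSum (fun i => a i • b i) z)
    (j : ι) : ⟪b j, z⟫ = a j := by
  have h1 : HasSum (fun i => ⟪b j, a i • b i⟫) ⟪b j, z⟫ := (innerSL ℝ (b j)).hasSum hz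
  refine h1.unique ?_
  have h2 : (fun i => ⟪b j, a i • b i⟫) = fun i => if i = j then a j else 0 := by
    funext i
    rw [real_inner_smul_right, orthonormal_iff_ite.1 hb j i]
    by_cases hij : i = j
    · simp [hij]
    · simp [hij, Ne.symm hij]
  rw [h2]
  exact hasSum_ite_eq j (a j)

lemma Orthonormal.summable_smul {H ι : Type*} [NormedAddCommGroup H] [InnerProductSpace ℝ H]
    [CompleteSpace H] {b : ι → H} (hb : Orthonormal ℝ b) {a : ι → ℝ}
    (ha : Summable fun i => a i ^ 2) : Summable fun i => a i • b i := by
  have h1 := (OrthogonalFamily.summable_iff_norm_sq_summable hb.orthogonalFamily a).2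
    (by simpa using ha)
  simpa using h1

namespace IsSpectralOperator

variable {J : E →L[ℝ] E} {Λ : Submodule ℝ E} {S1 : ℝ → E →L[ℝ] E} {ι : Type*} {x : ι → ℝ → E}
  {μ : ι → ℝ}

lemma summable_coeff_sq (h : IsSpectralOperator J Λ S1 x μ) {f : ℝ → E}
    (hf : MemLp f 2 unitMeasure) : Summable fun i => coeff x f i ^ 2 := by
  have h1 := h.orthonormal_vec.inner_products_summable (hf.toLp f)
  simpa [h.inner_toLp_vec hf] using h1

/-- A series of eigenfunctions with coefficients in the form domain converges uniformly. -/
lemma exists_uniform_limit [FiniteDimensional ℝ E] (h : IsSpectralOperator J Λ S1 x μ)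
    {c : ι → ℝ} (hc : Summable fun i => (1 + μ i ^ 2) * c i ^ 2) :
    ∃ w : ℝ → E, TendstoUniformlyOn (fun (F : Finset ι) t => ∑ i ∈ F, c i • x i t) w
      Filter.atTop (Icc 0 1) := by
  obtain ⟨C, hC0, hC⟩ := h.exists_norm_sum_sq_le
  have hcau : UniformCauchySeqOn (fun (F : Finset ι) t => ∑ i ∈ F, c i • x i t)
      Filter.atTop (Icc 0 1) := by
    rw [Metric.uniformCauchySeqOn_iff]
    intro ε hε
    have hδ : 0 < (ε / 4) ^ 2 / (C + 1) := by positivity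
    obtain ⟨F0, hF0⟩ := summable_iff_vanishing_norm.1 hc _ hδ
    have key : ∀ F ≥ F0, ∀ t ∈ Icc (0:ℝ) 1,
        ‖∑ i ∈ F, c i • x i t - ∑ i ∈ F0, c i • x i t‖ ≤ ε / 4 := by
      intro F hF t ht
      rw [← Finset.sum_sdiff_eq_sub hF]
      refine abs_le_of_sq_le_sq' ?_ (by positivity) |>.2
      refine (hC _ _ t ht).trans ?_
      have h1 := hF0 (F \ F0) Finset.sdiff_disjoint
      have h2 := (le_abs_self _).trans h1.le
      calc C * ∑ i ∈ F \ F0, (1 + μ i ^ 2) * c i ^ 2 ≤ C * ((ε / 4) ^ 2 / (C + 1)) := by gcongr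
        _ = (ε / 4) ^ 2 * (C / (C + 1)) := by ring
        _ ≤ (ε / 4) ^ 2 * 1 := by
            gcongr
            rw [div_le_one (by positivity)]
            linarith
        _ = _ := mul_one _
    refine ⟨F0, fun F hF G hG t ht => ?_⟩
    rw [dist_eq_norm]
    have h1 := key F hF t ht
    have h2 := key G hG t ht
    rw [show ∑ i ∈ F, c i • x i t - ∑ i ∈ G, c i • x i t =
      (∑ i ∈ F, c i • x i t - ∑ i ∈ F0, c i • x i t) -
      (∑ i ∈ G, c i • x i t - ∑ i ∈ F0, c i • x i t) by abel]
    linarith [norm_sub_le (∑ i ∈ F, c i • x i t - ∑ i ∈ F0, c i • x i t)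
      (∑ i ∈ G, c i • x i t - ∑ i ∈ F0, c i • x i t)]
  refine ⟨fun t => ∑' i, c i • x i t, hcau.tendstoUniformlyOn_of_tendsto fun t ht => ?_⟩
  exact (summable_iff_cauchySeq_finset.2 (hcau.cauchySeq ht)).hasSum

lemma hasSum_toLp_of_tendstoUniformlyOn (h : IsSpectralOperator J Λ S1 x μ)
    {c : ι → ℝ} {w : ℝ → E} (hw : MemLp w 2 unitMeasure)
    (hu : TendstoUniformlyOn (fun (F : Finset ι) t => ∑ i ∈ F, c i • x i t) w
      Filter.atTop (Icc 0 1)) :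
    HasSum (fun i => c i • h.vec i) (hw.toLp w) := by
  rw [HasSum, Metric.tendsto_nhds]
  intro ε hε
  rw [Metric.tendstoUniformlyOn_iff] at hu
  filter_upwards [hu (ε / 2) (by positivity)] with F hF
  have hm := memLp_unitMeasure_of_continuousOn (h.continuous_sum F c).continuousOn
  rw [← h.toLp_sum F c hm, dist_comm, dist_eq_norm, ← MemLp.toLp_sub]
  refine (Lp.norm_le_of_ae_bound (C := ε / 2) (by positivity) ?_).trans_lt ?_
  · filter_upwards [(hw.sub hm).coeFn_toLp, ae_restrict_mem measurableSet_Icc] with t h1 h2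
    rw [h1, Pi.sub_apply, ← dist_eq_norm]
    exact (hF t h2).le
  · simp [measureUnivNNReal]
    linarith

/-- The integrated form of `Au = v`. -/
lemma inner_indicator_toLp [FiniteDimensional ℝ E] (h : IsSpectralOperator J Λ S1 x μ)
    {u v u' : ℝ → E} (hu : ∀ t ∈ Icc (0:ℝ) 1, HasDerivWithinAt u (u' t) (Icc 0 1) t)
    (hv : ∀ t ∈ Icc (0:ℝ) 1, v t = J (u' t) + S1 t (u t))
    (hum : MemLp u 2 unitMeasure) (hvm : MemLp v 2 unitMeasure) {s : ℝ} (hs : s ∈ Icc (0:ℝ) 1)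
    (e : E) :
    ⟪(memLp_indicator_of_continuous (continuous_const (y := e)) s).toLp _, hvm.toLp v⟫ =
      ⟪e, J (u s) - J (u 0)⟫ +
      ⟪(memLp_indicator_of_continuous (h.continuous_S1.clm_apply (continuous_const (y := e)))
        s).toLp _, hum.toLp u⟫ := by
  have i1 : Integrable (fun t => ⟪e, v t⟫) unitMeasure :=
    (hvm.integrable (by norm_num)).const_inner e
  have i2 : Integrable (fun t => ⟪S1 t e, u t⟫) unitMeasure := integrable_inner_of_memLp
    (memLp_unitMeasure_of_continuousOn
      (h.continuous_S1.clm_apply (continuous_const (y := e))).continuousOn) hum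
  have hd : ∀ t ∈ Icc (0:ℝ) 1, HasDerivWithinAt (fun t => ⟪e, J (u t)⟫)
      (⟪e, v t⟫ - ⟪S1 t e, u t⟫) (Icc 0 1) t := by
    intro t ht
    have h2 := ((innerSL ℝ e).hasFDerivAt.comp_hasDerivWithinAt t
      (J.hasFDerivAt.comp_hasDerivWithinAt t (hu t ht)))
    have h3 : ⟪e, v t⟫ - ⟪S1 t e, u t⟫ = ⟪e, J (u' t)⟫ := by
      rw [hv t ht, inner_add_right, h.symm, add_sub_cancel_right]
    rw [h3]
    exact h2
  have h2 := integral_eq_sub_of_hasDerivWithinAt hd (i1.sub i2)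
    (by simp : (0:ℝ) ∈ Icc (0:ℝ) 1) hs hs.1
  have hsub : Icc (0:ℝ) s ⊆ Icc 0 1 := Icc_subset_Icc_right hs.2
  rw [intervalIntegral.integral_of_le hs.1, ← integral_Icc_eq_integral_Ioc, integral_sub
    (i1.mono_measure (Measure.restrict_mono hsub le_rfl))
    (i2.mono_measure (Measure.restrict_mono hsub le_rfl)), ← inner_sub_right] at h2
  have hind : ∀ f g : ℝ → E, ∫ t, ⟪(Icc 0 s).indicator f t, g t⟫ ∂unitMeasure =
      ∫ t in Icc 0 s, ⟪f t, g t⟫ := by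
    intro f g
    have : (fun t => ⟪(Icc 0 s).indicator f t, g t⟫) = (Icc 0 s).indicator fun t => ⟪f t, g t⟫ := by
      ext t
      by_cases h2 : t ∈ Icc 0 s <;> simp [h2]
    rw [this, integral_indicator measurableSet_Icc, Measure.restrict_restrict measurableSet_Icc,
      inter_eq_self_of_subset_left hsub]
  rw [inner_toLp_toLp, inner_toLp_toLp, hind, hind]
  linarith

/-- Parseval's identity for `u` and `Au`, for `u` in the domain of `A`. -/
theorem parseval [FiniteDimensional ℝ E] (h : IsSpectralOperator J Λ S1 x μ) {u u' : ℝ → E}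
    (hu : ∀ t ∈ Icc (0:ℝ) 1, HasDerivWithinAt u (u' t) (Icc 0 1) t)
    (hi : MemLp u' 2 unitMeasure) (h0 : u 0 ∈ Λ) (h1 : u 1 ∈ Λ) :
    HasSum (fun i => coeff x u i ^ 2) (∫ t, ‖u t‖ ^ 2 ∂unitMeasure) ∧
    HasSum (fun i => (μ i * coeff x u i) ^ 2)
      (∫ t, ‖J (u' t) + S1 t (u t)‖ ^ 2 ∂unitMeasure) := by
  set c : ι → ℝ := fun i => coeff x u i with hc
  have huc : ContinuousOn u (Icc 0 1) := fun t ht => (hu t ht).continuousWithinAt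
  have hum := memLp_unitMeasure_of_continuousOn huc
  have hvm : MemLp (fun t => J (u' t) + S1 t (u t)) 2 unitMeasure :=
    (J.comp_memLp' hi).add (memLp_unitMeasure_of_continuousOn
      (h.continuous_S1.continuousOn.clm_apply huc))
  have hcs : Summable fun i => c i ^ 2 := h.summable_coeff_sq hum
  have has : Summable fun i => (μ i * c i) ^ 2 := by
    have := h.summable_coeff_sq hvm
    simpa only [h.coeff_apply hu hi h0 h1] using this
  obtain ⟨w, hw⟩ := h.exists_uniform_limit (c := c) (by
    refine (hcs.add has).congr fun i => ?_
    ring)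
  have hwc : ContinuousOn w (Icc 0 1) := hw.continuousOn
    (Filter.Frequently.of_forall fun F => (h.continuous_sum F c).continuousOn)
  have hwm := memLp_unitMeasure_of_continuousOn hwc
  have hsumw := h.hasSum_toLp_of_tendstoUniformlyOn hwm hw
  have huw : ∀ t ∈ Icc (0:ℝ) 1, u t - w t = 0 := by
    refine h.eigen.2.2.2.2.2 (fun t => u t - w t) (huc.sub hwc) fun i => ?_
    have h2 := h.orthonormal_vec.inner_eq_of_hasSum hsumw i
    rw [h.inner_toLp_vec] at h2
    have h3 := h.inner_toLp_vec (hum.sub hwm) i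
    rw [MemLp.toLp_sub hum hwm, inner_sub_right, h.inner_toLp_vec hum, h.inner_toLp_vec hwm, h2, hc,
      sub_self] at h3
    exact h3.symm
  have huw' : ∀ t ∈ Icc (0:ℝ) 1, w t = u t := fun t ht => (sub_eq_zero.1 (huw t ht)).symm
  have hLp : hwm.toLp w = hum.toLp u := by
    rw [MemLp.toLp_eq_toLp_iff]
    filter_upwards [ae_restrict_mem measurableSet_Icc] with t ht using huw' t ht
  rw [hLp] at hsumw
  have hpt : ∀ t ∈ Icc (0:ℝ) 1, HasSum (fun i => c i • x i t) (u t) := fun t ht => by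
    rw [← huw' t ht]; exact hw.tendsto_at ht
  obtain ⟨z, hz⟩ := h.orthonormal_vec.summable_smul has
  have hzv : hvm.toLp _ = z := by
    rw [← sub_eq_zero]
    refine Lp_eq_zero_of_inner_indicator _ fun s hs e => ?_
    rw [inner_sub_right, sub_eq_zero, h.inner_indicator_toLp hu (fun _ _ => rfl) hum hvm hs e]
    set q := (memLp_indicator_of_continuous (continuous_const (y := e)) s).toLp
      ((Icc 0 s).indicator fun _ => e) with hq
    set g := (memLp_indicator_of_continuous (h.continuous_S1.clm_apply (continuous_const (y := e)))
        s).toLp _ with hg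
    have hfin : ∀ F : Finset ι, ⟪q, ∑ i ∈ F, (μ i * c i) • h.vec i⟫ =
        ⟪e, J (∑ i ∈ F, c i • x i s) - J (∑ i ∈ F, c i • x i 0)⟫ +
        ⟪g, ∑ i ∈ F, c i • h.vec i⟫ := by
      intro F
      have m1 := memLp_unitMeasure_of_continuousOn (h.continuous_sum F c).continuousOn
      have m2 := memLp_unitMeasure_of_continuousOn
        (h.continuous_sum F fun i => μ i * c i).continuousOn
      rw [← h.toLp_sum F _ m1, ← h.toLp_sum F _ m2]
      refine h.inner_indicator_toLp (fun t _ => (h.hasDerivAt_sum F c t).hasDerivWithinAt)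
        (fun t _ => ?_) m1 m2 hs e
      rw [h.J_J]
      simp [mul_comm]
    have l1 : Filter.Tendsto (fun F : Finset ι => ⟪q, ∑ i ∈ F, (μ i * c i) • h.vec i⟫)
        Filter.atTop (nhds ⟪q, z⟫) := Filter.Tendsto.inner tendsto_const_nhds hz
    have l2 : Filter.Tendsto (fun F : Finset ι => ⟪q, ∑ i ∈ F, (μ i * c i) • h.vec i⟫)
        Filter.atTop (nhds (⟪e, J (u s) - J (u 0)⟫ + ⟪g, hum.toLp u⟫)) := by
      simp_rw [hfin]
      refine Filter.Tendsto.add ?_ (Filter.Tendsto.inner tendsto_const_nhds hsumw)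
      refine Filter.Tendsto.inner tendsto_const_nhds (Filter.Tendsto.sub ?_ ?_)
      · exact (J.continuous.tendsto _).comp (hpt s hs)
      · exact (J.continuous.tendsto _).comp (hpt 0 (by simp))
    exact tendsto_nhds_unique l2 l1
  constructor
  · rw [← norm_toLp_sq hum]
    exact h.orthonormal_vec.hasSum_sq_of_hasSum hsumw
  · rw [← norm_toLp_sq hvm, hzv]
    exact h.orthonormal_vec.hasSum_sq_of_hasSum hz

end IsSpectralOperator

/-! ### Measures and derivatives on strips -/

/-- `I` is the half line `[0, ∞)` (with `σ = 1`) or `(-∞, 0]` (with `σ = -1`). -/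
def IsHalfLine (I : Set ℝ) (σ : ℝ) : Prop :=
  (I = Ici (0:ℝ) ∧ σ = 1) ∨ (I = Iic (0:ℝ) ∧ σ = -1)

namespace IsHalfLine

variable {I : Set ℝ} {σ : ℝ}

lemma measurableSet (hI : IsHalfLine I σ) : MeasurableSet I := by
  rcases hI with ⟨rfl, -⟩ | ⟨rfl, -⟩
  exacts [measurableSet_Ici, measurableSet_Iic]

lemma convex (hI : IsHalfLine I σ) : Convex ℝ I := by
  rcases hI with ⟨rfl, -⟩ | ⟨rfl, -⟩
  exacts [convex_Ici 0, convex_Iic 0]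

lemma isClosed (hI : IsHalfLine I σ) : IsClosed I := by
  rcases hI with ⟨rfl, -⟩ | ⟨rfl, -⟩
  exacts [isClosed_Ici, isClosed_Iic]

lemma nonempty_interior (hI : IsHalfLine I σ) : (interior I).Nonempty := by
  rcases hI with ⟨rfl, -⟩ | ⟨rfl, -⟩
  · rw [interior_Ici]; exact nonempty_Ioi
  · rw [interior_Iic]; exact nonempty_Iio

/-- The fundamental theorem of calculus on a half line. -/
lemma integral_deriv (hI : IsHalfLine I σ) {f f' : ℝ → ℝ} (hc : ContinuousOn f I)
    (hd : ∀ s ∈ interior I, HasDerivAt f (f' s) s) (hf : IntegrableOn f I)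
    (hf' : IntegrableOn f' I) : ∫ s in I, f' s = -(σ * f 0) := by
  rcases hI with ⟨rfl, rfl⟩ | ⟨rfl, rfl⟩
  · rw [interior_Ici] at hd
    have h1 := hf'.mono_set Ioi_subset_Ici_self
    rw [integral_Ici_eq_integral_Ioi, integral_Ioi_of_hasDerivAt_of_tendsto
      (hc.continuousWithinAt (by simp)) hd h1 (tendsto_zero_of_hasDerivAt_of_integrableOn_Ioi hd h1
      (hf.mono_set Ioi_subset_Ici_self))]
    ring
  · rw [interior_Iic] at hd
    have hs : Iic (-1:ℝ) ⊆ Iic 0 := Iic_subset_Iic.2 (by norm_num)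
    rw [integral_Iic_of_hasDerivAt_of_tendsto (hc.continuousWithinAt (by simp)) hd hf'
      (tendsto_zero_of_hasDerivAt_of_integrableOn_Iic (a := -1)
        (fun s hs => hd s (hs.trans_lt (by norm_num : (-1:ℝ) < 0)))
        (hf'.mono_set hs) (hf.mono_set hs))]
    ring

end IsHalfLine

lemma volume_restrict_Strip (I : Set ℝ) :
    volume.restrict (Strip I) = (volume.restrict I).prod unitMeasure := by
  rw [Strip, Measure.volume_eq_prod, Measure.prod_restrict]

lemma mk_mem_Strip {I : Set ℝ} {s t : ℝ} (hs : s ∈ I) (ht : t ∈ Icc (0:ℝ) 1) : (s, t) ∈ Strip I :=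
  ⟨hs, ht⟩

lemma measurableSet_Strip {I : Set ℝ} (hI : MeasurableSet I) : MeasurableSet (Strip I) :=
  hI.prod measurableSet_Icc

lemma convex_Strip {I : Set ℝ} (hI : Convex ℝ I) : Convex ℝ (Strip I) := hI.prod (convex_Icc 0 1)

section Derivative

variable {F : Type*} [NormedAddCommGroup F] [NormedSpace ℝ F] {I : Set ℝ} {u : ℝ × ℝ → F}
  {Du : ℝ × ℝ → ℝ × ℝ →L[ℝ] F}

lemma hasDerivWithinAt_snd_of_strip
    (hu : ∀ p ∈ Strip I, HasFDerivWithinAt u (Du p) (Strip I) p) {s t : ℝ} (hs : s ∈ I)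
    (ht : t ∈ Icc (0:ℝ) 1) :
    HasDerivWithinAt (fun t => u (s, t)) (Du (s, t) (0, 1)) (Icc 0 1) t := by
  have h1 : HasDerivWithinAt (fun t : ℝ => (s, t)) ((0:ℝ), (1:ℝ)) (Icc 0 1) t :=
    (hasDerivWithinAt_const _ _ _).prodMk (hasDerivWithinAt_id _ _)
  exact (hu (s, t) (mk_mem_Strip hs ht)).comp_hasDerivWithinAt t h1
    fun r hr => mk_mem_Strip hs hr

lemma hasDerivWithinAt_fst_of_strip
    (hu : ∀ p ∈ Strip I, HasFDerivWithinAt u (Du p) (Strip I) p) {s t : ℝ} (hs : s ∈ I)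
    (ht : t ∈ Icc (0:ℝ) 1) :
    HasDerivWithinAt (fun s => u (s, t)) (Du (s, t) (1, 0)) I s := by
  have h1 : HasDerivWithinAt (fun s : ℝ => (s, t)) ((1:ℝ), (0:ℝ)) I s :=
    (hasDerivWithinAt_id _ _).prodMk (hasDerivWithinAt_const _ _ _)
  exact (hu (s, t) (mk_mem_Strip hs ht)).comp_hasDerivWithinAt s h1
    fun r hr => mk_mem_Strip hr ht

lemma continuousOn_of_strip (hu : ∀ p ∈ Strip I, HasFDerivWithinAt u (Du p) (Strip I) p) :
    ContinuousOn u (Strip I) := fun p hp => (hu p hp).continuousWithinAt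

lemma ContinuousOn.aestronglyMeasurable_strip {G : Type*} [TopologicalSpace G]
    [TopologicalSpace.PseudoMetrizableSpace G] {f : ℝ × ℝ → G}
    (hI : MeasurableSet I) (hf : ContinuousOn f (Strip I)) :
    AEStronglyMeasurable f (volume.restrict (Strip I)) :=
  hf.aestronglyMeasurable (measurableSet_Strip hI)

lemma aestronglyMeasurable_fderiv_apply_of_strip [FiniteDimensional ℝ F] (hI : Convex ℝ I)
    (hm : MeasurableSet I)
    (hu : ∀ p ∈ Strip I, HasFDerivWithinAt u (Du p) (Strip I) p) (w : ℝ × ℝ) :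
    AEStronglyMeasurable (fun p => Du p w) (volume.restrict (Strip I)) := by
  borelize F
  have := FiniteDimensional.complete ℝ F
  have := FiniteDimensional.proper ℝ F
  refine AEStronglyMeasurable.congr
    (measurable_fderiv_apply_const ℝ u w).aestronglyMeasurable ?_
  have h1 : ∀ᵐ p : ℝ × ℝ, p ∉ frontier (Strip I) :=
    measure_eq_zero_iff_ae_notMem.1 ((convex_Strip hI).addHaar_frontier volume)
  refine (ae_restrict_iff' (measurableSet_Strip hm)).2 ?_
  filter_upwards [h1] with p hp hps
  have h2 : Strip I ∈ nhds p := by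
    rw [mem_interior_iff_mem_nhds.symm, ← self_sdiff_frontier]
    exact ⟨hps, hp⟩
  rw [((hu p hps).hasFDerivAt h2).fderiv]

lemma memLp_of_strip [FiniteDimensional ℝ F] (hm : MeasurableSet I)
    (hu : ∀ p ∈ Strip I, HasFDerivWithinAt u (Du p) (Strip I) p)
    (hi : IntegrableOn (fun p => ‖u p‖ ^ 2) (Strip I)) :
    MemLp u 2 (volume.restrict (Strip I)) :=
  (memLp_two_iff_integrable_sq_norm
    ((continuousOn_of_strip hu).aestronglyMeasurable_strip hm)).2 hi

lemma memLp_fderiv_of_strip [FiniteDimensional ℝ F] (hI : Convex ℝ I) (hm : MeasurableSet I)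
    (hu : ∀ p ∈ Strip I, HasFDerivWithinAt u (Du p) (Strip I) p) {w : ℝ × ℝ}
    (hi : IntegrableOn (fun p => ‖Du p w‖ ^ 2) (Strip I)) :
    MemLp (fun p => Du p w) 2 (volume.restrict (Strip I)) :=
  (memLp_two_iff_integrable_sq_norm (aestronglyMeasurable_fderiv_apply_of_strip hI hm hu w)).2 hi

lemma second_derivative_symmetric_of_strip (hI : Convex ℝ I) (hne : (interior I).Nonempty)
    {D2u : ℝ × ℝ → ℝ × ℝ →L[ℝ] ℝ × ℝ →L[ℝ] F}
    (hu : ∀ p ∈ Strip I, HasFDerivWithinAt u (Du p) (Strip I) p)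
    (hDu : ∀ p ∈ Strip I, HasFDerivWithinAt Du (D2u p) (Strip I) p) {p : ℝ × ℝ}
    (hp : p ∈ Strip I) (v w : ℝ × ℝ) : D2u p v w = D2u p w v := by
  refine (convex_Strip hI).second_derivative_within_at_symmetric ?_ (fun q hq =>
    (hu q (interior_subset hq)).hasFDerivAt (mem_interior_iff_mem_nhds.1 hq)) hp
    ((hDu p hp).mono interior_subset) v w
  rw [Strip, interior_prod_eq, interior_Icc]
  exact hne.prod (nonempty_Ioo.2 zero_lt_one)

/-- The derivative of a directional derivative. -/
lemma hasFDerivWithinAt_apply_of_strip {D2u : ℝ × ℝ → ℝ × ℝ →L[ℝ] ℝ × ℝ →L[ℝ] F}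
    (hDu : ∀ p ∈ Strip I, HasFDerivWithinAt Du (D2u p) (Strip I) p) (w : ℝ × ℝ) :
    ∀ p ∈ Strip I, HasFDerivWithinAt (fun p => Du p w) ((D2u p).flip w) (Strip I) p := by
  intro p hp
  have := (hDu p hp).clm_apply (hasFDerivWithinAt_const w p (Strip I))
  simpa using this

end Derivative

lemma MeasureTheory.MemLp.clm_comp {α F G : Type*} [MeasurableSpace α] {m : Measure α}
    [NormedAddCommGroup F] [NormedSpace ℝ F] [NormedAddCommGroup G] [NormedSpace ℝ G]
    {L : α → F →L[ℝ] G} {f : α → F} (hf : MemLp f 2 m)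
    (hLf : AEStronglyMeasurable (fun a => L a (f a)) m) {B : ℝ} (hB : ∀ᵐ a ∂m, ‖L a‖ ≤ B) :
    MemLp (fun a => L a (f a)) 2 m := by
  refine hf.of_le_mul (c := B) hLf ?_
  filter_upwards [hB] with a ha
  exact (L a).le_of_opNorm_le ha _

/-! ### Parseval's identity on strips -/

lemma ae_memLp_slice {F : Type*} [NormedAddCommGroup F] {I : Set ℝ} {U : ℝ × ℝ → F}
    (hU : MemLp U 2 (volume.restrict (Strip I))) :
    ∀ᵐ s ∂volume.restrict I, MemLp (fun t => U (s, t)) 2 unitMeasure := by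
  rw [volume_restrict_Strip] at hU
  filter_upwards [hU.1.prodMk_left, hU.integrable_norm_sq.prod_right_ae] with s h1 h2
  exact (memLp_two_iff_integrable_sq_norm h1).2 h2

namespace IsSpectralOperator

variable {J : E →L[ℝ] E} {Λ : Submodule ℝ E} {S1 : ℝ → E →L[ℝ] E} {ι : Type*} {x : ι → ℝ → E}
  {μ : ι → ℝ} {I : Set ℝ}

lemma coeff_eq_unitMeasure (x : ι → ℝ → E) (γ : ℝ → E) (i : ι) :
    coeff x γ i = ∫ t, ⟪γ t, x i t⟫ ∂unitMeasure := intervalIntegral_eq_unitMeasure _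

lemma aestronglyMeasurable_coeff (h : IsSpectralOperator J Λ S1 x μ) {U : ℝ × ℝ → E}
    (hU : AEStronglyMeasurable U (volume.restrict (Strip I))) (i : ι) :
    AEStronglyMeasurable (fun s => coeff x (fun t => U (s, t)) i) (volume.restrict I) := by
  rw [volume_restrict_Strip] at hU
  simp_rw [coeff_eq_unitMeasure]
  have h1 : AEStronglyMeasurable (fun p : ℝ × ℝ => ⟪U p, x i p.2⟫)
      ((volume.restrict I).prod unitMeasure) :=
    hU.inner ((h.continuous_x i).comp continuous_snd).aestronglyMeasurable
  exact h1.integral_prod_right'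

lemma coeff_sq_le (h : IsSpectralOperator J Λ S1 x μ) {f : ℝ → E} (hf : MemLp f 2 unitMeasure)
    (i : ι) : coeff x f i ^ 2 ≤ ∫ t, ‖f t‖ ^ 2 ∂unitMeasure := by
  rw [← norm_toLp_sq hf, ← h.inner_toLp_vec hf i]
  have h1 := abs_real_inner_le_norm (h.vec i) (hf.toLp f)
  rw [h.orthonormal_vec.1 i, one_mul] at h1
  exact sq_le_sq' (abs_le.1 h1).1 (abs_le.1 h1).2

lemma integrable_coeff_sq (h : IsSpectralOperator J Λ S1 x μ) {U : ℝ × ℝ → E}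
    (hU : MemLp U 2 (volume.restrict (Strip I))) (i : ι) :
    IntegrableOn (fun s => coeff x (fun t => U (s, t)) i ^ 2) I := by
  have h1 := hU.integrable_norm_sq
  rw [volume_restrict_Strip] at h1
  refine h1.integral_prod_left.mono' ((h.aestronglyMeasurable_coeff hU.1 i).pow 2) ?_
  filter_upwards [ae_memLp_slice hU] with s hs
  rw [Real.norm_of_nonneg (sq_nonneg _)]
  exact h.coeff_sq_le hs i

variable [FiniteDimensional ℝ E]

lemma ae_parseval (h : IsSpectralOperator J Λ S1 x μ) (hm : MeasurableSet I)
    {U Ut : ℝ × ℝ → E}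
    (hd : ∀ s ∈ I, ∀ t ∈ Icc (0:ℝ) 1,
      HasDerivWithinAt (fun t => U (s, t)) (Ut (s, t)) (Icc 0 1) t)
    (hUt : MemLp Ut 2 (volume.restrict (Strip I))) (hbc : LagBC Λ I U) :
    ∀ᵐ s ∂volume.restrict I,
      HasSum (fun i => coeff x (fun t => U (s, t)) i ^ 2) (∫ t, ‖U (s, t)‖ ^ 2 ∂unitMeasure) ∧
      HasSum (fun i => (μ i * coeff x (fun t => U (s, t)) i) ^ 2)
        (∫ t, ‖J (Ut (s, t)) + S1 t (U (s, t))‖ ^ 2 ∂unitMeasure) := by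
  filter_upwards [ae_memLp_slice hUt, ae_restrict_mem hm] with s hs hsI
  exact h.parseval (hd s hsI) hs (hbc s hsI).1 (hbc s hsI).2

lemma memLp_apply (h : IsSpectralOperator J Λ S1 x μ) (hm : MeasurableSet I) {U Ut : ℝ × ℝ → E}
    (hU : MemLp U 2 (volume.restrict (Strip I))) (hUt : MemLp Ut 2 (volume.restrict (Strip I))) :
    MemLp (fun p => J (Ut p) + S1 p.2 (U p)) 2 (volume.restrict (Strip I)) := by
  obtain ⟨B, hB0, hB⟩ := h.exists_bound
  refine (J.comp_memLp' hUt).add (hU.clm_comp (B := B) ?_ ?_)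
  · exact isBoundedBilinearMap_apply.continuous.comp_aestronglyMeasurable
      ((h.continuous_S1.comp continuous_snd).aestronglyMeasurable.prodMk hU.1)
  · filter_upwards [ae_restrict_mem (measurableSet_Strip hm)] with p hp using hB _ hp.2

/-- Parseval's identity on a strip. -/
theorem strip_parseval (h : IsSpectralOperator J Λ S1 x μ) (hm : MeasurableSet I)
    {U Ut : ℝ × ℝ → E}
    (hd : ∀ s ∈ I, ∀ t ∈ Icc (0:ℝ) 1,
      HasDerivWithinAt (fun t => U (s, t)) (Ut (s, t)) (Icc 0 1) t)
    (hU : MemLp U 2 (volume.restrict (Strip I)))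
    (hUt : MemLp Ut 2 (volume.restrict (Strip I))) (hbc : LagBC Λ I U) :
    HasSum (fun i => ∫ s in I, coeff x (fun t => U (s, t)) i ^ 2) (∫ p in Strip I, ‖U p‖ ^ 2) ∧
    HasSum (fun i => ∫ s in I, (μ i * coeff x (fun t => U (s, t)) i) ^ 2)
      (∫ p in Strip I, ‖J (Ut p) + S1 p.2 (U p)‖ ^ 2) := by
  have := h.countable_index
  have hae := h.ae_parseval hm hd hUt hbc
  have key : ∀ (a : ι → ℝ → ℝ) (f : ℝ × ℝ → ℝ), Integrable f (volume.restrict (Strip I)) →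
      (∀ i, AEStronglyMeasurable (a i) (volume.restrict I)) → (∀ i s, 0 ≤ a i s) →
      (∀ᵐ s ∂volume.restrict I, HasSum (fun i => a i s) (∫ t, f (s, t) ∂unitMeasure)) →
      HasSum (fun i => ∫ s in I, a i s) (∫ p in Strip I, f p) := by
    intro a f hf ha h0 hs
    rw [volume_restrict_Strip] at hf ⊢
    rw [integral_prod f hf]
    refine hasSum_integral_of_dominated_convergence a ha
      (fun i => Filter.Eventually.of_forall fun s => (Real.norm_of_nonneg (h0 i s)).le)
      (hs.mono fun s hs => hs.summable) (hf.integral_prod_left.congr ?_) hs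
    filter_upwards [hs] with s hs using hs.tsum_eq.symm
  have hcm := fun i => h.aestronglyMeasurable_coeff hU.1 i
  exact ⟨key _ _ hU.integrable_norm_sq (fun i => (hcm i).pow 2) (fun _ _ => sq_nonneg _)
    (hae.mono fun s hs => hs.1),
    key _ _ (h.memLp_apply hm hU hUt).integrable_norm_sq (fun i => ((hcm i).const_mul _).pow 2)
    (fun _ _ => sq_nonneg _) (hae.mono fun s hs => hs.2)⟩

/-- The operator `A` controls the `L²`-norms of `U` and `∂_t U`. -/
theorem exists_strip_bound (h : IsSpectralOperator J Λ S1 x μ) :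
    ∃ C, 0 ≤ C ∧ ∀ (I : Set ℝ) (U Ut : ℝ × ℝ → E), MeasurableSet I →
      (∀ s ∈ I, ∀ t ∈ Icc (0:ℝ) 1,
        HasDerivWithinAt (fun t => U (s, t)) (Ut (s, t)) (Icc 0 1) t) →
      MemLp U 2 (volume.restrict (Strip I)) → MemLp Ut 2 (volume.restrict (Strip I)) →
      LagBC Λ I U →
      ∫ p in Strip I, ‖U p‖ ^ 2 ≤ C * ∫ p in Strip I, ‖J (Ut p) + S1 p.2 (U p)‖ ^ 2 ∧
      ∫ p in Strip I, ‖Ut p‖ ^ 2 ≤ C * ∫ p in Strip I, ‖J (Ut p) + S1 p.2 (U p)‖ ^ 2 := by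
  obtain ⟨m, hm, hgap⟩ := h.exists_gap
  obtain ⟨B, hB0, hB⟩ := h.exists_bound
  have hC0 : 0 ≤ (m ^ 2)⁻¹ := by positivity
  refine ⟨(m ^ 2)⁻¹ + (2 + 2 * B ^ 2 * (m ^ 2)⁻¹), by positivity,
    fun I U Ut hI hd hU hUt hbc => ?_⟩
  obtain ⟨h1, h2⟩ := h.strip_parseval hI hd hU hUt hbc
  have hA := h.memLp_apply hI hU hUt
  have h3 : ∫ p in Strip I, ‖U p‖ ^ 2 ≤
      (m ^ 2)⁻¹ * ∫ p in Strip I, ‖J (Ut p) + S1 p.2 (U p)‖ ^ 2 := by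
    refine hasSum_le (fun i => ?_) h1 (h2.mul_left _)
    simp_rw [mul_pow]
    rw [integral_const_mul, ← mul_assoc]
    refine le_mul_of_one_le_left (integral_nonneg fun _ => sq_nonneg _) ?_
    rw [inv_mul_eq_div, one_le_div (by positivity), ← sq_abs (μ i)]
    have := hgap i
    gcongr
  have h4 : ∫ p in Strip I, ‖Ut p‖ ^ 2 ≤
      2 * (∫ p in Strip I, ‖J (Ut p) + S1 p.2 (U p)‖ ^ 2) +
        2 * B ^ 2 * ∫ p in Strip I, ‖U p‖ ^ 2 := by
    refine integral_norm_sq_le_of_le hA hU ?_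
    filter_upwards [ae_restrict_mem (measurableSet_Strip hI)] with p hp
    have h5 := norm_sub_sq_le_two (J (Ut p) + S1 p.2 (U p)) (S1 p.2 (U p))
    rw [add_sub_cancel_right, h.norm_J] at h5
    have h6 : ‖S1 p.2 (U p)‖ ^ 2 ≤ (B * ‖U p‖) ^ 2 := by
      have := (S1 p.2).le_of_opNorm_le (hB _ hp.2) (U p)
      gcongr
    nlinarith
  have h0 : 0 ≤ ∫ p in Strip I, ‖J (Ut p) + S1 p.2 (U p)‖ ^ 2 :=
    integral_nonneg fun _ => sq_nonneg _
  have hx : 0 ≤ 2 * B ^ 2 := by positivity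
  constructor
  · nlinarith [mul_nonneg hx hC0]
  · nlinarith [mul_le_mul_of_nonneg_left h3 hx]

end IsSpectralOperator

/-! ### The evolution of the modes -/

lemma IsHalfLine.integral_mode {I : Set ℝ} {σ : ℝ} (hI : IsHalfLine I σ) {c d : ℝ → ℝ} (m : ℝ)
    (hc : ContinuousOn c I) (hd : ∀ s ∈ interior I, HasDerivAt c (d s) s)
    (hdm : ContinuousOn d I) (hc2 : IntegrableOn (fun s => c s ^ 2) I)
    (hd2 : IntegrableOn (fun s => d s ^ 2) I) :
    ∫ s in I, (d s + m * c s) ^ 2 =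
      (∫ s in I, d s ^ 2) + m ^ 2 * (∫ s in I, c s ^ 2) - σ * m * c 0 ^ 2 := by
  have mc : MemLp c 2 (volume.restrict I) := (memLp_two_iff_integrable_sq
    (hc.aestronglyMeasurable hI.measurableSet)).2 hc2
  have md : MemLp d 2 (volume.restrict I) := (memLp_two_iff_integrable_sq
    (hdm.aestronglyMeasurable hI.measurableSet)).2 hd2
  have hcd : IntegrableOn (fun s => 2 * (c s * d s)) I := (mc.integrable_mul md).const_mul 2
  have h1 : ∫ s in I, 2 * (c s * d s) = -(σ * c 0 ^ 2) := by
    refine hI.integral_deriv (hc.pow 2) (fun s hs => ?_) hc2 hcd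
    refine ((hd s hs).pow 2).congr_deriv ?_
    push_cast
    ring
  have h2 : (fun s => (d s + m * c s) ^ 2) =
      fun s => d s ^ 2 + m ^ 2 * c s ^ 2 + m * (2 * (c s * d s)) := by
    ext s; ring
  have h3 : IntegrableOn (fun s => d s ^ 2 + m ^ 2 * c s ^ 2) I := hd2.add (hc2.const_mul _)
  rw [h2, integral_add h3 (hcd.const_mul _),
    integral_add hd2 (hc2.const_mul _), integral_const_mul, integral_const_mul, h1]
  ring

lemma exists_norm_le_near_of_strip {F : Type*} [NormedAddCommGroup F] {I : Set ℝ} (hI : IsClosed I)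
    {f : ℝ × ℝ → F} (hf : ContinuousOn f (Strip I)) (s : ℝ) :
    ∃ C, 0 ≤ C ∧ ∀ r ∈ I, r ∈ Icc (s - 1) (s + 1) → ∀ t ∈ Icc (0:ℝ) 1, ‖f (r, t)‖ ≤ C := by
  have hc : IsCompact ((I ∩ Icc (s - 1) (s + 1)) ×ˢ Icc (0:ℝ) 1) :=
    (isCompact_Icc.inter_left hI).prod isCompact_Icc
  obtain ⟨C, hC⟩ := hc.exists_bound_of_continuousOn
    (hf.mono (prod_mono_left inter_subset_left))
  exact ⟨max C 0, le_max_right _ _, fun r hr hr' t ht =>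
    (hC (r, t) ⟨⟨hr, hr'⟩, ht⟩).trans (le_max_left _ _)⟩

lemma continuousOn_slice_of_strip {F : Type*} [TopologicalSpace F] {I : Set ℝ} {f : ℝ × ℝ → F}
    (hf : ContinuousOn f (Strip I)) {s : ℝ} (hs : s ∈ I) :
    ContinuousOn (fun t => f (s, t)) (Icc 0 1) :=
  hf.comp (by fun_prop) fun _ ht => mk_mem_Strip hs ht

namespace IsSpectralOperator

variable {J : E →L[ℝ] E} {Λ : Submodule ℝ E} {S1 : ℝ → E →L[ℝ] E} {ι : Type*} {x : ι → ℝ → E}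
  {μ : ι → ℝ} {I : Set ℝ}

lemma integrable_inner_x (h : IsSpectralOperator J Λ S1 x μ) {f : ℝ → E}
    (hf : ContinuousOn f (Icc 0 1)) (i : ι) : Integrable (fun t => ⟪f t, x i t⟫) unitMeasure :=
  integrable_inner_of_memLp (memLp_unitMeasure_of_continuousOn hf) (h.memLp_x i)

lemma coeff_add (h : IsSpectralOperator J Λ S1 x μ) {f g : ℝ → E}
    (hf : ContinuousOn f (Icc 0 1)) (hg : ContinuousOn g (Icc 0 1)) (i : ι) :
    coeff x (fun t => f t + g t) i = coeff x f i + coeff x g i := by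
  simp_rw [coeff_eq_unitMeasure, inner_add_left]
  exact integral_add (h.integrable_inner_x hf i) (h.integrable_inner_x hg i)

lemma continuousOn_coeff (h : IsSpectralOperator J Λ S1 x μ) (hI : IsClosed I) {u : ℝ × ℝ → E}
    (hu : ContinuousOn u (Strip I)) (i : ι) :
    ContinuousOn (fun s => coeff x (fun t => u (s, t)) i) I := by
  intro s hs
  obtain ⟨C, hC0, hC⟩ := exists_norm_le_near_of_strip hI hu s
  obtain ⟨B, hB0, hB⟩ := exists_norm_le_of_continuous (h.continuous_x i)
  simp_rw [coeff_eq_unitMeasure]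
  refine continuousWithinAt_of_dominated (bound := fun _ => C * B) ?_ ?_ (integrable_const _) ?_
  · filter_upwards [self_mem_nhdsWithin] with r hr
    exact (h.integrable_inner_x (continuousOn_slice_of_strip hu hr) i).1
  · filter_upwards [self_mem_nhdsWithin, mem_nhdsWithin_of_mem_nhds
      (Icc_mem_nhds (sub_one_lt s) (lt_add_one s))] with r hr hr'
    filter_upwards [ae_restrict_mem measurableSet_Icc] with t ht
    refine (norm_inner_le_norm _ _).trans ?_
    have h1 := hC r hr hr' t ht
    have h2 := hB t ht
    gcongr
  · filter_upwards [ae_restrict_mem measurableSet_Icc] with t ht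
    have h1 : ContinuousWithinAt (fun s => u (s, t)) I s :=
      (hu.comp (f := fun s => (s, t)) (by fun_prop) fun _ hr => mk_mem_Strip hr ht) s hs
    exact h1.inner continuousWithinAt_const

lemma hasDerivAt_coeff (h : IsSpectralOperator J Λ S1 x μ) (hI : IsClosed I) {u : ℝ × ℝ → E}
    {Du : ℝ × ℝ → ℝ × ℝ →L[ℝ] E}
    (hu : ∀ p ∈ Strip I, HasFDerivWithinAt u (Du p) (Strip I) p)
    (hDu : ContinuousOn (fun p => Du p (1, 0)) (Strip I)) (i : ι) {s : ℝ} (hs : s ∈ interior I) :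
    HasDerivAt (fun s => coeff x (fun t => u (s, t)) i)
      (coeff x (fun t => Du (s, t) (1, 0)) i) s := by
  obtain ⟨C, hC0, hC⟩ := exists_norm_le_near_of_strip hI hDu s
  obtain ⟨B, hB0, hB⟩ := exists_norm_le_of_continuous (h.continuous_x i)
  have huc := continuousOn_of_strip hu
  have hsI := interior_subset hs
  have hnhds : interior I ∩ Icc (s - 1) (s + 1) ∈ nhds s := Filter.inter_mem
    (isOpen_interior.mem_nhds hs) (Icc_mem_nhds (sub_one_lt s) (lt_add_one s))
  simp_rw [coeff_eq_unitMeasure]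
  refine (hasDerivAt_integral_of_dominated_loc_of_deriv_le (bound := fun _ => C * B)
    (F' := fun s t => ⟪Du (s, t) (1, 0), x i t⟫) hnhds ?_
    (h.integrable_inner_x (continuousOn_slice_of_strip huc hsI) i)
    (h.integrable_inner_x (continuousOn_slice_of_strip hDu hsI) i).1 ?_
    (integrable_const _) ?_).2
  · filter_upwards [hnhds] with r hr
    exact (h.integrable_inner_x (continuousOn_slice_of_strip huc (interior_subset hr.1)) i).1
  · filter_upwards [ae_restrict_mem measurableSet_Icc] with t ht r hr
    refine (norm_inner_le_norm _ _).trans ?_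
    have h1 := hC r (interior_subset hr.1) hr.2 t ht
    have h2 := hB t ht
    gcongr
  · filter_upwards [ae_restrict_mem measurableSet_Icc] with t ht r hr
    have h1 := (hasDerivWithinAt_fst_of_strip hu (interior_subset hr.1) ht).hasDerivAt
      (mem_interior_iff_mem_nhds.1 hr.1)
    simpa using h1.inner ℝ (hasDerivAt_const r (x i t))

end IsSpectralOperator

lemma Submodule.mem_of_hasDerivWithinAt [FiniteDimensional ℝ E] (Λ : Submodule ℝ E) {I : Set ℝ}
    {f : ℝ → E} {f' : E} {s : ℝ} (hI : UniqueDiffWithinAt ℝ I s) (hs : s ∈ I)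
    (hf : HasDerivWithinAt f f' I s) (hmem : ∀ r ∈ I, f r ∈ Λ) : f' ∈ Λ := by
  rw [← Λ.orthogonal_orthogonal, Submodule.mem_orthogonal]
  intro w hw
  have h1 : HasDerivWithinAt (fun r => ⟪w, f r⟫) ⟪w, f'⟫ I s :=
    (innerSL ℝ w).hasFDerivAt.comp_hasDerivWithinAt s hf
  have h2 : ∀ r ∈ I, ⟪w, f r⟫ = 0 := fun r hr => by
    rw [real_inner_comm]
    exact (Submodule.mem_orthogonal _ _).1 hw _ (hmem r hr)
  have h3 : HasDerivWithinAt (fun r => ⟪w, f r⟫) 0 I s :=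
    (hasDerivWithinAt_const s I (0:ℝ)).congr h2 (h2 s hs)
  exact hI.eq_deriv _ h1 h3

lemma IsHalfLine.lagBC_deriv [FiniteDimensional ℝ E] {Λ : Submodule ℝ E} {I : Set ℝ} {σ : ℝ}
    (hI : IsHalfLine I σ) {u : ℝ × ℝ → E} {Du : ℝ × ℝ → ℝ × ℝ →L[ℝ] E}
    (hu : ∀ p ∈ Strip I, HasFDerivWithinAt u (Du p) (Strip I) p) (hbc : LagBC Λ I u) :
    LagBC Λ I fun p => Du p (1, 0) := by
  intro s hs
  have hud := uniqueDiffOn_convex hI.convex hI.nonempty_interior s hs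
  exact ⟨Λ.mem_of_hasDerivWithinAt hud hs (hasDerivWithinAt_fst_of_strip hu hs (by simp))
      fun r hr => (hbc r hr).1,
    Λ.mem_of_hasDerivWithinAt hud hs (hasDerivWithinAt_fst_of_strip hu hs (by simp))
      fun r hr => (hbc r hr).2⟩

/-! ### The estimate for the autonomous operator -/

/-- The function `AU = J∂_tU + S₁U`, given `U` and `∂_tU`. -/
def stripOp (J : E →L[ℝ] E) (S1 : ℝ → E →L[ℝ] E) (U Ut : ℝ × ℝ → E) (p : ℝ × ℝ) : E :=
  J (Ut p) + S1 p.2 (U p)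

/-- The function `∂_t(Au)`. -/
def stripOpDeriv (J : E →L[ℝ] E) (S1 : ℝ → E →L[ℝ] E) (u : ℝ × ℝ → E)
    (Du : ℝ × ℝ → ℝ × ℝ →L[ℝ] E) (D2u : ℝ × ℝ → ℝ × ℝ →L[ℝ] ℝ × ℝ →L[ℝ] E) (p : ℝ × ℝ) : E :=
  J (D2u p (0, 1) (0, 1)) + (deriv S1 p.2 (u p) + S1 p.2 (Du p (0, 1)))

namespace W22On

variable {I : Set ℝ} {σ : ℝ} {u : ℝ × ℝ → E} {Du : ℝ × ℝ → ℝ × ℝ →L[ℝ] E}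
  {D2u : ℝ × ℝ → ℝ × ℝ →L[ℝ] ℝ × ℝ →L[ℝ] E}

lemma hasFDerivWithinAt (hu : W22On I u Du D2u) :
    ∀ p ∈ Strip I, HasFDerivWithinAt u (Du p) (Strip I) p := hu.1.1

lemma hasFDerivWithinAt_apply (hu : W22On I u Du D2u) (w : ℝ × ℝ) :
    ∀ p ∈ Strip I, HasFDerivWithinAt (fun p => Du p w) ((D2u p).flip w) (Strip I) p :=
  hasFDerivWithinAt_apply_of_strip hu.2.1 w

lemma continuousOn (hu : W22On I u Du D2u) : ContinuousOn u (Strip I) :=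
  continuousOn_of_strip hu.hasFDerivWithinAt

lemma continuousOn_apply (hu : W22On I u Du D2u) (w : ℝ × ℝ) :
    ContinuousOn (fun p => Du p w) (Strip I) :=
  continuousOn_of_strip (hu.hasFDerivWithinAt_apply w)

lemma symm (hu : W22On I u Du D2u) (hI : IsHalfLine I σ) {p : ℝ × ℝ} (hp : p ∈ Strip I)
    (v w : ℝ × ℝ) : D2u p v w = D2u p w v :=
  second_derivative_symmetric_of_strip hI.convex hI.nonempty_interior hu.hasFDerivWithinAt hu.2.1
    hp v w

variable [FiniteDimensional ℝ E]

lemma memLp (hu : W22On I u Du D2u) (hI : IsHalfLine I σ) :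
    MemLp u 2 (volume.restrict (Strip I)) :=
  memLp_of_strip hI.measurableSet hu.1.1 hu.1.2.1

lemma memLp_s (hu : W22On I u Du D2u) (hI : IsHalfLine I σ) :
    MemLp (fun p => Du p (1, 0)) 2 (volume.restrict (Strip I)) :=
  memLp_fderiv_of_strip hI.convex hI.measurableSet hu.1.1 hu.1.2.2.1

lemma memLp_t (hu : W22On I u Du D2u) (hI : IsHalfLine I σ) :
    MemLp (fun p => Du p (0, 1)) 2 (volume.restrict (Strip I)) :=
  memLp_fderiv_of_strip hI.convex hI.measurableSet hu.1.1 hu.1.2.2.2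

lemma memLp_ss (hu : W22On I u Du D2u) (hI : IsHalfLine I σ) :
    MemLp (fun p => D2u p (1, 0) (1, 0)) 2 (volume.restrict (Strip I)) :=
  memLp_fderiv_of_strip hI.convex hI.measurableSet (hu.hasFDerivWithinAt_apply (1, 0)) hu.2.2.1

lemma memLp_st (hu : W22On I u Du D2u) (hI : IsHalfLine I σ) :
    MemLp (fun p => D2u p (1, 0) (0, 1)) 2 (volume.restrict (Strip I)) :=
  memLp_fderiv_of_strip hI.convex hI.measurableSet (hu.hasFDerivWithinAt_apply (0, 1)) hu.2.2.2.1

lemma memLp_tt (hu : W22On I u Du D2u) (hI : IsHalfLine I σ) :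
    MemLp (fun p => D2u p (0, 1) (0, 1)) 2 (volume.restrict (Strip I)) :=
  memLp_fderiv_of_strip hI.convex hI.measurableSet (hu.hasFDerivWithinAt_apply (0, 1)) hu.2.2.2.2

end W22On

namespace IsSpectralOperator

variable {J : E →L[ℝ] E} {Λ : Submodule ℝ E} {S1 : ℝ → E →L[ℝ] E} {ι : Type*} {x : ι → ℝ → E}
  {μ : ι → ℝ} {I : Set ℝ} {σ : ℝ} {u : ℝ × ℝ → E} {Du : ℝ × ℝ → ℝ × ℝ →L[ℝ] E}
  {D2u : ℝ × ℝ → ℝ × ℝ →L[ℝ] ℝ × ℝ →L[ℝ] E}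

lemma continuous_deriv_S1 (h : IsSpectralOperator J Λ S1 x μ) : Continuous (deriv S1) :=
  h.smooth.continuous_deriv (by simp)

lemma hasDerivAt_S1 (h : IsSpectralOperator J Λ S1 x μ) (t : ℝ) :
    HasDerivAt S1 (deriv S1 t) t :=
  (h.smooth.differentiable (by simp) t).hasDerivAt

lemma continuousOn_stripOp (h : IsSpectralOperator J Λ S1 x μ) {U Ut : ℝ × ℝ → E}
    (hU : ContinuousOn U (Strip I)) (hUt : ContinuousOn Ut (Strip I)) :
    ContinuousOn (stripOp J S1 U Ut) (Strip I) :=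
  (J.continuous.comp_continuousOn hUt).add
    ((h.continuous_S1.comp continuous_snd).continuousOn.clm_apply hU)

lemma hasDerivWithinAt_stripOp (h : IsSpectralOperator J Λ S1 x μ) (hu : W22On I u Du D2u) :
    ∀ s ∈ I, ∀ t ∈ Icc (0:ℝ) 1,
      HasDerivWithinAt (fun t => stripOp J S1 u (fun p => Du p (0, 1)) (s, t))
        (stripOpDeriv J S1 u Du D2u (s, t)) (Icc 0 1) t := by
  intro s hs t ht
  refine (J.hasFDerivAt.comp_hasDerivWithinAt t
    (hasDerivWithinAt_snd_of_strip (hu.hasFDerivWithinAt_apply (0, 1)) hs ht)).add ?_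
  exact (h.hasDerivAt_S1 t).hasDerivWithinAt.clm_apply
    (hasDerivWithinAt_snd_of_strip hu.hasFDerivWithinAt hs ht)

variable [FiniteDimensional ℝ E]

lemma memLp_stripOpDeriv (h : IsSpectralOperator J Λ S1 x μ) (hI : IsHalfLine I σ)
    (hu : W22On I u Du D2u) :
    MemLp (stripOpDeriv J S1 u Du D2u) 2 (volume.restrict (Strip I)) := by
  obtain ⟨B, hB0, hB⟩ := exists_norm_le_of_continuous h.continuous_deriv_S1
  have h1 : MemLp (fun p : ℝ × ℝ => deriv S1 p.2 (u p)) 2 (volume.restrict (Strip I)) := by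
    refine (hu.memLp hI).clm_comp (B := B) ?_ ?_
    · exact ((h.continuous_deriv_S1.comp continuous_snd).continuousOn.clm_apply
        hu.continuousOn).aestronglyMeasurable_strip hI.measurableSet
    · filter_upwards [ae_restrict_mem (measurableSet_Strip hI.measurableSet)] with p hp
        using hB _ hp.2
  have h2 := h.memLp_apply hI.measurableSet (hu.memLp_t hI) (hu.memLp_tt hI)
  refine (h2.add h1).congr_norm ?_ (Filter.Eventually.of_forall fun p => ?_)
  · exact (h2.add h1).1.congr (Filter.Eventually.of_forall fun p => by
      simp only [Pi.add_apply, stripOpDeriv]; abel)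
  · simp only [Pi.add_apply, stripOpDeriv]
    congr 1
    abel

theorem spectral_estimate (h : IsSpectralOperator J Λ S1 x μ) (hI : IsHalfLine I σ)
    {P : ℝ → Prop} (hP : ∀ r, P r ↔ 0 < σ * r) (hu : W22On I u Du D2u) (hbc : LagBC Λ I u)
    (hbc2 : LagBC2 Λ J S1 I u Du) :
    (∫ p in Strip I, ‖stripOp J S1 (fun p => Du p (1, 0)) (fun p => D2u p (1, 0) (0, 1)) p‖ ^ 2) +
      (∫ p in Strip I, ‖stripOp J S1 (stripOp J S1 u fun p => Du p (0, 1))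
        (stripOpDeriv J S1 u Du D2u) p‖ ^ 2) ≤
    (∫ p in Strip I, ‖stripOp J S1
        (fun p => Du p (1, 0) + stripOp J S1 u (fun p => Du p (0, 1)) p)
        (fun p => D2u p (1, 0) (0, 1) + stripOpDeriv J S1 u Du D2u p) p‖ ^ 2) +
      norm32P x μ P (fun t => u (0, t)) ^ 2 := by
  have hm := hI.measurableSet
  set V : ℝ × ℝ → E := stripOp J S1 u fun p => Du p (0, 1) with hV
  have hVc : ContinuousOn V (Strip I) := h.continuousOn_stripOp hu.continuousOn
    (hu.continuousOn_apply _)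
  have hVd := h.hasDerivWithinAt_stripOp hu
  have hVm : MemLp V 2 (volume.restrict (Strip I)) := h.memLp_apply hm (hu.memLp hI) (hu.memLp_t hI)
  have hVtm := h.memLp_stripOpDeriv hI hu
  have hsc := hu.continuousOn_apply (1, 0)
  have hsd : ∀ s ∈ I, ∀ t ∈ Icc (0:ℝ) 1, HasDerivWithinAt (fun t => Du (s, t) (1, 0))
      (D2u (s, t) (1, 0) (0, 1)) (Icc 0 1) t := by
    intro s hs t ht
    rw [hu.symm hI (mk_mem_Strip hs ht)]
    exact hasDerivWithinAt_snd_of_strip (hu.hasFDerivWithinAt_apply (1, 0)) hs ht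
  have hsbc := hI.lagBC_deriv hu.hasFDerivWithinAt hbc
  have s1 := (h.strip_parseval hm hsd (hu.memLp_s hI) (hu.memLp_st hI) hsbc).2
  have s2 := (h.strip_parseval (U := V) hm hVd hVm hVtm hbc2).2
  have s3 := (h.strip_parseval (U := fun p => Du p (1, 0) + V p)
    (Ut := fun p => D2u p (1, 0) (0, 1) + stripOpDeriv J S1 u Du D2u p) hm
    (fun s hs t ht => (hsd s hs t ht).add (hVd s hs t ht)) ((hu.memLp_s hI).add hVm)
    ((hu.memLp_st hI).add hVtm)
    (fun s hs => ⟨Λ.add_mem (hsbc s hs).1 (hbc2 s hs).1, Λ.add_mem (hsbc s hs).2 (hbc2 s hs).2⟩)).2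
  set c : ι → ℝ → ℝ := fun i s => coeff x (fun t => u (s, t)) i with hc
  set d : ι → ℝ → ℝ := fun i s => coeff x (fun t => Du (s, t) (1, 0)) i with hd
  have hcV : ∀ s ∈ I, ∀ i, coeff x (fun t => V (s, t)) i = μ i * c i s := fun s hs i =>
    h.coeff_apply (fun t ht => hasDerivWithinAt_snd_of_strip hu.hasFDerivWithinAt hs ht)
      (memLp_unitMeasure_of_continuousOn (continuousOn_slice_of_strip
        (hu.continuousOn_apply (0, 1)) hs)) (hbc s hs).1 (hbc s hs).2 i
  have hce : ∀ s ∈ I, ∀ i, coeff x (fun t => Du (s, t) (1, 0) + V (s, t)) i =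
      d i s + μ i * c i s := fun s hs i => by
    rw [h.coeff_add (continuousOn_slice_of_strip hsc hs) (continuousOn_slice_of_strip hVc hs),
      hcV s hs]
  have e1 : ∀ i, ∫ s in I, (μ i * d i s) ^ 2 = μ i ^ 2 * ∫ s in I, d i s ^ 2 := fun i => by
    simp_rw [mul_pow, integral_const_mul]
  have e2 : ∀ i, ∫ s in I, (μ i * coeff x (fun t => V (s, t)) i) ^ 2 =
      μ i ^ 2 * (μ i ^ 2 * ∫ s in I, c i s ^ 2) := fun i => by
    rw [← integral_const_mul, ← integral_const_mul]
    refine setIntegral_congr_fun hm fun s hs => ?_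
    simp only [hcV s hs i]
    ring
  have e3 : ∀ i, ∫ s in I, (μ i * coeff x (fun t => Du (s, t) (1, 0) + V (s, t)) i) ^ 2 =
      μ i ^ 2 * ∫ s in I, (d i s + μ i * c i s) ^ 2 := fun i => by
    rw [← integral_const_mul]
    refine setIntegral_congr_fun hm fun s hs => ?_
    simp only [hce s hs i]
    ring
  have hmode : ∀ i, ∫ s in I, (d i s + μ i * c i s) ^ 2 =
      (∫ s in I, d i s ^ 2) + μ i ^ 2 * (∫ s in I, c i s ^ 2) - σ * μ i * c i 0 ^ 2 := fun i =>
    hI.integral_mode (μ i) (h.continuousOn_coeff hI.isClosed hu.continuousOn i)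
      (fun s hs => h.hasDerivAt_coeff hI.isClosed hu.hasFDerivWithinAt hsc i hs)
      (h.continuousOn_coeff hI.isClosed hsc i) (h.integrable_coeff_sq (hu.memLp hI) i)
      (h.integrable_coeff_sq (hu.memLp_s hI) i)
  change HasSum (fun i => ∫ s in I, (μ i * d i s) ^ 2) _ at s1
  simp only [e1] at s1
  simp only [e2] at s2
  simp only [e3, hmode] at s3
  set b : ι → ℝ := fun i => if P (μ i) then |μ i| ^ 3 * c i 0 ^ 2 else 0 with hb
  have hσ : σ = 1 ∨ σ = -1 := by
    rcases hI with ⟨-, h⟩ | ⟨-, h⟩ <;> simp [h]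
  have hbσ : ∀ i, σ * μ i ^ 3 * c i 0 ^ 2 ≤ b i ∧ (b i = 0 ∨ b i = σ * μ i ^ 3 * c i 0 ^ 2) := by
    intro i
    by_cases hp : P (μ i)
    · have h1 : b i = σ * μ i ^ 3 * c i 0 ^ 2 := by
        simp only [hb, hp, if_true]
        have h2 := (hP _).1 hp
        rcases hσ with rfl | rfl
        · rw [abs_of_pos (by linarith)]; ring
        · rw [abs_of_neg (by linarith)]; ring
      exact ⟨h1.ge, Or.inr h1⟩
    · have h1 : b i = 0 := by simp [hb, hp]
      refine ⟨?_, Or.inl h1⟩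
      rw [h1]
      have h2 : σ * μ i ≤ 0 := not_lt.1 fun h3 => hp ((hP _).2 h3)
      have h4 : 0 ≤ μ i ^ 2 * c i 0 ^ 2 := by positivity
      nlinarith
  have hb0 : ∀ i, 0 ≤ b i := fun i => by
    simp only [hb]
    split_ifs <;> positivity
  have hd0 : ∀ i, 0 ≤ ∫ s in I, d i s ^ 2 := fun i => integral_nonneg fun _ => sq_nonneg _
  have hc0 : ∀ i, 0 ≤ ∫ s in I, c i s ^ 2 := fun i => integral_nonneg fun _ => sq_nonneg _
  have hr0 : ∀ i, 0 ≤ (∫ s in I, d i s ^ 2) + μ i ^ 2 * (∫ s in I, c i s ^ 2) -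
      σ * μ i * c i 0 ^ 2 := fun i => (hmode i) ▸ integral_nonneg fun _ => sq_nonneg _
  have s12 := s1.add s2
  have hbs : Summable b := by
    refine Summable.of_nonneg_of_le hb0 (fun i => ?_) s12.summable
    have h1 := mul_nonneg (sq_nonneg (μ i)) (hr0 i)
    have h2 := mul_nonneg (sq_nonneg (μ i)) (hd0 i)
    have h3 := mul_nonneg (sq_nonneg (μ i)) (mul_nonneg (sq_nonneg (μ i)) (hc0 i))
    rcases (hbσ i).2 with h4 | h4
    · rw [h4]; linarith
    · rw [h4]; linarith
  have hnorm : norm32P x μ P (fun t => u (0, t)) ^ 2 = ∑' i, b i :=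
    Real.sq_sqrt (tsum_nonneg hb0)
  rw [hnorm]
  refine hasSum_le (fun i => ?_) s12 (s3.add hbs.hasSum)
  linarith [(hbσ i).1]

end IsSpectralOperator

lemma W22On.normW22_sq [FiniteDimensional ℝ E] {I : Set ℝ} {σ : ℝ} {u : ℝ × ℝ → E}
    {Du : ℝ × ℝ → ℝ × ℝ →L[ℝ] E} {D2u : ℝ × ℝ → ℝ × ℝ →L[ℝ] ℝ × ℝ →L[ℝ] E}
    (hI : IsHalfLine I σ) (hu : W22On I u Du D2u) :
    normW22 I u Du D2u ^ 2 = (∫ p in Strip I, ‖u p‖ ^ 2) + (∫ p in Strip I, ‖Du p (1, 0)‖ ^ 2) +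
      (∫ p in Strip I, ‖Du p (0, 1)‖ ^ 2) + (∫ p in Strip I, ‖D2u p (1, 0) (1, 0)‖ ^ 2) +
      (∫ p in Strip I, ‖D2u p (1, 0) (0, 1)‖ ^ 2) +
      (∫ p in Strip I, ‖D2u p (0, 1) (0, 1)‖ ^ 2) := by
  have i0 := (hu.memLp hI).integrable_norm_sq
  have i1 := (hu.memLp_s hI).integrable_norm_sq
  have i2 := (hu.memLp_t hI).integrable_norm_sq
  have i3 := (hu.memLp_ss hI).integrable_norm_sq
  have i4 := (hu.memLp_st hI).integrable_norm_sq
  have i5 := (hu.memLp_tt hI).integrable_norm_sq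
  have j1 : Integrable (fun p => ‖u p‖ ^ 2 + ‖Du p (1, 0)‖ ^ 2) (volume.restrict (Strip I)) :=
    i0.add i1
  have j2 : Integrable (fun p => ‖u p‖ ^ 2 + ‖Du p (1, 0)‖ ^ 2 + ‖Du p (0, 1)‖ ^ 2)
    (volume.restrict (Strip I)) := j1.add i2
  have j3 : Integrable (fun p => ‖u p‖ ^ 2 + ‖Du p (1, 0)‖ ^ 2 + ‖Du p (0, 1)‖ ^ 2 +
    ‖D2u p (1, 0) (1, 0)‖ ^ 2) (volume.restrict (Strip I)) := j2.add i3
  have j4 : Integrable (fun p => ‖u p‖ ^ 2 + ‖Du p (1, 0)‖ ^ 2 + ‖Du p (0, 1)‖ ^ 2 +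
    ‖D2u p (1, 0) (1, 0)‖ ^ 2 + ‖D2u p (1, 0) (0, 1)‖ ^ 2) (volume.restrict (Strip I)) :=
    j3.add i4
  rw [normW22, Real.sq_sqrt (integral_nonneg fun _ => by positivity), ← integral_add i0 i1,
    ← integral_add j1 i2, ← integral_add j2 i3, ← integral_add j3 i4, ← integral_add j4 i5]

namespace IsSpectralOperator

variable {J : E →L[ℝ] E} {Λ : Submodule ℝ E} {S1 : ℝ → E →L[ℝ] E} {ι : Type*} {x : ι → ℝ → E}
  {μ : ι → ℝ}

/-- The `W^{2,2}`-estimate for the autonomous operator `∂_s + A` on a half strip. -/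
theorem exists_autonomous_estimate [FiniteDimensional ℝ E] (h : IsSpectralOperator J Λ S1 x μ) :
    ∃ C, 0 ≤ C ∧ ∀ (I : Set ℝ) (σ : ℝ) (P : ℝ → Prop) (u : ℝ × ℝ → E)
      (Du : ℝ × ℝ → ℝ × ℝ →L[ℝ] E) (D2u : ℝ × ℝ → ℝ × ℝ →L[ℝ] ℝ × ℝ →L[ℝ] E),
      IsHalfLine I σ → (∀ r, P r ↔ 0 < σ * r) → W22On I u Du D2u → LagBC Λ I u →
      LagBC2 Λ J S1 I u Du →
      normW22 I u Du D2u ^ 2 ≤ C *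
        ((∫ p in Strip I, ‖Du p (1, 0) + stripOp J S1 u (fun p => Du p (0, 1)) p‖ ^ 2) +
        (∫ p in Strip I, ‖D2u p (1, 0) (1, 0) +
          stripOp J S1 (fun p => Du p (1, 0)) (fun p => D2u p (1, 0) (0, 1)) p‖ ^ 2) +
        (∫ p in Strip I, ‖D2u p (1, 0) (0, 1) + stripOpDeriv J S1 u Du D2u p‖ ^ 2) +
        norm32P x μ P (fun t => u (0, t)) ^ 2) := by
  obtain ⟨C, hC0, hC⟩ := h.exists_strip_bound
  obtain ⟨B, hB0, hB⟩ := h.exists_bound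
  obtain ⟨B', hB0', hB'⟩ := exists_norm_le_of_continuous h.continuous_deriv_S1
  set K := C * C + C + C * C + 2 + C + (2 * C + 2 * (2 * B' ^ 2 * (C * C) + 2 * B ^ 2 * (C * C)))
    with hK
  have hK0 : 0 ≤ K := by positivity
  refine ⟨K * (2 + 2 * B ^ 2 + 1) + 2, by positivity,
    fun I σ P u Du D2u hI hP hu hbc hbc2 => ?_⟩
  have hm := hI.measurableSet
  have hstrip : ∀ᵐ p ∂volume.restrict (Strip I), p ∈ Strip I :=
    ae_restrict_mem (measurableSet_Strip hm)
  have hX := h.spectral_estimate hI hP hu hbc hbc2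
  have hsbc := hI.lagBC_deriv hu.hasFDerivWithinAt hbc
  obtain ⟨b1, b2⟩ := hC I (fun p => Du p (1, 0)) (fun p => D2u p (1, 0) (0, 1)) hm
    (fun s hs t ht => by
      rw [hu.symm hI (mk_mem_Strip hs ht)]
      exact hasDerivWithinAt_snd_of_strip (hu.hasFDerivWithinAt_apply (1, 0)) hs ht)
    (hu.memLp_s hI) (hu.memLp_st hI) hsbc
  have hVm := h.memLp_apply hm (hu.memLp hI) (hu.memLp_t hI)
  have hVtm := h.memLp_stripOpDeriv hI hu
  obtain ⟨b3, b4⟩ := hC I (stripOp J S1 u fun p => Du p (0, 1)) (stripOpDeriv J S1 u Du D2u) hm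
    (h.hasDerivWithinAt_stripOp hu) hVm hVtm hbc2
  obtain ⟨b5, b6⟩ := hC I u (fun p => Du p (0, 1)) hm
    (fun s hs t ht => hasDerivWithinAt_snd_of_strip hu.hasFDerivWithinAt hs ht)
    (hu.memLp hI) (hu.memLp_t hI) hbc
  have hA1m := h.memLp_apply hm (hu.memLp_s hI) (hu.memLp_st hI)
  have hηm := (hu.memLp_s hI).add hVm
  have hηtm := (hu.memLp_st hI).add hVtm
  have hηsm := (hu.memLp_ss hI).add hA1m
  have hS : ∀ p ∈ Strip I, ∀ v, ‖S1 p.2 v‖ ^ 2 ≤ B ^ 2 * ‖v‖ ^ 2 := fun p hp v => by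
    rw [← mul_pow]
    have := (S1 p.2).le_of_opNorm_le (hB _ hp.2) v
    gcongr
  have hS' : ∀ p ∈ Strip I, ∀ v, ‖deriv S1 p.2 v‖ ^ 2 ≤ B' ^ 2 * ‖v‖ ^ 2 := fun p hp v => by
    rw [← mul_pow]
    have := (deriv S1 p.2).le_of_opNorm_le (hB' _ hp.2) v
    gcongr
  have b7 : ∫ p in Strip I, ‖stripOp J S1
        (fun p => Du p (1, 0) + stripOp J S1 u (fun p => Du p (0, 1)) p)
        (fun p => D2u p (1, 0) (0, 1) + stripOpDeriv J S1 u Du D2u p) p‖ ^ 2 ≤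
      2 * (∫ p in Strip I, ‖D2u p (1, 0) (0, 1) + stripOpDeriv J S1 u Du D2u p‖ ^ 2) +
      2 * B ^ 2 * ∫ p in Strip I, ‖Du p (1, 0) + stripOp J S1 u (fun p => Du p (0, 1)) p‖ ^ 2 := by
    refine integral_norm_sq_le_of_le hηtm hηm (hstrip.mono fun p hp => ?_)
    refine (norm_add_sq_le_two _ _).trans ?_
    rw [h.norm_J]
    have := hS p hp (Du p (1, 0) + stripOp J S1 u (fun p => Du p (0, 1)) p)
    change _ ≤ 2 * ‖D2u p (1, 0) (0, 1) + stripOpDeriv J S1 u Du D2u p‖ ^ 2 + 2 * B ^ 2 *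
      ‖Du p (1, 0) + stripOp J S1 u (fun p => Du p (0, 1)) p‖ ^ 2
    linarith
  have b8 : ∫ p in Strip I, ‖D2u p (1, 0) (1, 0)‖ ^ 2 ≤
      2 * (∫ p in Strip I, ‖D2u p (1, 0) (1, 0) +
        stripOp J S1 (fun p => Du p (1, 0)) (fun p => D2u p (1, 0) (0, 1)) p‖ ^ 2) +
      2 * ∫ p in Strip I,
        ‖stripOp J S1 (fun p => Du p (1, 0)) (fun p => D2u p (1, 0) (0, 1)) p‖ ^ 2 := by
    refine integral_norm_sq_le_of_le hηsm hA1m (hstrip.mono fun p hp => ?_)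
    simpa [stripOp] using norm_sub_sq_le_two (D2u p (1, 0) (1, 0) +
        stripOp J S1 (fun p => Du p (1, 0)) (fun p => D2u p (1, 0) (0, 1)) p)
        (stripOp J S1 (fun p => Du p (1, 0)) (fun p => D2u p (1, 0) (0, 1)) p)
  have hWm : MemLp (fun p => stripOpDeriv J S1 u Du D2u p - J (D2u p (0, 1) (0, 1))) 2
      (volume.restrict (Strip I)) := hVtm.sub (J.comp_memLp' (hu.memLp_tt hI))
  have b9 : ∫ p in Strip I, ‖D2u p (0, 1) (0, 1)‖ ^ 2 ≤
      2 * (∫ p in Strip I, ‖stripOpDeriv J S1 u Du D2u p‖ ^ 2) +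
      2 * ∫ p in Strip I, ‖stripOpDeriv J S1 u Du D2u p - J (D2u p (0, 1) (0, 1))‖ ^ 2 := by
    refine integral_norm_sq_le_of_le hVtm hWm (hstrip.mono fun p hp => ?_)
    have h1 := norm_sub_sq_le_two (stripOpDeriv J S1 u Du D2u p)
      (stripOpDeriv J S1 u Du D2u p - J (D2u p (0, 1) (0, 1)))
    rwa [sub_sub_cancel, h.norm_J] at h1
  have b10 : ∫ p in Strip I, ‖stripOpDeriv J S1 u Du D2u p - J (D2u p (0, 1) (0, 1))‖ ^ 2 ≤
      2 * B' ^ 2 * (∫ p in Strip I, ‖u p‖ ^ 2) +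
      2 * B ^ 2 * ∫ p in Strip I, ‖Du p (0, 1)‖ ^ 2 := by
    refine integral_norm_sq_le_of_le (hu.memLp hI) (hu.memLp_t hI) (hstrip.mono fun p hp => ?_)
    rw [stripOpDeriv, add_sub_cancel_left]
    refine (norm_add_sq_le_two _ _).trans ?_
    linarith [hS p hp (Du p (0, 1)), hS' p hp (u p)]
  rw [hu.normW22_sq hI]
  have hn : ∀ f : ℝ × ℝ → E, 0 ≤ ∫ p in Strip I, ‖f p‖ ^ 2 := fun f =>
    integral_nonneg fun _ => sq_nonneg _
  change ∫ p in Strip I, ‖u p‖ ^ 2 ≤ C * ∫ p in Strip I,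
    ‖stripOp J S1 u (fun p => Du p (0, 1)) p‖ ^ 2 at b5
  change ∫ p in Strip I, ‖Du p (0, 1)‖ ^ 2 ≤ C * ∫ p in Strip I,
    ‖stripOp J S1 u (fun p => Du p (0, 1)) p‖ ^ 2 at b6
  change ∫ p in Strip I, ‖Du p (1, 0)‖ ^ 2 ≤ C * ∫ p in Strip I,
    ‖stripOp J S1 (fun p => Du p (1, 0)) (fun p => D2u p (1, 0) (0, 1)) p‖ ^ 2 at b1
  change ∫ p in Strip I, ‖D2u p (1, 0) (0, 1)‖ ^ 2 ≤ C * ∫ p in Strip I,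
    ‖stripOp J S1 (fun p => Du p (1, 0)) (fun p => D2u p (1, 0) (0, 1)) p‖ ^ 2 at b2
  change _ ≤ C * ∫ p in Strip I, ‖stripOp J S1 (stripOp J S1 u fun p => Du p (0, 1))
    (stripOpDeriv J S1 u Du D2u) p‖ ^ 2 at b3
  change _ ≤ C * ∫ p in Strip I, ‖stripOp J S1 (stripOp J S1 u fun p => Du p (0, 1))
    (stripOpDeriv J S1 u Du D2u) p‖ ^ 2 at b4
  have n1 := hn (stripOp J S1 (fun p => Du p (1, 0)) (fun p => D2u p (1, 0) (0, 1)))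
  have n2 := hn (stripOp J S1 (stripOp J S1 u fun p => Du p (0, 1)) (stripOpDeriv J S1 u Du D2u))
  have n3 := hn (fun p => Du p (1, 0) + stripOp J S1 u (fun p => Du p (0, 1)) p)
  have n4 := hn (fun p => D2u p (1, 0) (1, 0) +
        stripOp J S1 (fun p => Du p (1, 0)) (fun p => D2u p (1, 0) (0, 1)) p)
  have n5 := hn (fun p => D2u p (1, 0) (0, 1) + stripOpDeriv J S1 u Du D2u p)
  generalize (∫ p in Strip I,
    ‖stripOp J S1 (fun p => Du p (1, 0)) (fun p => D2u p (1, 0) (0, 1)) p‖ ^ 2) = a1 at *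
  generalize (∫ p in Strip I, ‖stripOp J S1 (stripOp J S1 u fun p => Du p (0, 1))
    (stripOpDeriv J S1 u Du D2u) p‖ ^ 2) = a2 at *
  generalize (∫ p in Strip I, ‖Du p (1, 0) + stripOp J S1 u (fun p => Du p (0, 1)) p‖ ^ 2) = e0 at *
  generalize (∫ p in Strip I, ‖D2u p (1, 0) (1, 0) +
        stripOp J S1 (fun p => Du p (1, 0)) (fun p => D2u p (1, 0) (0, 1)) p‖ ^ 2) = e1 at *
  generalize (∫ p in Strip I, ‖D2u p (1, 0) (0, 1) + stripOpDeriv J S1 u Du D2u p‖ ^ 2) = e2 at *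
  generalize (∫ p in Strip I, ‖stripOpDeriv J S1 u Du D2u p‖ ^ 2) = a3 at *
  generalize (∫ p in Strip I, ‖stripOp J S1 u (fun p => Du p (0, 1)) p‖ ^ 2) = a4 at *
  generalize (∫ p in Strip I, ‖stripOpDeriv J S1 u Du D2u p - J (D2u p (0, 1) (0, 1))‖ ^ 2) = a5
    at *
  have n6 : 0 ≤ norm32P x μ P (fun t => u (0, t)) ^ 2 := sq_nonneg _
  generalize norm32P x μ P (fun t => u (0, t)) ^ 2 = z at *
  set X := a1 + a2 with hXdef
  have c1 : C * a1 ≤ C * X := mul_le_mul_of_nonneg_left (by linarith) hC0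
  have c2 : C * a2 ≤ C * X := mul_le_mul_of_nonneg_left (by linarith) hC0
  have c3 : C * a4 ≤ C * C * X := by
    rw [mul_assoc]; exact mul_le_mul_of_nonneg_left (b3.trans c2) hC0
  have c4 := mul_le_mul_of_nonneg_left (b5.trans c3) (by positivity : 0 ≤ 2 * B' ^ 2)
  have c5 := mul_le_mul_of_nonneg_left (b6.trans c3) (by positivity : 0 ≤ 2 * B ^ 2)
  refine le_trans (b := K * X + 2 * e1) ?_ ?_
  · calc
      _ ≤ C * C * X + C * X + C * C * X + (2 * e1 + 2 * X) + C * X +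
          (2 * (C * X) + 2 * (2 * B' ^ 2 * (C * C * X) + 2 * B ^ 2 * (C * C * X))) := by
        linarith
      _ = K * X + 2 * e1 := by rw [hK]; ring
  have hXle : X ≤ (2 + 2 * B ^ 2 + 1) * (e0 + e1 + e2 + z) := by
    have q1 : 0 ≤ 2 * B ^ 2 * (e1 + e2 + z) := by positivity
    linarith
  have := mul_le_mul_of_nonneg_left hXle hK0
  linarith

end IsSpectralOperator

/-! ### The perturbation is small near infinity -/

lemma IsHalfLine.exists_filter {I : Set ℝ} {σ : ℝ} (hI : IsHalfLine I σ) :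
    ∃ l : Filter ℝ, l.NeBot ∧ I ∈ l ∧ Filter.Tendsto (fun s : ℝ => |s|) l Filter.atTop ∧
      ∀ S ∈ l, volume S = ⊤ := by
  rcases hI with ⟨rfl, -⟩ | ⟨rfl, -⟩
  · refine ⟨Filter.atTop, inferInstance, Filter.Ici_mem_atTop 0, Filter.tendsto_abs_atTop_atTop,
      fun S hS => ?_⟩
    obtain ⟨b, hb⟩ := Filter.mem_atTop_sets.1 hS
    rw [← top_le_iff, ← Real.volume_Ici (a := b)]
    exact measure_mono hb
  · refine ⟨Filter.atBot, inferInstance, Filter.Iic_mem_atBot 0, Filter.tendsto_abs_atBot_atTop,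
      fun S hS => ?_⟩
    obtain ⟨b, hb⟩ := Filter.mem_atBot_sets.1 hS
    rw [← top_le_iff, ← Real.volume_Iic (a := b)]
    exact measure_mono hb

/-- A square integrable function on a half strip can only converge to zero. -/
lemma IsHalfLine.eq_zero_of_integrable {F : Type*} [NormedAddCommGroup F] {I : Set ℝ} {σ : ℝ}
    (hI : IsHalfLine I σ) {R : ℝ × ℝ → F} {G : ℝ → F} (hG : ContinuousOn G (Icc 0 1))
    (hR : IntegrableOn (fun q => ‖R q‖ ^ 2) (Strip I))
    (hlim : ∀ ε : ℝ, 0 < ε → ∃ s₀ : ℝ, ∀ q ∈ Strip I, s₀ ≤ |q.1| → ‖R q - G q.2‖ ≤ ε) :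
    ∀ t ∈ Icc (0:ℝ) 1, G t = 0 := by
  obtain ⟨l, _, hIl, habs, hvol⟩ := hI.exists_filter
  rw [IntegrableOn, volume_restrict_Strip] at hR
  have hae : G =ᵐ[volume.restrict (Icc 0 1)] fun _ => 0 := by
    filter_upwards [hR.prod_left_ae, ae_restrict_mem measurableSet_Icc] with t ht ht01
    have hlim' : Filter.Tendsto (fun s => R (s, t)) l (nhds (G t)) := by
      rw [tendsto_iff_norm_sub_tendsto_zero, Metric.tendsto_nhds]
      intro ε hε
      obtain ⟨s₀, hs₀⟩ := hlim (ε / 2) (half_pos hε)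
      filter_upwards [hIl, habs.eventually_ge_atTop s₀] with s hs hss
      rw [dist_zero_right, norm_norm]
      exact (hs₀ (s, t) (mk_mem_Strip hs ht01) hss).trans_lt (half_lt_self hε)
    have h0 := IntegrableAtFilter.eq_zero_of_tendsto (l := l) (μ := volume) ⟨I, hIl, ht⟩ hvol
      (hlim'.norm.pow 2)
    simpa using h0
  exact Measure.eqOn_Icc_of_ae_eq volume zero_ne_one hae hG continuousOn_const

/-- If the coefficient `S₁ + R` converges in `C¹` and `R` is square integrable, then `R` tends to
zero in `C¹`. -/
lemma IsHalfLine.perturbation_tendsto_zero {F : Type*} [NormedAddCommGroup F] [NormedSpace ℝ F]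
    {I : Set ℝ} {σ : ℝ} (hI : IsHalfLine I σ) {R : ℝ × ℝ → F} {DR : ℝ × ℝ → ℝ × ℝ →L[ℝ] F}
    {S1 Sinf : ℝ → F} (hS1 : Differentiable ℝ S1) (hSinf : Differentiable ℝ Sinf)
    (hR : IntegrableOn (fun q => ‖R q‖ ^ 2) (Strip I))
    (hlim : ∀ ε : ℝ, 0 < ε → ∃ s₀ : ℝ, ∀ q ∈ Strip I, s₀ ≤ |q.1| →
      ‖S1 q.2 + R q - Sinf q.2‖ ≤ ε ∧ ‖DR q (1, 0)‖ ≤ ε ∧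
      ‖deriv S1 q.2 + DR q (0, 1) - deriv Sinf q.2‖ ≤ ε) {ε : ℝ} (hε : 0 < ε) :
    ∃ T : ℝ, ∀ q ∈ Strip I, T ≤ |q.1| →
      ‖R q‖ ≤ ε ∧ ‖DR q (1, 0)‖ ≤ ε ∧ ‖DR q (0, 1)‖ ≤ ε := by
  have h0 := hI.eq_zero_of_integrable (G := fun t => Sinf t - S1 t)
    (hSinf.continuous.sub hS1.continuous).continuousOn hR fun δ hδ => by
      obtain ⟨s₀, hs₀⟩ := hlim δ hδ
      refine ⟨s₀, fun q hq hqs => ?_⟩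
      convert (hs₀ q hq hqs).1 using 2
      abel
  have heq : EqOn Sinf S1 (Icc 0 1) := fun t ht => sub_eq_zero.1 (h0 t ht)
  have hderiv : ∀ t ∈ Icc (0:ℝ) 1, deriv Sinf t = deriv S1 t := fun t ht =>
    UniqueDiffWithinAt.eq_deriv (Icc (0:ℝ) 1) (uniqueDiffOn_Icc zero_lt_one t ht)
      ((hSinf t).hasDerivAt.hasDerivWithinAt.congr heq.symm (heq ht).symm)
      (hS1 t).hasDerivAt.hasDerivWithinAt
  obtain ⟨T, hT⟩ := hlim ε hε
  refine ⟨T, fun q hq hqT => ?_⟩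
  obtain ⟨h1, h2, h3⟩ := hT q hq hqT
  rw [heq hq.2, add_sub_cancel_left] at h1
  rw [hderiv _ hq.2, add_sub_cancel_left] at h3
  exact ⟨h1, h2, h3⟩

/-! ### Trace and interpolation inequalities on a rectangle -/

section Rectangle

variable [FiniteDimensional ℝ E] {a b : ℝ} {v vs vt vss vtt : ℝ × ℝ → E}

lemma setIntegral_strip {I : Set ℝ} {f : ℝ × ℝ → ℝ} (hf : IntegrableOn f (Strip I)) :
    ∫ p in Strip I, f p = ∫ s in I, ∫ t in Icc (0:ℝ) 1, f (s, t) := by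
  rw [IntegrableOn, volume_restrict_Strip] at hf
  rw [volume_restrict_Strip, integral_prod _ hf]

lemma setIntegral_strip_symm {I : Set ℝ} {f : ℝ × ℝ → ℝ} (hf : IntegrableOn f (Strip I)) :
    ∫ p in Strip I, f p = ∫ t in Icc (0:ℝ) 1, ∫ s in I, f (s, t) := by
  rw [IntegrableOn, volume_restrict_Strip] at hf
  rw [volume_restrict_Strip, integral_prod_symm _ hf]

lemma integral_norm_sq_trace_fst_le (hab : 1 ≤ b - a)
    (hd : ∀ s ∈ Icc a b, ∀ t ∈ Icc (0:ℝ) 1,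
      HasDerivWithinAt (fun s => v (s, t)) (vs (s, t)) (Icc a b) s)
    (hv : MemLp v 2 (volume.restrict (Strip (Icc a b))))
    (hvs : MemLp vs 2 (volume.restrict (Strip (Icc a b)))) {s : ℝ} (hs : s ∈ Icc a b) :
    ∫ t in Icc (0:ℝ) 1, ‖v (s, t)‖ ^ 2 ≤ 2 * (b - a) *
      ((∫ p in Strip (Icc a b), ‖v p‖ ^ 2) + ∫ p in Strip (Icc a b), ‖vs p‖ ^ 2) := by
  have hi : IntegrableOn (fun p => ‖v p‖ ^ 2 + ‖vs p‖ ^ 2) (Strip (Icc a b)) :=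
    hv.integrable_norm_sq.add hvs.integrable_norm_sq
  have hi2 : IntegrableOn (fun p => ‖vs p‖ ^ 2) (Strip (Icc a b)) := hvs.integrable_norm_sq
  rw [← integral_add hv.integrable_norm_sq hvs.integrable_norm_sq, setIntegral_strip_symm hi,
    ← integral_const_mul]
  rw [IntegrableOn, volume_restrict_Strip] at hi hi2
  refine integral_mono_of_nonneg (Filter.Eventually.of_forall fun t => by positivity)
    (hi.integral_prod_right.const_mul _) ?_
  filter_upwards [hi2.prod_left_ae, ae_restrict_mem measurableSet_Icc] with t ht ht01
  exact norm_sq_le_of_hasDerivWithinAt hab (fun r hr => hd r hr t ht01) ht hs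

lemma integral_norm_sq_trace_snd_le
    (hd : ∀ s ∈ Icc a b, ∀ t ∈ Icc (0:ℝ) 1,
      HasDerivWithinAt (fun t => v (s, t)) (vt (s, t)) (Icc 0 1) t)
    (hv : MemLp v 2 (volume.restrict (Strip (Icc a b))))
    (hvt : MemLp vt 2 (volume.restrict (Strip (Icc a b)))) {t : ℝ} (ht : t ∈ Icc (0:ℝ) 1) :
    ∫ s in Icc a b, ‖v (s, t)‖ ^ 2 ≤
      2 * ((∫ p in Strip (Icc a b), ‖v p‖ ^ 2) + ∫ p in Strip (Icc a b), ‖vt p‖ ^ 2) := by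
  have hi : IntegrableOn (fun p => ‖v p‖ ^ 2 + ‖vt p‖ ^ 2) (Strip (Icc a b)) :=
    hv.integrable_norm_sq.add hvt.integrable_norm_sq
  have hi2 : IntegrableOn (fun p => ‖vt p‖ ^ 2) (Strip (Icc a b)) := hvt.integrable_norm_sq
  rw [← integral_add hv.integrable_norm_sq hvt.integrable_norm_sq, setIntegral_strip hi,
    ← integral_const_mul]
  rw [IntegrableOn, volume_restrict_Strip] at hi hi2
  refine integral_mono_of_nonneg (Filter.Eventually.of_forall fun s => by positivity)
    (hi.integral_prod_left.const_mul _) ?_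
  filter_upwards [hi2.prod_right_ae, ae_restrict_mem measurableSet_Icc] with s hs hsI
  simpa using norm_sq_le_of_hasDerivWithinAt (a := 0) (b := 1) (by norm_num)
    (fun r hr => hd s hsI r hr) hs ht

lemma integral_norm_sq_deriv_fst_le {h C : ℝ} (hh : 0 < h) (hab : 2 * h ≤ b - a)
    (hd : ∀ s ∈ Icc a b, ∀ t ∈ Icc (0:ℝ) 1,
      HasDerivWithinAt (fun s => v (s, t)) (vs (s, t)) (Icc a b) s)
    (hd2 : ∀ s ∈ Icc a b, ∀ t ∈ Icc (0:ℝ) 1,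
      HasDerivWithinAt (fun s => vs (s, t)) (vss (s, t)) (Icc a b) s)
    (hvss : MemLp vss 2 (volume.restrict (Strip (Icc a b))))
    (hC : ∀ p ∈ Strip (Icc a b), ‖v p‖ ≤ C) :
    ∫ p in Strip (Icc a b), ‖vs p‖ ^ 2 ≤ (b - a) *
      (8 * C ^ 2 / h ^ 2 + 2 * h * ∫ p in Strip (Icc a b), ‖vss p‖ ^ 2) := by
  have hab' : a ≤ b := by linarith
  have hi : IntegrableOn (fun p => ‖vss p‖ ^ 2) (Strip (Icc a b)) := hvss.integrable_norm_sq
  rw [setIntegral_strip_symm hi]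
  rw [IntegrableOn, volume_restrict_Strip] at hi
  rw [volume_restrict_Strip]
  have hg : Integrable (fun p : ℝ × ℝ =>
      8 * C ^ 2 / h ^ 2 + 2 * h * ∫ s in Icc a b, ‖vss (s, p.2)‖ ^ 2)
      ((volume.restrict (Icc a b)).prod unitMeasure) :=
    (integrable_const _).add ((hi.integral_prod_right.comp_snd _).const_mul _)
  calc _ ≤ ∫ p, (8 * C ^ 2 / h ^ 2 + 2 * h * ∫ s in Icc a b, ‖vss (s, p.2)‖ ^ 2)
        ∂((volume.restrict (Icc a b)).prod unitMeasure) := by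
        refine integral_mono_of_nonneg (Filter.Eventually.of_forall fun t => by positivity) hg ?_
        have h1 := (Measure.quasiMeasurePreserving_snd
          (μ := volume.restrict (Icc a b)) (ν := unitMeasure)).ae hi.prod_left_ae
        have h2 : ∀ᵐ p ∂((volume.restrict (Icc a b)).prod unitMeasure), p ∈ Strip (Icc a b) := by
          rw [← volume_restrict_Strip]
          exact ae_restrict_mem (measurableSet_Strip measurableSet_Icc)
        filter_upwards [h1, h2] with p hp1 hp2
        exact norm_deriv_sq_le_of_hasDerivWithinAt hh hab (fun r hr => hd r hr p.2 hp2.2)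
          (fun r hr => hd2 r hr p.2 hp2.2) hp1 (fun r hr => hC _ (mk_mem_Strip hr hp2.2)) hp2.1
    _ = _ := by
        rw [integral_prod _ hg]
        simp only [integral_const, smul_eq_mul, Measure.real, Measure.restrict_apply_univ,
          Real.volume_Icc]
        rw [ENNReal.toReal_ofReal (by linarith),
          integral_add (integrable_const _) (hi.integral_prod_right.const_mul _),
          integral_const_mul]
        simp

lemma integral_norm_sq_deriv_snd_le {h C : ℝ} (hh : 0 < h) (hh1 : 2 * h ≤ 1) (hab : a ≤ b)
    (hd : ∀ s ∈ Icc a b, ∀ t ∈ Icc (0:ℝ) 1,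
      HasDerivWithinAt (fun t => v (s, t)) (vt (s, t)) (Icc 0 1) t)
    (hd2 : ∀ s ∈ Icc a b, ∀ t ∈ Icc (0:ℝ) 1,
      HasDerivWithinAt (fun t => vt (s, t)) (vtt (s, t)) (Icc 0 1) t)
    (hvtt : MemLp vtt 2 (volume.restrict (Strip (Icc a b))))
    (hC : ∀ p ∈ Strip (Icc a b), ‖v p‖ ≤ C) :
    ∫ p in Strip (Icc a b), ‖vt p‖ ^ 2 ≤
      (b - a) * (8 * C ^ 2 / h ^ 2) + 2 * h * ∫ p in Strip (Icc a b), ‖vtt p‖ ^ 2 := by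
  have hi : IntegrableOn (fun p => ‖vtt p‖ ^ 2) (Strip (Icc a b)) := hvtt.integrable_norm_sq
  rw [setIntegral_strip hi]
  rw [IntegrableOn, volume_restrict_Strip] at hi
  rw [volume_restrict_Strip]
  have hg : Integrable (fun p : ℝ × ℝ =>
      8 * C ^ 2 / h ^ 2 + 2 * h * ∫ t in Icc (0:ℝ) 1, ‖vtt (p.1, t)‖ ^ 2)
      ((volume.restrict (Icc a b)).prod unitMeasure) :=
    (integrable_const _).add ((hi.integral_prod_left.comp_fst _).const_mul _)
  calc _ ≤ ∫ p, (8 * C ^ 2 / h ^ 2 + 2 * h * ∫ t in Icc (0:ℝ) 1, ‖vtt (p.1, t)‖ ^ 2)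
        ∂((volume.restrict (Icc a b)).prod unitMeasure) := by
        refine integral_mono_of_nonneg (Filter.Eventually.of_forall fun t => by positivity) hg ?_
        have h1 := (Measure.quasiMeasurePreserving_fst
          (μ := volume.restrict (Icc a b)) (ν := unitMeasure)).ae hi.prod_right_ae
        have h2 : ∀ᵐ p ∂((volume.restrict (Icc a b)).prod unitMeasure), p ∈ Strip (Icc a b) := by
          rw [← volume_restrict_Strip]
          exact ae_restrict_mem (measurableSet_Strip measurableSet_Icc)
        filter_upwards [h1, h2] with p hp1 hp2
        exact norm_deriv_sq_le_of_hasDerivWithinAt hh (by linarith)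
          (fun r hr => hd p.1 hp2.1 r hr) (fun r hr => hd2 p.1 hp2.1 r hr) hp1
          (fun r hr => hC _ (mk_mem_Strip hp2.1 hr)) hp2.2
    _ = _ := by
        rw [integral_prod _ hg]
        simp only [integral_const, smul_eq_mul, Measure.real, Measure.restrict_apply_univ,
          Real.volume_Icc]
        rw [integral_const_mul, integral_add (integrable_const _)
          (hi.integral_prod_left.const_mul _), integral_const_mul]
        simp [hab]

end Rectangle

/-! ### An Ehrling inequality with finitely many point evaluations -/

lemma Strip_mono {I I' : Set ℝ} (h : I' ⊆ I) : Strip I' ⊆ Strip I := prod_mono h Subset.rfl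

lemma integral_strip_mono {F : Type*} [NormedAddCommGroup F] {I I' : Set ℝ} (h : I' ⊆ I)
    {f : ℝ × ℝ → F} (hf : MemLp f 2 (volume.restrict (Strip I))) :
    ∫ p in Strip I', ‖f p‖ ^ 2 ≤ ∫ p in Strip I, ‖f p‖ ^ 2 :=
  setIntegral_mono_set hf.integrable_norm_sq
    (Filter.Eventually.of_forall fun _ => sq_nonneg _) (Strip_mono h).eventuallyLE

namespace W22On

variable {I : Set ℝ} {σ a b : ℝ} {u : ℝ × ℝ → E}
  {Du : ℝ × ℝ → ℝ × ℝ →L[ℝ] E} {D2u : ℝ × ℝ → ℝ × ℝ →L[ℝ] ℝ × ℝ →L[ℝ] E}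

lemma hasDerivWithinAt_fst (hu : W22On I u Du D2u) (hab : Icc a b ⊆ I) :
    ∀ s ∈ Icc a b, ∀ t ∈ Icc (0:ℝ) 1,
      HasDerivWithinAt (fun s => u (s, t)) (Du (s, t) (1, 0)) (Icc a b) s :=
  fun _ hs _ ht => (hasDerivWithinAt_fst_of_strip hu.hasFDerivWithinAt (hab hs) ht).mono hab

lemma hasDerivWithinAt_snd (hu : W22On I u Du D2u) (hab : Icc a b ⊆ I) :
    ∀ s ∈ Icc a b, ∀ t ∈ Icc (0:ℝ) 1,
      HasDerivWithinAt (fun t => u (s, t)) (Du (s, t) (0, 1)) (Icc 0 1) t :=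
  fun _ hs _ ht => hasDerivWithinAt_snd_of_strip hu.hasFDerivWithinAt (hab hs) ht

lemma hasDerivWithinAt_fst_apply (hu : W22On I u Du D2u) (hab : Icc a b ⊆ I) (w : ℝ × ℝ) :
    ∀ s ∈ Icc a b, ∀ t ∈ Icc (0:ℝ) 1,
      HasDerivWithinAt (fun s => Du (s, t) w) (D2u (s, t) (1, 0) w) (Icc a b) s :=
  fun _ hs _ ht => (hasDerivWithinAt_fst_of_strip
    (hu.hasFDerivWithinAt_apply w) (hab hs) ht).mono hab

lemma hasDerivWithinAt_snd_apply (hu : W22On I u Du D2u) (hab : Icc a b ⊆ I) (w : ℝ × ℝ) :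
    ∀ s ∈ Icc a b, ∀ t ∈ Icc (0:ℝ) 1,
      HasDerivWithinAt (fun t => Du (s, t) w) (D2u (s, t) (0, 1) w) (Icc 0 1) t :=
  fun _ hs _ ht => hasDerivWithinAt_snd_of_strip (hu.hasFDerivWithinAt_apply w) (hab hs) ht

lemma integrableOn_trace_t (hu : W22On I u Du D2u) (hab : Icc a b ⊆ I) {s : ℝ}
    (hs : s ∈ Icc a b) : IntegrableOn (fun t => ‖Du (s, t) (0, 1)‖ ^ 2) (Icc 0 1) :=
  integrableOn_norm_sq_of_hasDerivWithinAt (hu.hasDerivWithinAt_snd_apply hab (0, 1) s hs)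

variable [FiniteDimensional ℝ E]

lemma integral_rect_le (hI : IsHalfLine I σ) (hu : W22On I u Du D2u) (hab : Icc a b ⊆ I) :
    (∫ p in Strip (Icc a b), ‖u p‖ ^ 2) + (∫ p in Strip (Icc a b), ‖Du p (1, 0)‖ ^ 2) +
      (∫ p in Strip (Icc a b), ‖Du p (0, 1)‖ ^ 2) +
      (∫ p in Strip (Icc a b), ‖D2u p (1, 0) (1, 0)‖ ^ 2) +
      (∫ p in Strip (Icc a b), ‖D2u p (1, 0) (0, 1)‖ ^ 2) +
      (∫ p in Strip (Icc a b), ‖D2u p (0, 1) (0, 1)‖ ^ 2) ≤ normW22 I u Du D2u ^ 2 := by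
  rw [hu.normW22_sq hI]
  gcongr ?_ + ?_ + ?_ + ?_ + ?_ + ?_
  exacts [integral_strip_mono hab (hu.memLp hI), integral_strip_mono hab (hu.memLp_s hI),
    integral_strip_mono hab (hu.memLp_t hI), integral_strip_mono hab (hu.memLp_ss hI),
    integral_strip_mono hab (hu.memLp_st hI), integral_strip_mono hab (hu.memLp_tt hI)]

lemma integral_trace_t_le (hI : IsHalfLine I σ) (hu : W22On I u Du D2u) (hab : Icc a b ⊆ I)
    (hL : 1 ≤ b - a) {s : ℝ} (hs : s ∈ Icc a b) :
    (∫ t in Icc (0:ℝ) 1, ‖u (s, t)‖ ^ 2) + (∫ t in Icc (0:ℝ) 1, ‖Du (s, t) (0, 1)‖ ^ 2) ≤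
      2 * (b - a) * normW22 I u Du D2u ^ 2 := by
  have hr := Measure.restrict_mono_set volume (Strip_mono hab)
  have h1 := integral_norm_sq_trace_fst_le hL (vs := fun p => Du p (1, 0))
    (hu.hasDerivWithinAt_fst hab) ((hu.memLp hI).mono_measure hr)
    ((hu.memLp_s hI).mono_measure hr) hs
  have h2 := integral_norm_sq_trace_fst_le hL (v := fun p => Du p (0, 1))
    (vs := fun p => D2u p (1, 0) (0, 1)) (hu.hasDerivWithinAt_fst_apply hab (0, 1))
    ((hu.memLp_t hI).mono_measure hr) ((hu.memLp_st hI).mono_measure hr) hs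
  refine (add_le_add h1 h2).trans ?_
  rw [← mul_add]
  have h3 := hu.integral_rect_le hI hab
  have n1 : 0 ≤ ∫ p in Strip (Icc a b), ‖D2u p (1, 0) (1, 0)‖ ^ 2 := by positivity
  have n2 : 0 ≤ ∫ p in Strip (Icc a b), ‖D2u p (0, 1) (0, 1)‖ ^ 2 := by positivity
  gcongr
  linarith

lemma integral_trace_s_le (hI : IsHalfLine I σ) (hu : W22On I u Du D2u) (hab : Icc a b ⊆ I)
    {t : ℝ} (ht : t ∈ Icc (0:ℝ) 1) :
    ∫ s in Icc a b, ‖Du (s, t) (1, 0)‖ ^ 2 ≤ 2 * normW22 I u Du D2u ^ 2 := by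
  have hr := Measure.restrict_mono_set volume (Strip_mono hab)
  have h1 := integral_norm_sq_trace_snd_le (v := fun p => Du p (1, 0))
    (vt := fun p => D2u p (1, 0) (0, 1)) (fun s hs t ht => by
      rw [hu.symm hI (mk_mem_Strip (hab hs) ht)]
      exact hu.hasDerivWithinAt_snd_apply hab (1, 0) s hs t ht)
    ((hu.memLp_s hI).mono_measure hr) ((hu.memLp_st hI).mono_measure hr) ht
  refine h1.trans ?_
  have h3 := hu.integral_rect_le hI hab
  have n1 : 0 ≤ ∫ p in Strip (Icc a b), ‖D2u p (1, 0) (1, 0)‖ ^ 2 := by positivity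
  have n2 : 0 ≤ ∫ p in Strip (Icc a b), ‖D2u p (0, 1) (0, 1)‖ ^ 2 := by positivity
  have n3 : 0 ≤ ∫ p in Strip (Icc a b), ‖u p‖ ^ 2 := by positivity
  have n4 : 0 ≤ ∫ p in Strip (Icc a b), ‖Du p (0, 1)‖ ^ 2 := by positivity
  linarith

lemma norm_sq_le (hI : IsHalfLine I σ) (hu : W22On I u Du D2u) (hab : Icc a b ⊆ I)
    (hL : 1 ≤ b - a) {p : ℝ × ℝ} (hp : p ∈ Strip (Icc a b)) :
    ‖u p‖ ^ 2 ≤ 4 * (b - a) * normW22 I u Du D2u ^ 2 := by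
  obtain ⟨s, t⟩ := p
  obtain ⟨hs, ht⟩ : s ∈ Icc a b ∧ t ∈ Icc (0:ℝ) 1 := hp
  have hd := hu.hasDerivWithinAt_snd hab s hs
  have h1 := norm_sq_le_of_hasDerivWithinAt (by norm_num) hd (hu.integrableOn_trace_t hab hs) ht
  rw [integral_add (integrableOn_norm_sq_of_hasDerivWithinAt hd)
    (hu.integrableOn_trace_t hab hs)] at h1
  linarith [hu.integral_trace_t_le hI hab hL hs]

lemma norm_sub_sq_le (hI : IsHalfLine I σ) (hu : W22On I u Du D2u) (hab : Icc a b ⊆ I)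
    (hL : 1 ≤ b - a) {p q : ℝ × ℝ} (hp : p ∈ Strip (Icc a b)) (hq : q ∈ Strip (Icc a b)) :
    ‖u p - u q‖ ^ 2 ≤ 4 * (1 + (b - a)) * dist p q * normW22 I u Du D2u ^ 2 := by
  obtain ⟨s, t⟩ := p
  obtain ⟨s', t'⟩ := q
  obtain ⟨hs, ht⟩ : s ∈ Icc a b ∧ t ∈ Icc (0:ℝ) 1 := hp
  obtain ⟨hs', ht'⟩ : s' ∈ Icc a b ∧ t' ∈ Icc (0:ℝ) 1 := hq
  set M := normW22 I u Du D2u ^ 2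
  set r := dist (s, t) (s', t')
  have hM : 0 ≤ M := sq_nonneg _
  have hL0 : 0 ≤ b - a := by linarith
  have hr1 : |s - s'| ≤ r := by
    rw [← Real.dist_eq]; exact le_max_left _ _
  have hr2 : |t - t'| ≤ r := by
    rw [← Real.dist_eq]; exact le_max_right _ _
  have h1 := norm_sub_sq_le_of_hasDerivWithinAt
    (fun r hr => hu.hasDerivWithinAt_fst hab r hr t ht)
    (integrableOn_norm_sq_of_hasDerivWithinAt
      fun r hr => hu.hasDerivWithinAt_fst_apply hab (1, 0) r hr t ht) hs' hs
  have h2 := norm_sub_sq_le_of_hasDerivWithinAt (hu.hasDerivWithinAt_snd hab s' hs')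
    (hu.integrableOn_trace_t hab hs') ht' ht
  have n1 : 0 ≤ ∫ t in Icc (0:ℝ) 1, ‖u (s', t)‖ ^ 2 := by positivity
  have h3 : |s - s'| * ∫ s in Icc a b, ‖Du (s, t) (1, 0)‖ ^ 2 ≤ r * (2 * M) :=
    mul_le_mul hr1 (hu.integral_trace_s_le hI hab ht) (by positivity) dist_nonneg
  have h4 : |t - t'| * ∫ t in Icc (0:ℝ) 1, ‖Du (s', t) (0, 1)‖ ^ 2 ≤ r * (2 * (b - a) * M) :=
    mul_le_mul hr2 (by linarith [hu.integral_trace_t_le hI hab hL hs']) (by positivity)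
      dist_nonneg
  have h5 := norm_add_sq_le_two (u (s, t) - u (s', t)) (u (s', t) - u (s', t'))
  rw [sub_add_sub_cancel] at h5
  linarith

lemma integral_norm_sq_s_le (hI : IsHalfLine I σ) (hu : W22On I u Du D2u) (hab : Icc a b ⊆ I)
    {h C : ℝ} (hh : 0 < h) (hL : 2 * h ≤ b - a) (hC : ∀ p ∈ Strip (Icc a b), ‖u p‖ ≤ C) :
    ∫ p in Strip (Icc a b), ‖Du p (1, 0)‖ ^ 2 ≤
      (b - a) * (8 * C ^ 2 / h ^ 2 + 2 * h * normW22 I u Du D2u ^ 2) := by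
  have hr := Measure.restrict_mono_set volume (Strip_mono hab)
  have h0 : 0 ≤ b - a := by linarith
  refine (integral_norm_sq_deriv_fst_le hh hL (hu.hasDerivWithinAt_fst hab)
    (hu.hasDerivWithinAt_fst_apply hab (1, 0)) ((hu.memLp_ss hI).mono_measure hr) hC).trans ?_
  have h3 := hu.integral_rect_le hI hab
  have n1 : 0 ≤ ∫ p in Strip (Icc a b), ‖Du p (1, 0)‖ ^ 2 := by positivity
  have n2 : 0 ≤ ∫ p in Strip (Icc a b), ‖D2u p (0, 1) (0, 1)‖ ^ 2 := by positivity
  have n3 : 0 ≤ ∫ p in Strip (Icc a b), ‖u p‖ ^ 2 := by positivity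
  have n4 : 0 ≤ ∫ p in Strip (Icc a b), ‖Du p (0, 1)‖ ^ 2 := by positivity
  have n5 : 0 ≤ ∫ p in Strip (Icc a b), ‖D2u p (1, 0) (0, 1)‖ ^ 2 := by positivity
  gcongr
  linarith

lemma integral_norm_sq_t_le (hI : IsHalfLine I σ) (hu : W22On I u Du D2u) (hab : Icc a b ⊆ I)
    {h C : ℝ} (hh : 0 < h) (hh1 : 2 * h ≤ 1) (hL : a ≤ b)
    (hC : ∀ p ∈ Strip (Icc a b), ‖u p‖ ≤ C) :
    ∫ p in Strip (Icc a b), ‖Du p (0, 1)‖ ^ 2 ≤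
      (b - a) * (8 * C ^ 2 / h ^ 2) + 2 * h * normW22 I u Du D2u ^ 2 := by
  have hr := Measure.restrict_mono_set volume (Strip_mono hab)
  refine (integral_norm_sq_deriv_snd_le hh hh1 hL (hu.hasDerivWithinAt_snd hab)
    (hu.hasDerivWithinAt_snd_apply hab (0, 1)) ((hu.memLp_tt hI).mono_measure hr) hC).trans ?_
  have h3 := hu.integral_rect_le hI hab
  have n1 : 0 ≤ ∫ p in Strip (Icc a b), ‖Du p (1, 0)‖ ^ 2 := by positivity
  have n2 : 0 ≤ ∫ p in Strip (Icc a b), ‖D2u p (1, 0) (1, 0)‖ ^ 2 := by positivity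
  have n3 : 0 ≤ ∫ p in Strip (Icc a b), ‖u p‖ ^ 2 := by positivity
  have n4 : 0 ≤ ∫ p in Strip (Icc a b), ‖Du p (0, 1)‖ ^ 2 := by positivity
  have n5 : 0 ≤ ∫ p in Strip (Icc a b), ‖D2u p (1, 0) (0, 1)‖ ^ 2 := by positivity
  gcongr
  linarith

end W22On

/-- Lower order terms on a rectangle are controlled by a small multiple of the `W^{2,2}`-norm and
finitely many point values. -/
theorem exists_ehrling [FiniteDimensional ℝ E] {a b ε : ℝ} (hL : 1 ≤ b - a) (hε : 0 < ε) :
    ∃ (G : Finset (ℝ × ℝ)) (C : ℝ), (G : Set (ℝ × ℝ)) ⊆ Strip (Icc a b) ∧ 0 ≤ C ∧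
      ∀ (I : Set ℝ) (σ : ℝ) (u : ℝ × ℝ → E) (Du : ℝ × ℝ → ℝ × ℝ →L[ℝ] E)
        (D2u : ℝ × ℝ → ℝ × ℝ →L[ℝ] ℝ × ℝ →L[ℝ] E),
        IsHalfLine I σ → Icc a b ⊆ I → W22On I u Du D2u →
        (∀ p ∈ Strip (Icc a b),
          ‖u p‖ ^ 2 ≤ ε * normW22 I u Du D2u ^ 2 + C * (∑ g ∈ G, ‖u g‖) ^ 2) ∧
        ∫ p in Strip (Icc a b), ‖Du p (1, 0)‖ ^ 2 ≤
          ε * normW22 I u Du D2u ^ 2 + C * (∑ g ∈ G, ‖u g‖) ^ 2 ∧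
        ∫ p in Strip (Icc a b), ‖Du p (0, 1)‖ ^ 2 ≤
          ε * normW22 I u Du D2u ^ 2 + C * (∑ g ∈ G, ‖u g‖) ^ 2 := by
  set L := b - a with hLdef
  have hL0 : 0 < L := by linarith
  set h := min (1 / 2) (ε / (4 * L)) with hhdef
  have hh : 0 < h := lt_min (by norm_num) (by positivity)
  have hh1 : 2 * h ≤ 1 := by linarith [min_le_left (1 / 2 : ℝ) (ε / (4 * L))]
  have hhL : L * (2 * h) ≤ ε / 2 := by
    have h1 : h * (4 * L) ≤ ε := (le_div_iff₀ (by positivity)).1 (min_le_right _ _)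
    linarith
  have hh2 : 2 * h ≤ ε / 2 := by
    refine le_trans ?_ hhL
    nlinarith
  set κ := L * (8 / h ^ 2) with hκ
  have hκ0 : 0 < κ := by positivity
  set δ := min ε (ε / (2 * κ)) with hδdef
  have hδ : 0 < δ := lt_min hε (by positivity)
  have hδκ : κ * δ ≤ ε / 2 := by
    have h1 : δ * (2 * κ) ≤ ε := (le_div_iff₀ (by positivity)).1 (min_le_right _ _)
    linarith
  set ρ := δ / (8 * (1 + L)) with hρdef
  have hρ : 0 < ρ := by positivity
  have hcpt : IsCompact (Strip (Icc a b)) := isCompact_Icc.prod isCompact_Icc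
  obtain ⟨G, hGQ, hGfin, hG⟩ := hcpt.finite_cover_balls hρ
  refine ⟨hGfin.toFinset, 2 + κ * 2, by simpa using hGQ, by positivity, ?_⟩
  intro I σ u Du D2u hI hab hu
  set M := normW22 I u Du D2u ^ 2 with hM
  have hM0 : 0 ≤ M := sq_nonneg _
  set N := ∑ g ∈ hGfin.toFinset, ‖u g‖ with hN
  have hsup : ∀ p ∈ Strip (Icc a b), ‖u p‖ ^ 2 ≤ δ * M + 2 * N ^ 2 := by
    intro p hp
    obtain ⟨g, hg, hpg⟩ := mem_iUnion₂.1 (hG hp)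
    have h1 := hu.norm_sub_sq_le hI hab hL hp (hGQ hg)
    have h2 := norm_add_sq_le_two (u p - u g) (u g)
    rw [sub_add_cancel] at h2
    have h3 : ‖u g‖ ≤ N :=
      Finset.single_le_sum (f := fun g => ‖u g‖) (fun _ _ => norm_nonneg _) (by simpa using hg)
    have h4 : 4 * (1 + L) * dist p g ≤ δ / 2 := by
      have h5 : dist p g * (8 * (1 + L)) ≤ δ :=
        (le_div_iff₀ (by positivity)).1 (Metric.mem_ball.1 hpg).le
      linarith
    have h6 := mul_le_mul_of_nonneg_right h4 hM0
    have h7 : ‖u g‖ ^ 2 ≤ N ^ 2 := by gcongr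
    linarith
  have hδε : δ * M ≤ ε * M := mul_le_mul_of_nonneg_right (min_le_left _ _) hM0
  have hC0 : 0 ≤ δ * M + 2 * N ^ 2 := by positivity
  have hC : ∀ p ∈ Strip (Icc a b), ‖u p‖ ≤ √(δ * M + 2 * N ^ 2) := fun p hp =>
    Real.le_sqrt_of_sq_le (hsup p hp)
  have hκN : 0 ≤ κ * (2 * N ^ 2) := by positivity
  have key : L * (8 * √(δ * M + 2 * N ^ 2) ^ 2 / h ^ 2) ≤ ε / 2 * M + κ * (2 * N ^ 2) := by
    rw [Real.sq_sqrt hC0]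
    have h1 := mul_le_mul_of_nonneg_right hδκ hM0
    calc L * (8 * (δ * M + 2 * N ^ 2) / h ^ 2) = κ * δ * M + κ * (2 * N ^ 2) := by
          rw [hκ]; ring
      _ ≤ _ := by linarith
  refine ⟨fun p hp => ?_, ?_, ?_⟩
  · linarith [hsup p hp]
  · have h1 := hu.integral_norm_sq_s_le hI hab hh (hh1.trans hL) hC
    have h2 := mul_le_mul_of_nonneg_right hhL hM0
    rw [mul_add] at h1
    linarith [sq_nonneg N]
  · have h1 := hu.integral_norm_sq_t_le hI hab hh hh1 (by linarith) hC
    have h2 := mul_le_mul_of_nonneg_right hh2 hM0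
    linarith [sq_nonneg N]

/-! ### The perturbation is relatively compact -/

lemma IsHalfLine.exists_interval {I : Set ℝ} {σ : ℝ} (hI : IsHalfLine I σ) (T : ℝ) :
    ∃ a b : ℝ, 1 ≤ b - a ∧ Icc a b ⊆ I ∧ ∀ s ∈ I, s ∉ Icc a b → T ≤ |s| := by
  have h1 := le_max_left T 1
  have h2 := le_max_right T 1
  rcases hI with ⟨rfl, -⟩ | ⟨rfl, -⟩
  · refine ⟨0, max T 1, by simp, Icc_subset_Ici_self, fun s hs hsn => ?_⟩
    have h3 : max T 1 < s := by
      by_contra! h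
      exact hsn ⟨hs, h⟩
    linarith [le_abs_self s]
  · refine ⟨-max T 1, 0, by simp, Icc_subset_Iic_self, fun s hs hsn => ?_⟩
    have h3 : s < -max T 1 := by
      by_contra! h
      exact hsn ⟨h, hs⟩
    linarith [neg_le_abs s]

section

variable {I : Set ℝ} {a b : ℝ} {f : ℝ × ℝ → E}
  {L : ℝ × ℝ → E →L[ℝ] E}

lemma MeasureTheory.AEStronglyMeasurable.clm_comp_apply {α F G : Type*} [MeasurableSpace α]
    {m : Measure α} [NormedAddCommGroup F] [NormedSpace ℝ F] [NormedAddCommGroup G]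
    [NormedSpace ℝ G] {L : α → F →L[ℝ] G} {f : α → F} (hL : AEStronglyMeasurable L m)
    (hf : AEStronglyMeasurable f m) : AEStronglyMeasurable (fun a => L a (f a)) m :=
  isBoundedBilinearMap_apply.continuous.comp_aestronglyMeasurable₂ hL hf

lemma memLp_and_integral_le_of_bounded {B ε : ℝ} (hm : MeasurableSet I) (hab : Icc a b ⊆ I)
    (hf : MemLp f 2 (volume.restrict (Strip I)))
    (hL : AEStronglyMeasurable L (volume.restrict (Strip I)))
    (hB : ∀ p ∈ Strip (Icc a b), ‖L p‖ ≤ B)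
    (hε : ∀ p ∈ Strip I, p ∉ Strip (Icc a b) → ‖L p‖ ≤ ε) :
    MemLp (fun p => L p (f p)) 2 (volume.restrict (Strip I)) ∧
      ∫ p in Strip I, ‖L p (f p)‖ ^ 2 ≤
        B ^ 2 * (∫ p in Strip (Icc a b), ‖f p‖ ^ 2) + ε ^ 2 * ∫ p in Strip I, ‖f p‖ ^ 2 := by
  have hQ : MeasurableSet (Strip (Icc a b)) := measurableSet_Strip measurableSet_Icc
  have hstrip : ∀ᵐ p ∂volume.restrict (Strip I), p ∈ Strip I :=
    ae_restrict_mem (measurableSet_Strip hm)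
  refine ⟨hf.clm_comp (B := max B ε) (hL.clm_comp_apply hf.1) (hstrip.mono fun p hp => ?_), ?_⟩
  · by_cases h : p ∈ Strip (Icc a b)
    · exact (hB p h).trans (le_max_left _ _)
    · exact (hε p hp h).trans (le_max_right _ _)
  have hind : ∫ p in Strip I, ‖(Strip (Icc a b)).indicator f p‖ ^ 2 =
      ∫ p in Strip (Icc a b), ‖f p‖ ^ 2 := by
    have h1 : (fun p => ‖(Strip (Icc a b)).indicator f p‖ ^ 2) =
        (Strip (Icc a b)).indicator fun p => ‖f p‖ ^ 2 := by
      ext p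
      by_cases h : p ∈ Strip (Icc a b) <;> simp [h]
    rw [h1, integral_indicator hQ, Measure.restrict_restrict hQ,
      inter_eq_self_of_subset_left (Strip_mono hab)]
  rw [← hind]
  refine integral_norm_sq_le_of_le (hf.indicator hQ) hf (hstrip.mono fun p hp => ?_)
  by_cases h : p ∈ Strip (Icc a b)
  · have h1 := (L p).le_of_opNorm_le (hB p h) (f p)
    have h2 : ‖L p (f p)‖ ^ 2 ≤ B ^ 2 * ‖f p‖ ^ 2 := by rw [← mul_pow]; gcongr
    rw [indicator_of_mem h]
    have : 0 ≤ ε ^ 2 * ‖f p‖ ^ 2 := by positivity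
    linarith
  · have h1 := (L p).le_of_opNorm_le (hε p hp h) (f p)
    rw [indicator_of_notMem h, norm_zero]
    have h2 : ‖L p (f p)‖ ^ 2 ≤ ε ^ 2 * ‖f p‖ ^ 2 := by rw [← mul_pow]; gcongr
    linarith

lemma memLp_and_integral_le_of_sup {K ε : ℝ} (hm : MeasurableSet I)
    (hf : MemLp f 2 (volume.restrict (Strip I)))
    (hL : MemLp L 2 (volume.restrict (Strip I)))
    (hK : ∀ p ∈ Strip (Icc a b), ‖f p‖ ≤ K)
    (hε : ∀ p ∈ Strip I, p ∉ Strip (Icc a b) → ‖L p‖ ≤ ε) :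
    MemLp (fun p => L p (f p)) 2 (volume.restrict (Strip I)) ∧
      ∫ p in Strip I, ‖L p (f p)‖ ^ 2 ≤
        K ^ 2 * (∫ p in Strip I, ‖L p‖ ^ 2) + ε ^ 2 * ∫ p in Strip I, ‖f p‖ ^ 2 := by
  have hstrip : ∀ᵐ p ∂volume.restrict (Strip I), p ∈ Strip I :=
    ae_restrict_mem (measurableSet_Strip hm)
  have hpt : ∀ p ∈ Strip I, ‖L p (f p)‖ ^ 2 ≤ K ^ 2 * ‖‖L p‖‖ ^ 2 + ε ^ 2 * ‖f p‖ ^ 2 := by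
    intro p hp
    rw [norm_norm]
    by_cases h : p ∈ Strip (Icc a b)
    · have h1 := (L p).le_opNorm_of_le (hK p h)
      have h2 : ‖L p (f p)‖ ^ 2 ≤ K ^ 2 * ‖L p‖ ^ 2 := by
        rw [← mul_pow, mul_comm K]; gcongr
      have : 0 ≤ ε ^ 2 * ‖f p‖ ^ 2 := by positivity
      linarith
    · have h1 := (L p).le_of_opNorm_le (hε p hp h) (f p)
      have h2 : ‖L p (f p)‖ ^ 2 ≤ ε ^ 2 * ‖f p‖ ^ 2 := by rw [← mul_pow]; gcongr
      have : 0 ≤ K ^ 2 * ‖L p‖ ^ 2 := by positivity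
      linarith
  have hmeas := hL.1.clm_comp_apply hf.1
  constructor
  · refine (memLp_two_iff_integrable_sq_norm hmeas).2 (Integrable.mono'
      ((hL.norm.integrable_norm_sq.const_mul (K ^ 2)).add (hf.integrable_norm_sq.const_mul (ε ^ 2)))
      (hmeas.norm.pow 2) (hstrip.mono fun p hp => ?_))
    rw [Real.norm_of_nonneg (sq_nonneg _)]
    exact hpt p hp
  · have := integral_norm_sq_le_of_le hL.norm hf (hstrip.mono hpt)
    simpa only [norm_norm] using this

/-- The terms coming from the perturbation `R` are bounded by a small multiple of the
`W^{2,2}`-norm and finitely many point values. -/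
theorem exists_perturbation_bound [FiniteDimensional ℝ E] {σ δ : ℝ} (hI : IsHalfLine I σ)
    {R : ℝ × ℝ → E →L[ℝ] E}
    {DR : ℝ × ℝ → ℝ × ℝ →L[ℝ] E →L[ℝ] E}
    (hR : ∀ q ∈ Strip I, HasFDerivWithinAt R (DR q) (Strip I) q)
    (hDRs : IntegrableOn (fun q => ‖DR q (1, 0)‖ ^ 2) (Strip I))
    (hDRt : IntegrableOn (fun q => ‖DR q (0, 1)‖ ^ 2) (Strip I))
    (hlim : ∀ ε : ℝ, 0 < ε → ∃ T : ℝ, ∀ q ∈ Strip I, T ≤ |q.1| →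
      ‖R q‖ ≤ ε ∧ ‖DR q (1, 0)‖ ≤ ε ∧ ‖DR q (0, 1)‖ ≤ ε) (hδ : 0 < δ) :
    ∃ (a b : ℝ) (G : Finset (ℝ × ℝ)) (C : ℝ), 1 ≤ b - a ∧ Icc a b ⊆ I ∧
      (G : Set (ℝ × ℝ)) ⊆ Strip (Icc a b) ∧ 0 ≤ C ∧
      ∀ (u : ℝ × ℝ → E) (Du : ℝ × ℝ → ℝ × ℝ →L[ℝ] E) (D2u : ℝ × ℝ → ℝ × ℝ →L[ℝ] ℝ × ℝ →L[ℝ] E),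
        W22On I u Du D2u →
        MemLp (fun p => R p (u p)) 2 (volume.restrict (Strip I)) ∧
        MemLp (fun p => DR p (1, 0) (u p) + R p (Du p (1, 0))) 2 (volume.restrict (Strip I)) ∧
        MemLp (fun p => DR p (0, 1) (u p) + R p (Du p (0, 1))) 2 (volume.restrict (Strip I)) ∧
        (∫ p in Strip I, ‖R p (u p)‖ ^ 2) +
          (∫ p in Strip I, ‖DR p (1, 0) (u p) + R p (Du p (1, 0))‖ ^ 2) +
          (∫ p in Strip I, ‖DR p (0, 1) (u p) + R p (Du p (0, 1))‖ ^ 2) ≤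
          δ * normW22 I u Du D2u ^ 2 + C * (∑ g ∈ G, ‖u g‖) ^ 2 := by
  have hm := hI.measurableSet
  set ε := √(δ / 18) with hεdef
  have hε : 0 < ε := Real.sqrt_pos.2 (by positivity)
  have hε2 : 9 * ε ^ 2 = δ / 2 := by
    rw [hεdef, Real.sq_sqrt (by positivity)]; ring
  obtain ⟨T, hT⟩ := hlim ε hε
  obtain ⟨a, b, hL, hab, hout⟩ := hI.exists_interval T
  have hsmall : ∀ p ∈ Strip I, p ∉ Strip (Icc a b) →
      ‖R p‖ ≤ ε ∧ ‖DR p (1, 0)‖ ≤ ε ∧ ‖DR p (0, 1)‖ ≤ ε := fun p hp hpn =>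
    hT p hp (hout p.1 hp.1 fun h => hpn ⟨h, hp.2⟩)
  have hcpt : IsCompact (Strip (Icc a b)) := isCompact_Icc.prod isCompact_Icc
  obtain ⟨B, hB⟩ := hcpt.exists_bound_of_continuousOn
    ((continuousOn_of_strip hR).mono (Strip_mono hab))
  have hRm := (continuousOn_of_strip hR).aestronglyMeasurable_strip hm
  have hsm := memLp_fderiv_of_strip hI.convex hm hR hDRs
  have htm := memLp_fderiv_of_strip hI.convex hm hR hDRt
  set As := ∫ p in Strip I, ‖DR p (1, 0)‖ ^ 2 with hAs
  set At := ∫ p in Strip I, ‖DR p (0, 1)‖ ^ 2 with hAt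
  have hAs0 : 0 ≤ As := by positivity
  have hAt0 : 0 ≤ At := by positivity
  have hL0 : 0 ≤ b - a := by linarith
  set A := B ^ 2 * (b - a) + 2 * As + 2 * At + 4 * B ^ 2 + 1 with hA
  have hA0 : 0 < A := by positivity
  obtain ⟨G, C, hGQ, hC0, hG⟩ := exists_ehrling (E := E) (ε := δ / (2 * A)) hL (by positivity)
  refine ⟨a, b, G, A * C, hL, hab, hGQ, by positivity, fun u Du D2u hu => ?_⟩
  obtain ⟨hsup, hs, ht⟩ := hG I σ u Du D2u hI hab hu
  set M := normW22 I u Du D2u ^ 2 with hM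
  set N := ∑ g ∈ G, ‖u g‖ with hN
  set X := δ / (2 * A) * M + C * N ^ 2 with hX
  have hM0 : 0 ≤ M := sq_nonneg _
  have hX0 : 0 ≤ X := by positivity
  have hK : ∀ p ∈ Strip (Icc a b), ‖u p‖ ≤ √X := fun p hp => Real.le_sqrt_of_sq_le (hsup p hp)
  have hu2 : ∫ p in Strip (Icc a b), ‖u p‖ ^ 2 ≤ (b - a) * X := by
    have hvol : volume.real (Strip (Icc a b)) = b - a := by
      rw [Measure.real, Strip, Measure.volume_eq_prod, Measure.prod_prod, Real.volume_Icc,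
        Real.volume_Icc]
      simp [hL0]
    calc _ ≤ ∫ p in Strip (Icc a b), X := by
          refine setIntegral_mono_on ?_ ?_ (measurableSet_Strip measurableSet_Icc) hsup
          · exact ((hu.memLp hI).mono_measure
              (Measure.restrict_mono_set volume (Strip_mono hab))).integrable_norm_sq
          · exact integrableOn_const hcpt.measure_lt_top.ne
      _ = (b - a) * X := by rw [setIntegral_const, hvol, smul_eq_mul]
  obtain ⟨m0, e0⟩ := memLp_and_integral_le_of_bounded hm hab (hu.memLp hI) hRm hB
    fun p hp hpn => (hsmall p hp hpn).1
  obtain ⟨m1, e1⟩ := memLp_and_integral_le_of_bounded hm hab (hu.memLp_s hI) hRm hB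
    fun p hp hpn => (hsmall p hp hpn).1
  obtain ⟨m2, e2⟩ := memLp_and_integral_le_of_bounded hm hab (hu.memLp_t hI) hRm hB
    fun p hp hpn => (hsmall p hp hpn).1
  obtain ⟨m3, e3⟩ := memLp_and_integral_le_of_sup hm (hu.memLp hI) hsm hK
    fun p hp hpn => (hsmall p hp hpn).2.1
  obtain ⟨m4, e4⟩ := memLp_and_integral_le_of_sup hm (hu.memLp hI) htm hK
    fun p hp hpn => (hsmall p hp hpn).2.2
  rw [Real.sq_sqrt hX0] at e3 e4
  refine ⟨m0, m3.add m1, m4.add m2, ?_⟩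
  have f1 := integral_norm_sq_le_of_le m3 m1
    (Filter.Eventually.of_forall fun p => norm_add_sq_le_two _ _)
  have f2 := integral_norm_sq_le_of_le m4 m2
    (Filter.Eventually.of_forall fun p => norm_add_sq_le_two _ _)
  have hMsum := hu.normW22_sq hI
  have n0 : 0 ≤ ∫ p in Strip I, ‖u p‖ ^ 2 := by positivity
  have n1 : 0 ≤ ∫ p in Strip I, ‖Du p (1, 0)‖ ^ 2 := by positivity
  have n2 : 0 ≤ ∫ p in Strip I, ‖Du p (0, 1)‖ ^ 2 := by positivity
  have n3 : 0 ≤ ∫ p in Strip I, ‖D2u p (1, 0) (1, 0)‖ ^ 2 := by positivity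
  have n4 : 0 ≤ ∫ p in Strip I, ‖D2u p (1, 0) (0, 1)‖ ^ 2 := by positivity
  have n5 : 0 ≤ ∫ p in Strip I, ‖D2u p (0, 1) (0, 1)‖ ^ 2 := by positivity
  have k0 : ε ^ 2 * ∫ p in Strip I, ‖u p‖ ^ 2 ≤ ε ^ 2 * M := by gcongr; linarith
  have k1 : ε ^ 2 * ∫ p in Strip I, ‖Du p (1, 0)‖ ^ 2 ≤ ε ^ 2 * M := by gcongr; linarith
  have k2 : ε ^ 2 * ∫ p in Strip I, ‖Du p (0, 1)‖ ^ 2 ≤ ε ^ 2 * M := by gcongr; linarith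
  have l0 := mul_le_mul_of_nonneg_left hu2 (sq_nonneg B)
  have l1 := mul_le_mul_of_nonneg_left hs (sq_nonneg B)
  have l2 := mul_le_mul_of_nonneg_left ht (sq_nonneg B)
  have hAX : A * X = δ / 2 * M + A * C * N ^ 2 := by
    rw [hX]; field_simp
  calc _ ≤ A * X + 9 * ε ^ 2 * M := by
        have : A * X = B ^ 2 * ((b - a) * X) + 2 * (X * As) + 2 * (X * At) +
            4 * (B ^ 2 * X) + X := by
          rw [hA]; ring
        linarith
    _ = _ := by rw [hAX, hε2]; ring

end

/-! ### The estimate on the half strip -/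

/-- Finitely many point evaluations of a bounded sequence converge along a subsequence. -/
lemma exists_subseq_sum_norm_sub_le {X F : Type*} [NormedAddCommGroup F] [NormedSpace ℝ F]
    [FiniteDimensional ℝ F] (G : Finset X) (w : ℕ → X → F) {r : ℝ}
    (hw : ∀ k, ∀ g ∈ G, ‖w k g‖ ≤ r) :
    ∃ φ : ℕ → ℕ, StrictMono φ ∧ ∀ ε : ℝ, 0 < ε → ∃ N₀ : ℕ, ∀ k l : ℕ, N₀ ≤ k → N₀ ≤ l →
      ∑ g ∈ G, ‖w (φ k) g - w (φ l) g‖ ≤ ε := by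
  have := FiniteDimensional.proper ℝ (G → F)
  obtain ⟨y, -, φ, hφ, hlim⟩ := tendsto_subseq_of_bounded
    (Metric.isBounded_closedBall (x := (0 : G → F)) (r := max r 0))
    (x := fun k (g : G) => w k g) fun k => by
      rw [mem_closedBall_zero_iff, pi_norm_le_iff_of_nonneg (le_max_right _ _)]
      exact fun g => (hw k g g.2).trans (le_max_left _ _)
  refine ⟨φ, hφ, fun ε hε => ?_⟩
  obtain ⟨N₀, hN₀⟩ := Metric.cauchySeq_iff.1 hlim.cauchySeq (ε / (G.card + 1)) (by positivity)
  refine ⟨N₀, fun k l hk hl => ?_⟩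
  have hd := (hN₀ k hk l hl).le
  rw [dist_eq_norm] at hd
  calc ∑ g ∈ G, ‖w (φ k) g - w (φ l) g‖ ≤ ∑ _g ∈ G, ε / (G.card + 1) := by
        refine Finset.sum_le_sum fun g hg => (le_trans ?_ hd)
        exact norm_le_pi_norm ((fun g : G => w (φ k) g) - fun g : G => w (φ l) g) ⟨g, hg⟩
    _ = G.card * (ε / (G.card + 1)) := by rw [Finset.sum_const, nsmul_eq_mul]
    _ ≤ (G.card + 1) * (ε / (G.card + 1)) := by gcongr; linarith
    _ = ε := by field_simp

section

variable [FiniteDimensional ℝ E] {J : E →L[ℝ] E} {Λ : Submodule ℝ E} {S1 : ℝ → E →L[ℝ] E}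
  {ι : Type*} {x : ι → ℝ → E} {μ : ι → ℝ} {I : Set ℝ} {σ : ℝ} {R : ℝ × ℝ → E →L[ℝ] E}
  {DR : ℝ × ℝ → ℝ × ℝ →L[ℝ] E →L[ℝ] E} {u : ℝ × ℝ → E} {Du : ℝ × ℝ → ℝ × ℝ →L[ℝ] E}
  {D2u : ℝ × ℝ → ℝ × ℝ →L[ℝ] ℝ × ℝ →L[ℝ] E}

/-- The autonomous part of `Dop` is bounded by `Dop` and the perturbation terms. -/
lemma IsSpectralOperator.integral_autonomous_le (h : IsSpectralOperator J Λ S1 x μ)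
    (hI : IsHalfLine I σ) (hu : W22On I u Du D2u)
    (h0 : MemLp (fun p => R p (u p)) 2 (volume.restrict (Strip I)))
    (h1 : MemLp (fun p => DR p (1, 0) (u p) + R p (Du p (1, 0))) 2 (volume.restrict (Strip I)))
    (h2 : MemLp (fun p => DR p (0, 1) (u p) + R p (Du p (0, 1))) 2 (volume.restrict (Strip I))) :
    (∫ p in Strip I, ‖Du p (1, 0) + stripOp J S1 u (fun p => Du p (0, 1)) p‖ ^ 2) +
        (∫ p in Strip I, ‖D2u p (1, 0) (1, 0) +
          stripOp J S1 (fun p => Du p (1, 0)) (fun p => D2u p (1, 0) (0, 1)) p‖ ^ 2) +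
        (∫ p in Strip I, ‖D2u p (1, 0) (0, 1) + stripOpDeriv J S1 u Du D2u p‖ ^ 2) ≤
      2 * (∫ q in Strip I,
        (‖Dop J (fun s t => S1 t + R (s, t)) u Du q‖ ^ 2
          + ‖DDop J S1 R DR u Du D2u q (1, 0)‖ ^ 2
          + ‖DDop J S1 R DR u Du D2u q (0, 1)‖ ^ 2)) +
      2 * ((∫ p in Strip I, ‖R p (u p)‖ ^ 2) +
          (∫ p in Strip I, ‖DR p (1, 0) (u p) + R p (Du p (1, 0))‖ ^ 2) +
          (∫ p in Strip I, ‖DR p (0, 1) (u p) + R p (Du p (0, 1))‖ ^ 2)) := by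
  have hm := hI.measurableSet
  have hstrip : ∀ᵐ p ∂volume.restrict (Strip I), p ∈ Strip I :=
    ae_restrict_mem (measurableSet_Strip hm)
  have d0 : ∀ p, Dop J (fun s t => S1 t + R (s, t)) u Du p =
      (Du p (1, 0) + stripOp J S1 u (fun p => Du p (0, 1)) p) + R p (u p) := fun p => by
    simp only [Dop, stripOp, add_apply]
    abel
  have d1 : ∀ p, DDop J S1 R DR u Du D2u p (1, 0) =
      (D2u p (1, 0) (1, 0) +
        stripOp J S1 (fun p => Du p (1, 0)) (fun p => D2u p (1, 0) (0, 1)) p) +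
      (DR p (1, 0) (u p) + R p (Du p (1, 0))) := fun p => by
    simp only [DDop, stripOp, add_apply, zero_smul, zero_add]
    abel
  have d2 : ∀ p ∈ Strip I, DDop J S1 R DR u Du D2u p (0, 1) =
      (D2u p (1, 0) (0, 1) + stripOpDeriv J S1 u Du D2u p) +
      (DR p (0, 1) (u p) + R p (Du p (0, 1))) := fun p hp => by
    simp only [DDop, stripOpDeriv, add_apply, one_smul, hu.symm hI hp (0, 1) (1, 0)]
    abel
  have hη := (hu.memLp_s hI).add (h.memLp_apply hm (hu.memLp hI) (hu.memLp_t hI))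
  have hηs := (hu.memLp_ss hI).add (h.memLp_apply hm (hu.memLp_s hI) (hu.memLp_st hI))
  have hηt := (hu.memLp_st hI).add (h.memLp_stripOpDeriv hI hu)
  have m0 : MemLp (Dop J (fun s t => S1 t + R (s, t)) u Du) 2 (volume.restrict (Strip I)) :=
    (hη.add h0).ae_eq (Filter.Eventually.of_forall fun p => (d0 p).symm)
  have m1 : MemLp (fun q => DDop J S1 R DR u Du D2u q (1, 0)) 2 (volume.restrict (Strip I)) :=
    (hηs.add h1).ae_eq (Filter.Eventually.of_forall fun p => (d1 p).symm)
  have m2 : MemLp (fun q => DDop J S1 R DR u Du D2u q (0, 1)) 2 (volume.restrict (Strip I)) :=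
    (hηt.add h2).ae_eq (hstrip.mono fun p hp => (d2 p hp).symm)
  have key : ∀ v w : E, ‖v‖ ^ 2 ≤ 2 * ‖v + w‖ ^ 2 + 2 * ‖w‖ ^ 2 := fun v w => by
    simpa using norm_sub_sq_le_two (v + w) w
  have i0 := integral_norm_sq_le_of_le m0 h0 (Filter.Eventually.of_forall fun p => by
    rw [d0]; exact key (Du p (1, 0) + stripOp J S1 u (fun p => Du p (0, 1)) p) _)
  have i1 := integral_norm_sq_le_of_le m1 h1 (Filter.Eventually.of_forall fun p => by
    rw [d1]; exact key (D2u p (1, 0) (1, 0) +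
        stripOp J S1 (fun p => Du p (1, 0)) (fun p => D2u p (1, 0) (0, 1)) p) _)
  have i2 := integral_norm_sq_le_of_le m2 h2 (hstrip.mono fun p hp => by
    rw [d2 p hp]; exact key (D2u p (1, 0) (0, 1) + stripOpDeriv J S1 u Du D2u p) _)
  have j : Integrable (fun q => ‖Dop J (fun s t => S1 t + R (s, t)) u Du q‖ ^ 2
      + ‖DDop J S1 R DR u Du D2u q (1, 0)‖ ^ 2) (volume.restrict (Strip I)) :=
    m0.integrable_norm_sq.add m1.integrable_norm_sq
  rw [integral_add j m2.integrable_norm_sq,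
    integral_add m0.integrable_norm_sq m1.integrable_norm_sq]
  linarith

end

/-- Let `D` be the time-dependent operator
`Dξ = ∂_sξ + J₀∂_tξ + S(s,t)ξ = ∂_sξ + Aξ + R(s,t)ξ` on the half strip `I = ℝ^±`
(`A = J₀∂_t + S₁(t)` satisfying (HA)), and assume hypothesis (H1): `S(s,·)` converges in
`C¹` as `s → ±∞` to a smooth limit `S^±` whose operator `A^± = J₀∂_t + S^±(t)` satisfies
(HA).  Then there exist `c > 0` and a compact operator `K : H²_bc → H¹_bc` (encoded by the
seminorm `N ξ = ‖Kξ‖_{W^{1,2}}`) such that every `ξ ∈ H²_bc(ℝ^±×[0,1])` satisfies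
`‖ξ‖_{W^{2,2}} ≤ c(‖Dξ‖_{W^{1,2}} + ‖Kξ‖_{W^{1,2}} + ‖π^±_A ξ(0,·)‖_{3/2})`. -/
theorem stmt_12
    {E : Type*} [NormedAddCommGroup E] [InnerProductSpace ℝ E] [FiniteDimensional ℝ E]
    (n : ℕ) (hdim : Module.finrank ℝ E = 2 * n)
    (J : E →L[ℝ] E) (hJiso : ∀ v : E, ‖J v‖ = ‖v‖) (hJ2 : ∀ v : E, J (J v) = -v)
    (Λ : Submodule ℝ E) (hΛdim : Module.finrank ℝ Λ = n)
    (hJΛ : ∀ v : E, v ∈ Λ ↔ J v ∈ Λᗮ)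
    (S1 : ℝ → E →L[ℝ] E) (hS1 : ContDiff ℝ (⊤ : ℕ∞) S1)
    (hS1sym : ∀ (t : ℝ) (v w : E), ⟪S1 t v, w⟫ = ⟪v, S1 t w⟫)
    {ι : Type*} (x : ι → ℝ → E) (μ : ι → ℝ)
    (hEig : EigenData J Λ S1 x μ)
    -- the half strip `ℝ⁺` (with the projection `π⁺_A`) or `ℝ⁻` (with `π⁻_A`)
    (I : Set ℝ) (P : ℝ → Prop)
    (hIP : (I = Ici (0:ℝ) ∧ P = fun r => 0 < r) ∨
           (I = Iic (0:ℝ) ∧ P = fun r => r < 0))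
    -- the perturbation `R ∈ W^{1,2}` defining `D = ∂_s + A + R`
    (R : ℝ × ℝ → E →L[ℝ] E) (DR : ℝ × ℝ → ℝ × ℝ →L[ℝ] E →L[ℝ] E)
    (hR : ∀ q ∈ Strip I, HasFDerivWithinAt R (DR q) (Strip I) q)
    (hR2 : IntegrableOn (fun q => ‖R q‖ ^ 2) (Strip I) volume)
    (hDR2s : IntegrableOn (fun q => ‖DR q (1, 0)‖ ^ 2) (Strip I) volume)
    (hDR2t : IntegrableOn (fun q => ‖DR q (0, 1)‖ ^ 2) (Strip I) volume)
    -- hypothesis (H1): the limit operator `A^± = J₀∂_t + S^±(t)` satisfies (HA) …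
    (Sinf : ℝ → E →L[ℝ] E) (hSinf : ContDiff ℝ (⊤ : ℕ∞) Sinf)
    (hSinfsym : ∀ (t : ℝ) (v w : E), ⟪Sinf t v, w⟫ = ⟪v, Sinf t w⟫)
    {ι' : Type*} (xinf : ι' → ℝ → E) (μinf : ι' → ℝ)
    (hEiginf : EigenData J Λ Sinf xinf μinf)
    -- … and `S(s,·) = S₁ + R(s,·) → S^±` in `C¹([s,∞)×[0,1])` as `s → ±∞`
    (hH1 : ∀ ε : ℝ, 0 < ε → ∃ s₀ : ℝ, ∀ q ∈ Strip I, s₀ ≤ |q.1| →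
      ‖S1 q.2 + R q - Sinf q.2‖ ≤ ε ∧ ‖DR q (1, 0)‖ ≤ ε ∧
      ‖deriv S1 q.2 + DR q (0, 1) - deriv Sinf q.2‖ ≤ ε) :
    ∃ (c : ℝ) (N : (ℝ × ℝ → E) → ℝ), 0 < c ∧
      -- `N ξ = ‖Kξ‖_{W^{1,2}}` for a linear operator `K` …
      (∀ u v : ℝ × ℝ → E, N (fun q => u q + v q) ≤ N u + N v) ∧
      (∀ (r : ℝ) (u : ℝ × ℝ → E), N (fun q => r • u q) = |r| * N u) ∧
      (∀ u : ℝ × ℝ → E, 0 ≤ N u) ∧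
      -- … which is compact from `H²_bc` to `H¹_bc` …
      (∀ (C : ℝ) (u : ℕ → ℝ × ℝ → E) (Du : ℕ → ℝ × ℝ → ℝ × ℝ →L[ℝ] E)
          (D2u : ℕ → ℝ × ℝ → ℝ × ℝ →L[ℝ] ℝ × ℝ →L[ℝ] E),
          (∀ k, W22On I (u k) (Du k) (D2u k)) →
          (∀ k, LagBC Λ I (u k)) →
          (∀ k, LagBC2 Λ J S1 I (u k) (Du k)) →
          (∀ k, normW22 I (u k) (Du k) (D2u k) ≤ C) →
          ∃ φ : ℕ → ℕ, StrictMono φ ∧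
            ∀ ε : ℝ, 0 < ε → ∃ N₀ : ℕ, ∀ k l : ℕ, N₀ ≤ k → N₀ ≤ l →
              N (fun q => u (φ k) q - u (φ l) q) ≤ ε) ∧
      -- … and the estimate holds for all `ξ ∈ H²_bc(ℝ^±×[0,1])`
      (∀ (ξ : ℝ × ℝ → E) (Dξ : ℝ × ℝ → ℝ × ℝ →L[ℝ] E)
          (D2ξ : ℝ × ℝ → ℝ × ℝ →L[ℝ] ℝ × ℝ →L[ℝ] E),
          W22On I ξ Dξ D2ξ → LagBC Λ I ξ →
          LagBC2 Λ J S1 I ξ Dξ →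
          normW22 I ξ Dξ D2ξ
            ≤ c * (Real.sqrt (∫ q in Strip I,
                    (‖Dop J (fun s t => S1 t + R (s, t)) ξ Dξ q‖ ^ 2
                      + ‖DDop J S1 R DR ξ Dξ D2ξ q (1, 0)‖ ^ 2
                      + ‖DDop J S1 R DR ξ Dξ D2ξ q (0, 1)‖ ^ 2))
                + N ξ
                + norm32P x μ P (fun t => ξ (0, t)))) := by
  have h : IsSpectralOperator J Λ S1 x μ := ⟨hJiso, hJ2, hJΛ, hS1, hS1sym, hEig⟩
  obtain ⟨σ, hI, hP⟩ : ∃ σ, IsHalfLine I σ ∧ ∀ r, P r ↔ 0 < σ * r := by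
    rcases hIP with ⟨rfl, rfl⟩ | ⟨rfl, rfl⟩
    · exact ⟨1, Or.inl ⟨rfl, rfl⟩, fun r => by simp⟩
    · exact ⟨-1, Or.inr ⟨rfl, rfl⟩, fun r => by simp⟩
  obtain ⟨C₀, hC₀, hauto⟩ := h.exists_autonomous_estimate
  obtain ⟨a, b, G, C₁, hL, hab, hG, hC₁, hpert⟩ := exists_perturbation_bound
    (δ := 1 / (4 * (C₀ + 1))) hI hR hDR2s hDR2t
    (fun ε hε => hI.perturbation_tendsto_zero (hS1.differentiable (by simp))
      (hSinf.differentiable (by simp)) hR2 hH1 hε) (by positivity)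
  set K := 4 * C₀ * (1 + C₁) + 1 with hK
  have hK0 : 0 < K := by positivity
  refine ⟨√K, fun u => ∑ g ∈ G, ‖u g‖, Real.sqrt_pos.2 hK0, fun u v => ?_, fun r u => ?_,
    fun u => by positivity, fun C u Du D2u hu _ _ hC => ?_, fun ξ Dξ D2ξ hξ hbc hbc2 => ?_⟩
  · rw [← Finset.sum_add_distrib]
    exact Finset.sum_le_sum fun g _ => norm_add_le _ _
  · simp only [norm_smul, Real.norm_eq_abs, Finset.mul_sum]
  · refine exists_subseq_sum_norm_sub_le G u (r := √(4 * (b - a) * C ^ 2)) fun k g hg => ?_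
    refine Real.le_sqrt_of_sq_le (((hu k).norm_sq_le hI hab hL (hG hg)).trans ?_)
    have h0 : 0 ≤ normW22 I (u k) (Du k) (D2u k) := Real.sqrt_nonneg _
    have h1 := hC k
    have h2 : 0 ≤ b - a := by linarith
    gcongr
  · obtain ⟨h0, h1, h2, hr⟩ := hpert ξ Dξ D2ξ hξ
    have hA := hauto I σ P ξ Dξ D2ξ hI hP hξ hbc hbc2
    have hB := h.integral_autonomous_le hI hξ h0 h1 h2
    set D := ∫ q in Strip I, (‖Dop J (fun s t => S1 t + R (s, t)) ξ Dξ q‖ ^ 2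
      + ‖DDop J S1 R DR ξ Dξ D2ξ q (1, 0)‖ ^ 2 + ‖DDop J S1 R DR ξ Dξ D2ξ q (0, 1)‖ ^ 2) with hD
    have hD0 : 0 ≤ D := integral_nonneg fun _ => by positivity
    set M := normW22 I ξ Dξ D2ξ
    set N := ∑ g ∈ G, ‖ξ g‖ with hN
    set z := norm32P x μ P fun t => ξ (0, t)
    have hN0 : 0 ≤ N := by positivity
    have hz0 : 0 ≤ z := Real.sqrt_nonneg _
    have hsmall : C₀ * (2 * (1 / (4 * (C₀ + 1)) * M ^ 2)) ≤ M ^ 2 / 2 := by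
      have : C₀ * (1 / (4 * (C₀ + 1))) ≤ 1 / 4 := by
        rw [mul_one_div, div_le_div_iff₀ (by positivity) (by norm_num)]
        linarith
      have := mul_le_mul_of_nonneg_right this (sq_nonneg M)
      linarith
    have hM : M ^ 2 ≤ C₀ * (2 * D + 2 * (1 / (4 * (C₀ + 1)) * M ^ 2 + C₁ * N ^ 2) + z ^ 2) := by
      refine hA.trans ?_
      exact mul_le_mul_of_nonneg_left (by linarith) hC₀
    have hM2 : M ^ 2 ≤ K * (D + N ^ 2 + z ^ 2) := by
      have q1 : 0 ≤ C₀ * C₁ * D := by positivity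
      have q2 : 0 ≤ C₀ * C₁ * z ^ 2 := by positivity
      have q3 : 0 ≤ C₀ * N ^ 2 := by positivity
      have q4 : 0 ≤ C₀ * z ^ 2 := by positivity
      have q5 : K * (D + N ^ 2 + z ^ 2) = 4 * (C₀ * D) + 4 * (C₀ * N ^ 2) + 4 * (C₀ * z ^ 2) +
          4 * (C₀ * C₁ * D) + 4 * (C₀ * C₁ * N ^ 2) + 4 * (C₀ * C₁ * z ^ 2) +
          (D + N ^ 2 + z ^ 2) := by rw [hK]; ring
      have q6 : C₀ * (2 * D + 2 * (1 / (4 * (C₀ + 1)) * M ^ 2 + C₁ * N ^ 2) + z ^ 2) =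
          2 * (C₀ * D) + C₀ * (2 * (1 / (4 * (C₀ + 1)) * M ^ 2)) + 2 * (C₀ * C₁ * N ^ 2) +
          C₀ * z ^ 2 := by ring
      linarith [sq_nonneg N, sq_nonneg z, mul_nonneg hC₀ hD0]
    refine (abs_le_of_sq_le_sq' (hM2.trans ?_) (by positivity)).2
    rw [mul_pow, Real.sq_sqrt hK0.le]
    gcongr
    have hDs := Real.sq_sqrt hD0
    have q1 : 0 ≤ √D * N := by positivity
    have q2 : 0 ≤ √D * z := by positivity
    have q3 : 0 ≤ N * z := by positivity
    linarith [show (√D + N + z) ^ 2 = √D ^ 2 + N ^ 2 + z ^ 2 + 2 * (√D * N) + 2 * (√D * z) +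
      2 * (N * z) by ring]
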